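/- Assume (R4). Let C be a field of characteristic p > 0, t ∈ C, and suppose there exists a perfect subfield C₀ ⊆ C such that C/C₀(t) is separable algebraic. If (F,v) and (F′,v′) are henselian nontrivially valued fields extending the trivially valued field C which satisfy UR(t), and the residue fields Fv and F′v′ have the same universal/existential 𝔏_ring(C)-theory, then (F,v) and (F′,v′) have the same universal/existential 𝔏_val(C)-theory. -/

import Mathlib

open FirstOrder Language

/-- The language with a single unary relation symbol `𝒪`. -/
def LO : Language :=
  ⟨fun _ => Empty, fun n => match n with | 1 => PUnit | _ => Empty⟩

/-- The one-sorted language of valued fields `𝔏_val = 𝔏_ring ∪ {𝒪}`. -/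
def Lval : Language := Language.ring.sum LO

/-- The `LO`-structure on a type given by a subset interpreting `𝒪`. -/
def LOStructure {F : Type*} (O : Set F) : LO.Structure F where
  funMap := fun f _ => f.elim
  RelMap := fun {n} r x =>
    match n, r, x with
    | 1, _, x => x 0 ∈ O

/-- The canonical `ring`-structure on a field. -/
noncomputable def ringStructure (F : Type*) [Field F] : Language.ring.Structure F :=
  (Ring.compatibleRingOfRing F).toStructure

/-- The `Lval`-structure of a valued field, `𝒪` interpreted as the valuation ring. -/
noncomputable def valStructure (F : Type*) [Field F] (O : ValuationSubring F) :
    Lval.Structure F :=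
  letI := ringStructure F
  letI := LOStructure (O : Set F)
  Language.sumStructure _ _ F

/-- The `Lval[[C]]`-structure of a valued field with constants interpreted via `ι`. -/
noncomputable def valCStructure (C : Type*) (F : Type*) [Field F] (ι : C → F)
    (O : ValuationSubring F) : (Lval[[C]]).Structure F :=
  letI := valStructure F O
  letI := constantsOn.structure ι
  Language.sumStructure _ _ F

/-- The `ring[[C]]`-structure on a field with constants interpreted via `ι`. -/
noncomputable def ringCStructure (C : Type*) (F : Type*) [Field F] (ι : C → F) :
    (Language.ring[[C]]).Structure F :=
  letI := ringStructure F
  letI := constantsOn.structure ι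
  Language.sumStructure _ _ F

/-- Satisfaction of an `𝔏_val`-sentence in a valued field. -/
def SatV {F : Type*} [Field F] (O : ValuationSubring F) (φ : Lval.Sentence) : Prop :=
  letI := valStructure F O
  F ⊨ φ

/-- Satisfaction of an `𝔏_val(C)`-sentence in a valued field with constants `ι`. -/
def SatVC (C : Type*) {F : Type*} [Field F] (ι : C → F) (O : ValuationSubring F)
    (φ : (Lval[[C]]).Sentence) : Prop :=
  letI := valCStructure C F ι O
  F ⊨ φ

/-- Satisfaction of an `𝔏_ring`-sentence in a field. -/
def SatR (F : Type*) [Field F] (φ : Language.ring.Sentence) : Prop :=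
  letI := ringStructure F
  F ⊨ φ

/-- Satisfaction of an `𝔏_ring(C)`-sentence in a field with constants `ι`. -/
def SatRC (C : Type*) (F : Type*) [Field F] (ι : C → F)
    (φ : (Language.ring[[C]]).Sentence) : Prop :=
  letI := ringCStructure C F ι
  F ⊨ φ

/-- An existential sentence: a quantifier-free formula with all variables
existentially quantified. -/
def IsExistentialSen {L : Language} (φ : L.Sentence) : Prop :=
  ∃ (n : ℕ) (ψ : L.BoundedFormula Empty n), ψ.IsQF ∧ φ = ψ.exs

/-- A universal sentence. -/
def IsUniversalSen {L : Language} (φ : L.Sentence) : Prop :=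
  ∃ (n : ℕ) (ψ : L.BoundedFormula Empty n), ψ.IsQF ∧ φ = ψ.alls

/-- A universal/existential sentence: a finite conjunction/disjunction combination of
existential and universal sentences. -/
inductive IsUE {L : Language} : L.Sentence → Prop
  | ex {φ} : IsExistentialSen φ → IsUE φ
  | all {φ} : IsUniversalSen φ → IsUE φ
  | inf {φ ψ} : IsUE φ → IsUE ψ → IsUE (φ ⊓ ψ)
  | sup {φ ψ} : IsUE φ → IsUE ψ → IsUE (φ ⊔ ψ)
/-- A place of a function field `K` over `k` (given by `ι : k →+* K`): a nontrivial
valuation subring of `K` containing (the image of) `k`. -/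
def IsPlace {k K : Type*} [Field k] [Field K] (ι : k →+* K) (O : ValuationSubring K) : Prop :=
  O ≠ ⊤ ∧ ∀ c, ι c ∈ O

/-- `K/k` is a function field of one variable: finitely generated of transcendence
degree 1 (equivalently, finite over `k(t)` for some transcendental `t`), with `k`
relatively algebraically closed in `K`. -/
structure IsFunctionField (k K : Type*) [Field k] [Field K] [Algebra k K] : Prop where
  exists_primitive : ∃ t : K, Transcendental k t ∧
    FiniteDimensional ↥(IntermediateField.adjoin k {t}) K
  constants_closed : ∀ x : K, IsAlgebraic k x → ∃ c : k, algebraMap k K c = x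

section Completion

variable (K : Type*) [Field K] (v : ValuationSubring K)

/-- The completion `K̂_v` of the valued field `(K, v)`. -/
noncomputable def Cmpl : Type _ :=
  letI := Valued.mk' v.valuation
  UniformSpace.Completion K

noncomputable instance : Field (Cmpl K v) :=
  letI := Valued.mk' v.valuation
  UniformSpace.Completion.instField

/-- The valuation ring of the canonical extension of `v` to the completion `K̂_v`. -/
noncomputable def cmplO : ValuationSubring (Cmpl K v) := by
  letI := Valued.mk' v.valuation
  letI : Field (UniformSpace.Completion K) := UniformSpace.Completion.instField
  letI : Valued (UniformSpace.Completion K) v.ValueGroup := Valued.valuedCompletion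
  exact (Valued.v : Valuation (UniformSpace.Completion K) v.ValueGroup).valuationSubring

/-- The canonical embedding of `K` into its completion `K̂_v`. -/
noncomputable def cmplEmb : K →+* Cmpl K v := by
  letI := Valued.mk' v.valuation
  letI : Field (UniformSpace.Completion K) := UniformSpace.Completion.instField
  exact UniformSpace.Completion.coeRingHom

end Completion

section Residue

variable {F : Type*} [Field F] (O : ValuationSubring F)

/-- The residue field `Fv` of a valued field. -/
noncomputable abbrev ResF := IsLocalRing.ResidueField ↥O

/-- The interpretation of constants from `C` in the residue field, via the residue map. -/
noncomputable def resConst {C : Type*} (ι : C → F) (h : ∀ c, ι c ∈ O) :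
    C → ResF O :=
  fun c => IsLocalRing.residue _ ⟨ι c, h c⟩

/-- The interpretation of constants from `C` in the residue field, via the residue map,
extended by `0` outside the valuation ring. -/
noncomputable def resConstExt {C : Type*} (ι : C → F) : C → ResF O :=
  open scoped Classical in
  fun c => if h : ι c ∈ O then IsLocalRing.residue _ ⟨ι c, h⟩ else 0

end Residue

/-- A field is pseudofinite if it is infinite and models the first-order theory of
the class of all finite fields. -/
def IsPseudofinite (F : Type*) [Field F] : Prop :=
  Infinite F ∧ ∀ φ : Language.ring.Sentence,
    (∀ (E : Type) (_ : Field E) (_ : Finite E), SatR E φ) → SatR F φ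
/-- The residue ring homomorphism `C →+* Fv` of a valued field extending the trivially
valued field `C`. -/
noncomputable def resRingHom {F : Type*} [Field F] (O : ValuationSubring F) {C : Type*}
    [Field C] (ι : C →+* F) (h : ∀ c, ι c ∈ O) : C →+* ResF O :=
  (IsLocalRing.residue ↥O).comp (ι.codRestrict O h)

/-- `C` has imperfect exponent at most `1`, i.e. `[C : Cᵖ] ≤ p` in characteristic `p`
(no condition in characteristic `0`). -/
def ImperfectExpLEOne (C : Type*) [Field C] : Prop :=
  ∀ p : ℕ, p.Prime → ringChar C = p →
    Module.rank ↥(Subfield.closure {x : C | ∃ y : C, y ^ p = x}) C ≤ p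

/-- The field extension `F/C` (along `ι`) is separable: its base change to every field
extension of `C` is reduced. -/
def SeparableExt {C F : Type*} [Field C] [Field F] (ι : C →+* F) : Prop :=
  ∀ (E : Type) (_ : Field E) (j : C →+* E),
    letI := ι.toAlgebra
    letI := j.toAlgebra
    IsReduced (TensorProduct C F E)
/-- `π` is a uniformiser for the valuation with valuation ring `O`: an element of minimal
positive value. -/
def IsUniformiser {F : Type*} [Field F] (O : ValuationSubring F) (π : F) : Prop :=
  O.valuation π < 1 ∧ ∀ y : F, O.valuation y < 1 → O.valuation y ≤ O.valuation π

/-- The property `UR(t)` of a valued field of characteristic `p` containing `t`: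
for every `s`, the element `t - sᵖ` has non-positive value or is a uniformiser. -/
def URt {F : Type*} [Field F] (O : ValuationSubring F) (p : ℕ) (t : F) : Prop :=
  ∀ s : F, 1 ≤ O.valuation (t - s ^ p) ∨ IsUniformiser O (t - s ^ p)

/-- `L` is existentially closed in `F` along the embedding `j`: every existential
`𝔏_ring(L)`-sentence (with constants from `L`) true in `F` is true in `L`. -/
def ExistentiallyClosedIn {L F : Type} [Field L] [Field F] (j : L →+* F) : Prop :=
  ∀ φ : (Language.ring[[L]]).Sentence, IsExistentialSen φ →
    SatRC L F (⇑j) φ → SatRC L L id φ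

/-- The axiom (R4): every field `L` existentially closed in `L((t))` is existentially
closed in every extension `F/L` admitting a valuation trivial on `L` with residue
field `L`. -/
def R4 : Prop :=
  ∀ (L : Type) (_ : Field L),
    ExistentiallyClosedIn (algebraMap L (LaurentSeries L)) →
    ∀ (F : Type) (_ : Field F) (j : L →+* F),
      (∃ (O : ValuationSubring F) (h : ∀ x : L, j x ∈ O),
        (∀ x : L, x ≠ 0 → (j x)⁻¹ ∈ O) ∧
        Function.Surjective ⇑(resRingHom O j h)) →
      ExistentiallyClosedIn j

/-- `t` is a separating element of the function field `K/k`: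
`K/k(t)` is finite and separable. -/
def IsSeparating (k : Type*) {K : Type*} [Field k] [Field K] [Algebra k K] (t : K) : Prop :=
  Transcendental k t ∧ FiniteDimensional ↥(IntermediateField.adjoin k {t}) K ∧
    Algebra.IsSeparable ↥(IntermediateField.adjoin k {t}) K

/-- The place `O` of `K` is unramified over the rational subfield `k(t)`:
some element of `k(t)` is a uniformiser for `O` (i.e. the ramification index is `1`). -/
def UnramifiedOver (k : Type*) {K : Type*} [Field k] [Field K] [Algebra k K] (t : K)
    (O : ValuationSubring K) : Prop :=
  ∃ d : K, d ∈ IntermediateField.adjoin k {t} ∧ IsUniformiser O d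

/-- `RingApprox 𝓕` says that, along the filter `𝓕` of functions between two fields, every finite
piece of the ring structure is eventually respected. -/
structure RingApprox {A B : Type*} [Field A] [Field B] (𝓕 : Filter (A → B)) : Prop where
  map_add : ∀ a b, ∀ᶠ f in 𝓕, f (a + b) = f a + f b
  map_mul : ∀ a b, ∀ᶠ f in 𝓕, f (a * b) = f a * f b
  map_one : ∀ᶠ f in 𝓕, f 1 = 1

/-- `Emb ιA OA ιB OB`: the field `A` with distinguished subset `OA` and constants `ιA`
is finitely approximable in `B`, i.e. embeds into an elementary extension of `B`. -/
def Emb {C A B : Type*} [Field A] [Field B] (ιA : C → A) (OA : Set A) (ιB : C → B)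
    (OB : Set B) : Prop :=
  ∃ 𝓕 : Filter (A → B), 𝓕.NeBot ∧ RingApprox 𝓕 ∧ (∀ a, ∀ᶠ f in 𝓕, (f a ∈ OB ↔ a ∈ OA)) ∧
    ∀ c, ∀ᶠ f in 𝓕, f (ιA c) = ιB c

namespace RingApprox

variable {A B : Type*} [Field A] [Field B] {𝓕 : Filter (A → B)}

lemma map_zero (h : RingApprox 𝓕) : ∀ᶠ f in 𝓕, f 0 = 0 := by
  filter_upwards [h.map_add 0 0] with f hf
  simpa using hf

lemma map_neg (h : RingApprox 𝓕) (a : A) : ∀ᶠ f in 𝓕, f (-a) = - f a := by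
  filter_upwards [h.map_add (-a) a, h.map_zero] with f hf h0
  rw [neg_add_cancel, h0] at hf
  exact eq_neg_of_add_eq_zero_left hf.symm

lemma map_sub (h : RingApprox 𝓕) (a b : A) : ∀ᶠ f in 𝓕, f (a - b) = f a - f b := by
  filter_upwards [h.map_add (a - b) b] with f hf
  rw [sub_add_cancel] at hf
  rw [hf]; ring

lemma map_pow (h : RingApprox 𝓕) (a : A) (n : ℕ) : ∀ᶠ f in 𝓕, f (a ^ n) = f a ^ n := by
  induction n with
  | zero => simpa using h.map_one
  | succ n ih =>
    filter_upwards [ih, h.map_mul (a ^ n) a] with f h1 h2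
    rw [pow_succ, h2, h1, pow_succ]

lemma map_ne_zero (h : RingApprox 𝓕) {a : A} (ha : a ≠ 0) : ∀ᶠ f in 𝓕, f a ≠ 0 := by
  filter_upwards [h.map_mul a a⁻¹, h.map_one] with f hf h1 h0
  rw [mul_inv_cancel₀ ha, h1, h0, zero_mul] at hf
  exact one_ne_zero hf

lemma map_ne (h : RingApprox 𝓕) {a b : A} (hab : a ≠ b) : ∀ᶠ f in 𝓕, f a ≠ f b := by
  filter_upwards [h.map_ne_zero (sub_ne_zero.2 hab), h.map_sub a b] with f h1 h2 h3
  rw [h2, h3, sub_self] at h1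
  exact h1 rfl

end RingApprox

section QF

variable {L : Language} {A B : Type*} [L.Structure A] [L.Structure B] {𝓕 : Filter (A → B)}

lemma eventually_realize_term
    (hfun : ∀ n (F : L.Functions n) (x : Fin n → A), ∀ᶠ f in 𝓕,
      f (Structure.funMap F x) = Structure.funMap F (f ∘ x))
    {α : Type*} (τ : L.Term α) (x : α → A) :
    ∀ᶠ f in 𝓕, τ.realize (f ∘ x) = f (τ.realize x) := by
  induction τ with
  | var i => exact Filter.Eventually.of_forall fun f => rfl
  | func F ts ih =>
    have := Filter.eventually_all.2 ih
    filter_upwards [this, hfun _ F fun i => (ts i).realize x] with f h1 h2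
    simp only [Term.realize_func, h2]
    congr 1
    funext i
    exact h1 i

lemma eventually_realize_qf
    (hfun : ∀ n (F : L.Functions n) (x : Fin n → A), ∀ᶠ f in 𝓕,
      f (Structure.funMap F x) = Structure.funMap F (f ∘ x))
    (hrel : ∀ n (R : L.Relations n) (x : Fin n → A), ∀ᶠ f in 𝓕,
      (Structure.RelMap R (f ∘ x) ↔ Structure.RelMap R x))
    (hinj : ∀ a b : A, a ≠ b → ∀ᶠ f in 𝓕, f a ≠ f b)
    {n : ℕ} {ψ : L.BoundedFormula Empty n} (hψ : ψ.IsQF) (x : Fin n → A) :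
    ∀ᶠ f in 𝓕, (ψ.Realize default (f ∘ x) ↔ ψ.Realize default x) := by
  have term (τ : L.Term (Empty ⊕ Fin n)) : ∀ᶠ f in 𝓕,
      τ.realize (Sum.elim (default : Empty → B) (f ∘ x)) =
        f (τ.realize (Sum.elim default x)) := by
    filter_upwards [eventually_realize_term hfun τ (Sum.elim default x)] with f hf
    rw [← hf]
    congr 1
    funext i
    rcases i with i | i
    · exact i.elim
    · rfl
  induction hψ with
  | falsum => exact Filter.Eventually.of_forall fun f => Iff.rfl
  | of_isAtomic h =>
    cases h with
    | equal t₁ t₂ =>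
      simp only [BoundedFormula.realize_bdEqual]
      by_cases h : t₁.realize (Sum.elim (default : Empty → A) x) = t₂.realize (Sum.elim default x)
      · filter_upwards [term t₁, term t₂] with f h1 h2
        rw [h1, h2]
        exact iff_of_true (congrArg f h) h
      · filter_upwards [term t₁, term t₂, hinj _ _ h] with f h1 h2 h3
        rw [h1, h2]
        exact iff_of_false h3 h
    | rel R ts =>
      simp only [BoundedFormula.realize_rel]
      filter_upwards [Filter.eventually_all.2 fun i => term (ts i),
        hrel _ R fun i => (ts i).realize (Sum.elim default x)] with f h1 h2
      rw [← h2]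
      have : (fun i => (ts i).realize (Sum.elim (default : Empty → B) (f ∘ x))) =
          f ∘ fun i => (ts i).realize (Sum.elim default x) := funext h1
      rw [this]
  | imp h₁ h₂ ih₁ ih₂ =>
    filter_upwards [ih₁, ih₂] with f h1 h2
    simp only [BoundedFormula.realize_imp, h1, h2]

lemma realize_existential_of_eventually [𝓕.NeBot]
    (hfun : ∀ n (F : L.Functions n) (x : Fin n → A), ∀ᶠ f in 𝓕,
      f (Structure.funMap F x) = Structure.funMap F (f ∘ x))
    (hrel : ∀ n (R : L.Relations n) (x : Fin n → A), ∀ᶠ f in 𝓕,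
      (Structure.RelMap R (f ∘ x) ↔ Structure.RelMap R x))
    (hinj : ∀ a b : A, a ≠ b → ∀ᶠ f in 𝓕, f a ≠ f b)
    {φ : L.Sentence} (hφ : IsExistentialSen φ) (h : A ⊨ φ) : B ⊨ φ := by
  obtain ⟨n, ψ, hψ, rfl⟩ := hφ
  obtain ⟨x, hx⟩ := BoundedFormula.realize_exs.1 h
  obtain ⟨f, hf⟩ := (eventually_realize_qf hfun hrel hinj hψ x).exists
  exact BoundedFormula.realize_exs.2 ⟨f ∘ x, hf.2 hx⟩

end QF

section Fields

variable {C A B : Type} [Field A] [Field B] {ιA : C → A} {ιB : C → B}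

lemma RingApprox.eventually_funMap {𝓕 : Filter (A → B)} (h : RingApprox 𝓕) (n : ℕ)
    (F : Language.ring.Functions n) (x : Fin n → A) :
    ∀ᶠ f in 𝓕, f ((ringStructure A).funMap F x) = (ringStructure B).funMap F (f ∘ x) := by
  cases F with
  | add => exact h.map_add (x 0) (x 1)
  | mul => exact h.map_mul (x 0) (x 1)
  | neg => exact h.map_neg (x 0)
  | zero => exact h.map_zero
  | one => exact h.map_one

lemma eventually_funMap_constants {𝓕 : Filter (A → B)} (h : ∀ c, ∀ᶠ f in 𝓕, f (ιA c) = ιB c)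
    (n : ℕ) (F : (constantsOn C).Functions n) (x : Fin n → A) :
    ∀ᶠ f in 𝓕, f ((constantsOn.structure ιA).funMap F x) =
      (constantsOn.structure ιB).funMap F (f ∘ x) := by
  match n, F with
  | 0, c => exact h c
  | 1, c => exact c.elim
  | (_ + 2), c => exact c.elim

/-- Existential sentences of valued fields transfer along approximate embeddings. -/
lemma Emb.satVC {OA : ValuationSubring A} {OB : ValuationSubring B}
    (h : Emb ιA (OA : Set A) ιB (OB : Set B)) {φ : (Lval[[C]]).Sentence}
    (hφ : IsExistentialSen φ) (hA : SatVC C ιA OA φ) : SatVC C ιB OB φ := by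
  obtain ⟨𝓕, hne, hr, hO, hC⟩ := h
  let _ := valCStructure C A ιA OA
  let _ := valCStructure C B ιB OB
  refine realize_existential_of_eventually (𝓕 := 𝓕) ?_ ?_ (fun _ _ => hr.map_ne) hφ hA
  · rintro n ((F | F) | F) x
    · exact hr.eventually_funMap n F x
    · exact F.elim
    · exact eventually_funMap_constants hC n F x
  · rintro n ((R | R) | R) x
    · exact R.elim
    · match n, R with
      | 0, R => exact R.elim
      | 1, R => exact hO (x 0)
      | (_ + 2), R => exact R.elim
    · match n, R with
      | 0, R => exact R.elim
      | (_ + 1), R => exact R.elim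

/-- Existential sentences of fields transfer along approximate embeddings. -/
lemma Emb.satRC (h : Emb ιA Set.univ ιB Set.univ) {φ : (Language.ring[[C]]).Sentence}
    (hφ : IsExistentialSen φ) (hA : SatRC C A ιA φ) : SatRC C B ιB φ := by
  obtain ⟨𝓕, hne, hr, hO, hC⟩ := h
  let _ := ringCStructure C A ιA
  let _ := ringCStructure C B ιB
  refine realize_existential_of_eventually (𝓕 := 𝓕) ?_ ?_ (fun _ _ => hr.map_ne) hφ hA
  · rintro n (F | F) x
    · exact hr.eventually_funMap n F x
    · exact eventually_funMap_constants hC n F x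
  · rintro n (R | R) x
    · exact R.elim
    · match n, R with
      | 0, R => exact R.elim
      | (_ + 1), R => exact R.elim

/-- Existence of a quantifier free formula describing finitely many conditions. -/
lemma exists_qf_forall_mem {L : Language} [L.Structure A] [L.Structure B] {n : ℕ} {D : Type*}
    (P : D → (Fin n → B) → Prop) (a : Fin n → A)
    (h : ∀ d, ∃ ψ : L.BoundedFormula Empty n, ψ.IsQF ∧ ψ.Realize default a ∧
      ∀ b : Fin n → B, ψ.Realize default b → P d b) (s : Finset D) :
    ∃ ψ : L.BoundedFormula Empty n, ψ.IsQF ∧ ψ.Realize default a ∧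
      ∀ b : Fin n → B, ψ.Realize default b → ∀ d ∈ s, P d b := by
  classical
  induction s using Finset.induction_on with
  | empty => exact ⟨⊤, BoundedFormula.IsQF.top, BoundedFormula.realize_top.2 trivial, by simp⟩
  | insert d s hd ih =>
    obtain ⟨ψ, h1, h2, h3⟩ := ih
    obtain ⟨ψ', h1', h2', h3'⟩ := h d
    refine ⟨ψ' ⊓ ψ, h1'.inf h1, BoundedFormula.realize_inf.2 ⟨h2', h2⟩, fun b hb e he => ?_⟩
    rw [BoundedFormula.realize_inf] at hb
    rcases Finset.mem_insert.1 he with rfl | he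
    · exact h3' b hb.1
    · exact h3 b hb.2 e he

/-- The conditions making up the diagram of `A` with constants. -/
def DiagCond (ιA : C → A) (ιB : C → B) : (A × A) ⊕ (A × A) ⊕ Unit ⊕ C → (A → B) → Prop
  | .inl (a, b), f => f (a + b) = f a + f b
  | .inr (.inl (a, b)), f => f (a * b) = f a * f b
  | .inr (.inr (.inl _)), f => f 1 = 1
  | .inr (.inr (.inr c)), f => f (ιA c) = ιB c

lemma emb_univ_of_finite (h : ∀ s : Finset ((A × A) ⊕ (A × A) ⊕ Unit ⊕ C), ∃ f : A → B,
    ∀ d ∈ s, DiagCond ιA ιB d f) : Emb ιA Set.univ ιB Set.univ := by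
  choose g hg using h
  have key (d) : ∀ᶠ f in Filter.map g Filter.atTop, DiagCond ιA ιB d f := by
    rw [Filter.eventually_map]
    filter_upwards [Filter.eventually_ge_atTop {d}] with s hs
    exact hg s d (hs (Finset.mem_singleton_self d))
  exact ⟨Filter.map g Filter.atTop, inferInstance,
    ⟨fun a b => key (.inl (a, b)), fun a b => key (.inr (.inl (a, b))),
      key (.inr (.inr (.inl ())))⟩, by simp, fun c => key (.inr (.inr (.inr c)))⟩

/-- If existential sentences transfer, then there is an approximate embedding. -/
lemma emb_univ_of_satRC (h : ∀ φ : (Language.ring[[C]]).Sentence, IsExistentialSen φ →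
    SatRC C A ιA φ → SatRC C B ιB φ) : Emb ιA Set.univ ιB Set.univ := by
  classical
  refine emb_univ_of_finite fun s => ?_
  let E : (A × A) ⊕ (A × A) ⊕ Unit ⊕ C → Finset A := fun d => match d with
    | .inl (a, b) => {a, b, a + b}
    | .inr (.inl (a, b)) => {a, b, a * b}
    | .inr (.inr (.inl _)) => {1}
    | .inr (.inr (.inr c)) => {ιA c}
  let T : Finset A := s.biUnion E
  let e : T ≃ Fin T.card := T.equivFin
  let a : Fin T.card → A := fun i => (e.symm i : A)
  let g : (Fin T.card → B) → A → B := fun b x => if hx : x ∈ T then b (e ⟨x, hx⟩) else 0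
  letI iA := ringCStructure C A ιA
  letI iB := ringCStructure C B ιB
  have hT {d} (hd : d ∈ s) {x} (hx : x ∈ E d) : x ∈ T := Finset.mem_biUnion.2 ⟨d, hd, hx⟩
  have hg (b) (x) (hx : x ∈ T) : g b x = b (e ⟨x, hx⟩) := dif_pos hx
  have ha (x) (hx : x ∈ T) : a (e ⟨x, hx⟩) = x := by simp [a]
  let v (x : A) (hx : x ∈ T) : (Language.ring[[C]]).Term (Empty ⊕ Fin T.card) :=
    Term.var (Sum.inr (e ⟨x, hx⟩))
  have key (d : s) : ∃ ψ : (Language.ring[[C]]).BoundedFormula Empty T.card, ψ.IsQF ∧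
      ψ.Realize default a ∧ ∀ b : Fin T.card → B, ψ.Realize default b →
        DiagCond ιA ιB d (g b) := by
    obtain ⟨d, hd⟩ := d
    have hE (x) : x ∈ E d → x ∈ T := hT hd
    rcases d with ⟨x, y⟩ | ⟨x, y⟩ | _ | c
    · have hx := hE x (by simp [E])
      have hy := hE y (by simp [E])
      have hxy := hE (x + y) (by simp [E])
      refine ⟨(v _ hxy).bdEqual (Term.func (Sum.inl .add) ![v x hx, v y hy]),
        (BoundedFormula.IsAtomic.equal _ _).isQF, ?_, fun b hb => ?_⟩
      · rw [BoundedFormula.realize_bdEqual]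
        exact (ha _ hxy).trans (congrArg₂ (· + ·) (ha x hx) (ha y hy)).symm
      · rw [BoundedFormula.realize_bdEqual] at hb
        change g b (x + y) = g b x + g b y
        rw [hg b _ hx, hg b _ hy, hg b _ hxy]
        exact hb
    · have hx := hE x (by simp [E])
      have hy := hE y (by simp [E])
      have hxy := hE (x * y) (by simp [E])
      refine ⟨(v _ hxy).bdEqual (Term.func (Sum.inl .mul) ![v x hx, v y hy]),
        (BoundedFormula.IsAtomic.equal _ _).isQF, ?_, fun b hb => ?_⟩
      · rw [BoundedFormula.realize_bdEqual]
        exact (ha _ hxy).trans (congrArg₂ (· * ·) (ha x hx) (ha y hy)).symm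
      · rw [BoundedFormula.realize_bdEqual] at hb
        change g b (x * y) = g b x * g b y
        rw [hg b _ hx, hg b _ hy, hg b _ hxy]
        exact hb
    · have hx := hE 1 (by simp [E])
      refine ⟨(v _ hx).bdEqual (Term.func (Sum.inl .one) ![]),
        (BoundedFormula.IsAtomic.equal _ _).isQF, ?_, fun b hb => ?_⟩
      · rw [BoundedFormula.realize_bdEqual]
        exact ha _ hx
      · rw [BoundedFormula.realize_bdEqual] at hb
        change g b 1 = 1
        rw [hg b _ hx]
        exact hb
    · have hx := hE (ιA c) (by simp [E])
      let τ : (Language.ring[[C]]).Term (Empty ⊕ Fin T.card) :=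
        Term.func (l := 0) (Sum.inr c) ![]
      refine ⟨(v _ hx).bdEqual τ,
        (BoundedFormula.IsAtomic.equal _ _).isQF, ?_, fun b hb => ?_⟩
      · rw [BoundedFormula.realize_bdEqual]
        exact ha _ hx
      · rw [BoundedFormula.realize_bdEqual] at hb
        change g b (ιA c) = ιB c
        rw [hg b _ hx]
        exact hb
  obtain ⟨ψ, h1, h2, h3⟩ := exists_qf_forall_mem (L := Language.ring[[C]]) (A := A) (B := B)
    (fun (d : s) b => DiagCond ιA ιB d (g b)) a key Finset.univ
  obtain ⟨b, hb⟩ := BoundedFormula.realize_exs.1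
    (h ψ.exs ⟨_, ψ, h1, rfl⟩ (BoundedFormula.realize_exs.2 ⟨a, h2⟩))
  exact ⟨g b, fun d hd => h3 b hb ⟨d, hd⟩ (Finset.mem_univ _)⟩

end Fields

section EmbCalculus

variable {C A B D : Type*} [Field A] [Field B] [Field D] {ιA : C → A} {ιB : C → B} {ιD : C → D}
  {OA : Set A} {OB : Set B} {OD : Set D}

lemma Emb.trans (h : Emb ιA OA ιB OB) (h' : Emb ιB OB ιD OD) : Emb ιA OA ιD OD := by
  obtain ⟨𝓕, hne, hr, hO, hC⟩ := h
  obtain ⟨𝓖, hne', hr', hO', hC'⟩ := h'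
  have key {P : (A → B) → Prop} {Q : (A → B) → (B → D) → Prop} {R : (A → D) → Prop}
      (hP : ∀ᶠ f in 𝓕, P f) (hQ : ∀ f, P f → ∀ᶠ g in 𝓖, Q f g)
      (hR : ∀ f g, P f → Q f g → R (g ∘ f)) :
      ∀ᶠ k in 𝓕.bind (fun f => 𝓖.map (fun g => g ∘ f)), R k := by
    rw [Filter.eventually_bind]
    filter_upwards [hP] with f hf
    rw [Filter.eventually_map]
    filter_upwards [hQ f hf] with g hg
    exact hR f g hf hg
  refine ⟨𝓕.bind (fun f => 𝓖.map (fun g => g ∘ f)), ?_, ⟨fun a b => ?_, fun a b => ?_, ?_⟩,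
    fun a => ?_, fun c => ?_⟩
  · rw [← Filter.frequently_true_iff_neBot]
    intro hcon
    rw [Filter.eventually_bind] at hcon
    obtain ⟨f, hf⟩ := hcon.exists
    rw [Filter.eventually_map] at hf
    exact hf.exists.elim fun g hg => hg trivial
  · refine key (hr.map_add a b) (fun f hf => hr'.map_add (f a) (f b)) fun f g hf hg => ?_
    simp only [Function.comp, hf, hg]
  · refine key (hr.map_mul a b) (fun f hf => hr'.map_mul (f a) (f b)) fun f g hf hg => ?_
    simp only [Function.comp, hf, hg]
  · refine key hr.map_one (fun f hf => hr'.map_one) fun f g hf hg => ?_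
    simp only [Function.comp, hf, hg]
  · refine key (hO a) (fun f hf => hO' (f a)) fun f g hf hg => ?_
    simp only [Function.comp, hg, hf]
  · refine key (hC c) (fun f hf => hC' c) fun f g hf hg => ?_
    simp only [Function.comp, hg, hf]

lemma Emb.of_ringHom (f : A →+* B) (hO : ∀ a, f a ∈ OB ↔ a ∈ OA) (hC : ∀ c, f (ιA c) = ιB c) :
    Emb ιA OA ιB OB :=
  ⟨pure (f : A → B), inferInstance, ⟨fun a b => by simp, fun a b => by simp, by simp⟩,
    fun a => Filter.eventually_pure.2 (hO a), fun c => Filter.eventually_pure.2 (hC c)⟩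

lemma Emb.univ (h : Emb ιA OA ιB OB) : Emb ιA Set.univ ιB Set.univ := by
  obtain ⟨𝓕, hne, hr, hO, hC⟩ := h
  exact ⟨𝓕, hne, hr, by simp, hC⟩

lemma Emb.comp {C' : Type*} (h : Emb ιA OA ιB OB) (φ : C' → C) :
    Emb (ιA ∘ φ) OA (ιB ∘ φ) OB := by
  obtain ⟨𝓕, hne, hr, hO, hC⟩ := h
  exact ⟨𝓕, hne, hr, hO, fun c => hC (φ c)⟩

end EmbCalculus

lemma ValuationSubring.lt_one_iff {F : Type*} [Field F] (O : ValuationSubring F) (a : F) :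
    O.valuation a < 1 ↔ a = 0 ∨ a⁻¹ ∉ O := by
  rcases eq_or_ne a 0 with rfl | ha
  · simp
  · rw [← O.valuation_le_one_iff, map_inv₀, not_le,
      one_lt_inv₀ (zero_lt_iff.2 ((Valuation.ne_zero_iff _).2 ha))]
    simp [ha]

section Ultrapower

open Filter

variable {I F : Type*} [Field F] (U : Ultrafilter I)

/-- The ultrapower of a field. -/
abbrev UP (U : Ultrafilter I) (F : Type*) := Germ (U : Filter I) F

/-- The diagonal embedding into the ultrapower. -/
noncomputable def upConst (F : Type*) [Field F] : F →+* UP U F :=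
  (Germ.coeRingHom (U : Filter I)).comp (Pi.constRingHom I F)

lemma upConst_apply (a : F) : upConst U F a = ((fun _ => a : I → F) : UP U F) := rfl

lemma up_eq {f g : I → F} : (f : UP U F) = (g : UP U F) ↔ ∀ᶠ i in U, f i = g i := Germ.coe_eq

lemma up_add (f g : I → F) : (f : UP U F) + (g : UP U F) = ((fun i => f i + g i : I → F) : UP U F) :=
  rfl

lemma up_mul (f g : I → F) : (f : UP U F) * (g : UP U F) = ((fun i => f i * g i : I → F) : UP U F) :=
  rfl

lemma up_inv (f : I → F) : (f : UP U F)⁻¹ = ((fun i => (f i)⁻¹ : I → F) : UP U F) := rfl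

lemma up_sub (f g : I → F) : (f : UP U F) - (g : UP U F) = ((fun i => f i - g i : I → F) : UP U F) :=
  rfl

lemma up_pow (f : I → F) (n : ℕ) : (f : UP U F) ^ n = ((fun i => f i ^ n : I → F) : UP U F) :=
  rfl

lemma up_one : (1 : UP U F) = ((fun _ => 1 : I → F) : UP U F) := rfl

lemma up_zero : (0 : UP U F) = ((fun _ => 0 : I → F) : UP U F) := rfl

lemma up_sum {α : Type*} (s : Finset α) (f : α → I → F) :
    ∑ a ∈ s, (f a : UP U F) = ((fun i => ∑ a ∈ s, f a i : I → F) : UP U F) := by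
  have := map_sum (Germ.coeRingHom (R := F) (U : Filter I)) f s
  rw [Germ.coe_coeRingHom] at this
  rw [← this]
  congr 1
  funext i
  simp

/-- A representative of an element of the ultrapower. -/
noncomputable def upRep (x : UP U F) : I → F := Quotient.out x

lemma upRep_spec (x : UP U F) : ((upRep U x : I → F) : UP U F) = x := Quotient.out_eq x

/-- The ultrapower of a valuation ring. -/
def upO (O : ValuationSubring F) : ValuationSubring (UP U F) where
  carrier := {x | x.LiftPred (· ∈ O)}
  mul_mem' {a b} := by
    refine Germ.inductionOn₂ a b fun f g hf hg => ?_
    filter_upwards [hf, hg] with i h1 h2 using O.mul_mem _ _ h1 h2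
  add_mem' {a b} := by
    refine Germ.inductionOn₂ a b fun f g hf hg => ?_
    filter_upwards [hf, hg] with i h1 h2 using O.add_mem _ _ h1 h2
  one_mem' := Eventually.of_forall fun _ => O.one_mem
  zero_mem' := Eventually.of_forall fun _ => O.zero_mem
  neg_mem' {a} := by
    refine Germ.inductionOn a fun f hf => ?_
    filter_upwards [hf] with i h1 using O.neg_mem _ h1
  mem_or_inv_mem' a := by
    refine Germ.inductionOn a fun f => ?_
    exact Ultrafilter.eventually_or.1 (Eventually.of_forall fun i => O.mem_or_inv_mem (f i))

lemma mem_upO {O : ValuationSubring F} {f : I → F} : (f : UP U F) ∈ upO U O ↔ ∀ᶠ i in U, f i ∈ O :=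
  Iff.rfl

lemma upConst_mem_upO {O : ValuationSubring F} {a : F} : upConst U F a ∈ upO U O ↔ a ∈ O := by
  rw [upConst_apply, mem_upO]
  exact eventually_const

lemma upO_lt_one {O : ValuationSubring F} {f : I → F} :
    (upO U O).valuation (f : UP U F) < 1 ↔ ∀ᶠ i in U, O.valuation (f i) < 1 := by
  simp only [ValuationSubring.lt_one_iff, Ultrafilter.eventually_or, Ultrafilter.eventually_not]
  rw [up_zero, up_eq, up_inv, mem_upO]

lemma upConst_lt_one {O : ValuationSubring F} {a : F} :
    (upO U O).valuation (upConst U F a) < 1 ↔ O.valuation a < 1 := by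
  rw [upConst_apply, upO_lt_one]
  exact eventually_const

lemma Emb.of_up {C A : Type*} [Field A] {ιA : C → A} {OA : Set A} {O : ValuationSubring F}
    {ι : C → F} (σ : A →+* UP U F) (hO : ∀ a, σ a ∈ upO U O ↔ a ∈ OA)
    (hC : ∀ c, σ (ιA c) = upConst U F (ι c)) : Emb ιA OA ι (O : Set F) := by
  have hrep (a : A) : ((upRep U (σ a) : I → F) : UP U F) = σ a := upRep_spec U _
  refine ⟨(U : Filter I).map fun i a => upRep U (σ a) i, inferInstance,
    ⟨fun a b => ?_, fun a b => ?_, ?_⟩, fun a => ?_, fun c => ?_⟩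
  · rw [eventually_map, ← up_eq U (f := fun i => upRep U (σ (a + b)) i)
      (g := fun i => upRep U (σ a) i + upRep U (σ b) i), ← up_add, hrep, hrep, hrep, map_add]
  · rw [eventually_map, ← up_eq U (f := fun i => upRep U (σ (a * b)) i)
      (g := fun i => upRep U (σ a) i * upRep U (σ b) i), ← up_mul, hrep, hrep, hrep, map_mul]
  · rw [eventually_map, ← up_eq U (f := fun i => upRep U (σ 1) i) (g := fun i => 1), hrep, map_one]
    rfl
  · rw [eventually_map]
    have := hO a
    rw [← hrep a, mem_upO] at this
    by_cases h : a ∈ OA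
    · filter_upwards [this.2 h] with i hi using iff_of_true hi h
    · have h' : ∀ᶠ i in U, upRep U (σ a) i ∉ O := Ultrafilter.eventually_not.2 fun h' =>
        h (this.1 h')
      filter_upwards [h'] with i hi using iff_of_false hi h
  · rw [eventually_map, ← up_eq U (f := fun i => upRep U (σ (ιA c)) i) (g := fun i => ι c), hrep, hC]
    rfl

lemma Emb.exists_up {C A : Type*} [Field A] {ιA : C → A} {OA : Set A} {O : ValuationSubring F}
    {ι : C → F} (h : Emb ιA OA ι (O : Set F)) :
    ∃ (U : Ultrafilter (A → F)) (σ : A →+* UP U F), (∀ a, σ a ∈ upO U O ↔ a ∈ OA) ∧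
      ∀ c, σ (ιA c) = upConst U F (ι c) := by
  obtain ⟨𝓕, hne, hr, hO, hC⟩ := h
  let U := Ultrafilter.of 𝓕
  have hU : (U : Filter (A → F)) ≤ 𝓕 := Ultrafilter.of_le 𝓕
  let σ : A →+* UP U F :=
    { toFun := fun a => ((fun f => f a : (A → F) → F) : UP U F)
      map_one' := (up_eq U).2 (hU hr.map_one)
      map_mul' := fun a b => (up_eq U).2 (hU (hr.map_mul a b))
      map_zero' := (up_eq U).2 (hU hr.map_zero)
      map_add' := fun a b => (up_eq U).2 (hU (hr.map_add a b)) }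
  refine ⟨U, σ, fun a => ?_, fun c => (up_eq U).2 (hU (hC c))⟩
  change (∀ᶠ f : A → F in U, f a ∈ O) ↔ a ∈ OA
  have h1 : ∀ᶠ f : A → F in U, (f a ∈ O ↔ a ∈ OA) := hU (hO a)
  rw [eventually_congr h1, eventually_const]

lemma Emb.of_upConst {C : Type*} {O : ValuationSubring F} {ι : C → F} :
    Emb (upConst U F ∘ ι) (upO U O : Set (UP U F)) ι (O : Set F) :=
  Emb.of_up U (RingHom.id _) (fun _ => Iff.rfl) fun _ => rfl

end Ultrapower

section Valuations

variable {F : Type*} [Field F] (O : ValuationSubring F)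

lemma ValuationSubring.lt_one_of_le {O O' : ValuationSubring F} (h : O ≤ O') {a : F}
    (ha : O'.valuation a < 1) : O.valuation a < 1 := by
  rw [ValuationSubring.lt_one_iff] at ha ⊢
  exact ha.imp_right fun h1 h2 => h1 (h h2)

lemma ValuationSubring.mem_of_lt_one {a : F} (h : O.valuation a < 1) : a ∈ O :=
  (O.valuation_le_one_iff a).1 h.le

lemma ValuationSubring.mul_lt_one {a b : F} (h : O.valuation a < 1) (hb : b ∈ O) :
    O.valuation (a * b) < 1 := by
  rw [map_mul]
  exact mul_lt_one_of_lt_of_le h ((O.valuation_le_one_iff b).2 hb)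

lemma ValuationSubring.mul_lt_one' {a b : F} (ha : a ∈ O) (h : O.valuation b < 1) :
    O.valuation (a * b) < 1 := by
  rw [mul_comm]
  exact O.mul_lt_one h ha

lemma ValuationSubring.add_lt_one {a b : F} (ha : O.valuation a < 1) (hb : O.valuation b < 1) :
    O.valuation (a + b) < 1 := (O.valuation.map_add a b).trans_lt (max_lt ha hb)

lemma ValuationSubring.sub_lt_one {a b : F} (ha : O.valuation a < 1) (hb : O.valuation b < 1) :
    O.valuation (a - b) < 1 := (O.valuation.map_sub a b).trans_lt (max_lt ha hb)

lemma ValuationSubring.sub_mem' {a b : F} (ha : a ∈ O) (hb : b ∈ O) : a - b ∈ O :=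
  O.toSubring.sub_mem ha hb

lemma ValuationSubring.pow_mem' {a : F} (ha : a ∈ O) (n : ℕ) : a ^ n ∈ O :=
  O.toSubring.pow_mem ha n

lemma ValuationSubring.pow_lt_one {a : F} (h : O.valuation a < 1) {n : ℕ} (hn : n ≠ 0) :
    O.valuation (a ^ n) < 1 := by
  rw [map_pow]
  exact pow_lt_one₀ zero_le h hn

lemma ValuationSubring.sum_mem' {α : Type*} {s : Finset α} {f : α → F} (h : ∀ i ∈ s, f i ∈ O) :
    ∑ i ∈ s, f i ∈ O := O.toSubring.sum_mem h

lemma ValuationSubring.sum_lt_one {α : Type*} {s : Finset α} {f : α → F}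
    (h : ∀ i ∈ s, O.valuation (f i) < 1) : O.valuation (∑ i ∈ s, f i) < 1 :=
  Valuation.map_sum_lt _ one_ne_zero h

lemma ValuationSubring.valuation_eq_one_iff' {a : F} (ha : a ≠ 0) :
    O.valuation a = 1 ↔ a ∈ O ∧ a⁻¹ ∈ O := by
  rw [← O.valuation_le_one_iff, ← O.valuation_le_one_iff, map_inv₀,
    inv_le_one₀ (zero_lt_iff.2 ((Valuation.ne_zero_iff _).2 ha))]
  exact le_antisymm_iff

lemma ValuationSubring.exists_lt_one {O : ValuationSubring F} (h : O ≠ ⊤) :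
    ∃ π, π ≠ 0 ∧ O.valuation π < 1 := by
  by_contra! hc
  refine h (top_unique fun x _ => ?_)
  by_contra hx
  have hx0 : x ≠ 0 := fun h => hx (h ▸ O.zero_mem)
  have := hc x⁻¹ (inv_ne_zero hx0)
  rw [map_inv₀, one_le_inv₀ (zero_lt_iff.2 ((Valuation.ne_zero_iff _).2 hx0)),
    O.valuation_le_one_iff] at this
  exact hx this

end Valuations

/-- A form of Hensel's lemma which is first order over the valued field. -/
def HenF {F : Type*} [Field F] (O : ValuationSubring F) : Prop :=
  ∀ (n : ℕ) (c : ℕ → F), (∀ k < n, O.valuation (c k) < 1) →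
    ∃ y ∈ O, 1 + y + ∑ k ∈ Finset.range n, c k * y ^ (k + 2) = 0

section HenF

variable {F : Type*} [Field F] {O : ValuationSubring F}

lemma HenF.coarsen {O' : ValuationSubring F} (h : HenF O) (hle : O ≤ O') : HenF O' := by
  intro n c hc
  obtain ⟨y, hy, hy'⟩ := h n c fun k hk => ValuationSubring.lt_one_of_le hle (hc k hk)
  exact ⟨y, hle hy, hy'⟩

lemma HenF.quad (h : HenF O) {a : F} (ha : O.valuation a < 1) : ∃ y ∈ O, 1 + y + a * y ^ 2 = 0 := by
  obtain ⟨y, hy, hy'⟩ := h 1 (fun _ => a) fun _ _ => ha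
  exact ⟨y, hy, by simpa using hy'⟩

lemma HenF.up {I : Type*} (U : Ultrafilter I) (h : HenF O) : HenF (upO U O) := by
  intro n c hc
  let d : ℕ → I → F := fun k => upRep U (c k)
  have hd (k) : ((d k : I → F) : UP U F) = c k := upRep_spec U _
  have h1 : ∀ᶠ i in (U : Filter I), ∀ k ∈ Finset.range n, O.valuation (d k i) < 1 := by
    rw [Filter.eventually_all_finset]
    intro k hk
    rw [← upO_lt_one, hd]
    exact hc k (Finset.mem_range.1 hk)
  have h2 (i) : ∃ y, (∀ k ∈ Finset.range n, O.valuation (d k i) < 1) →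
      y ∈ O ∧ 1 + y + ∑ k ∈ Finset.range n, d k i * y ^ (k + 2) = 0 := by
    by_cases hi : ∀ k ∈ Finset.range n, O.valuation (d k i) < 1
    · obtain ⟨y, hy⟩ := h n (fun k => d k i) fun k hk => hi k (Finset.mem_range.2 hk)
      exact ⟨y, fun _ => hy⟩
    · exact ⟨0, fun h => absurd h hi⟩
  choose y hy using h2
  refine ⟨(y : UP U F), ?_, ?_⟩
  · filter_upwards [h1] with i hi using (hy i hi).1
  · simp_rw [← hd, up_pow, up_mul]
    rw [up_sum, up_one, up_add, up_add, up_zero, up_eq]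
    filter_upwards [h1] with i hi using (hy i hi).2

open Polynomial in
lemma HenF.of_henselianLocalRing (h : HenselianLocalRing O) : HenF O := by
  intro n c hc
  let c' : ℕ → O := fun k => if hk : k < n then ⟨c k, O.mem_of_lt_one (hc k hk)⟩ else 0
  have hc' (k) (hk : k < n) : (c' k : F) = c k := by simp [c', hk]
  let f : O[X] := X ^ (n + 1) + (X ^ n + ∑ k ∈ Finset.range n, C (c' k) * X ^ (n - 1 - k))
  have hm (k) : IsLocalRing.residue O (c' k) = 0 := by
    rw [IsLocalRing.residue_eq_zero_iff, ValuationSubring.valuation_lt_one_iff]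
    by_cases hk : k < n
    · rw [hc' k hk]; exact hc k hk
    · simp [c', hk]
  have hmap : f.map (IsLocalRing.residue O) = X ^ n * (X + 1) := by
    simp only [f, Polynomial.map_add, Polynomial.map_pow, Polynomial.map_X, Polynomial.map_sum,
      Polynomial.map_mul, Polynomial.map_C, hm]
    simp
    ring
  have hmonic : f.Monic := by
    refine monic_X_pow_add ?_
    refine (degree_add_le _ _).trans_lt (max_lt ?_ ?_)
    · rw [degree_X_pow]; exact_mod_cast Nat.lt_succ_self n
    · refine (degree_sum_le _ _).trans_lt ?_
      rw [Finset.sup_lt_iff (WithBot.bot_lt_coe _)]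
      intro k hk
      refine (degree_C_mul_X_pow_le _ _).trans_lt ?_
      have := Finset.mem_range.1 hk
      exact_mod_cast (by omega : n - 1 - k < n + 1)
  obtain ⟨z, hz, hz'⟩ := h.is_henselian f hmonic (-1) (by
    rw [← IsLocalRing.residue_eq_zero_iff, ← Polynomial.eval_map_apply, hmap]
    simp) (by
    rw [← IsLocalRing.residue_ne_zero_iff_isUnit, ← Polynomial.eval_map_apply, ← derivative_map, hmap]
    simp)
  have hzu : IsUnit z := by
    rw [← IsLocalRing.residue_ne_zero_iff_isUnit]
    rw [← IsLocalRing.residue_eq_zero_iff, map_sub, map_neg, map_one, sub_neg_eq_add] at hz'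
    rw [eq_neg_of_add_eq_zero_left hz']
    simp
  obtain ⟨u, rfl⟩ := hzu
  have hu0 : ((u : O) : F) ≠ 0 := by
    intro h0
    exact u.ne_zero (Subtype.ext h0)
  refine ⟨((u⁻¹ : Oˣ) : O), Subtype.mem _, ?_⟩
  have e : ((((u⁻¹ : Oˣ) : O)) : F) = (((u : O) : F))⁻¹ := by
    apply eq_inv_of_mul_eq_one_left
    exact congrArg Subtype.val u.inv_mul
  rw [e]
  have hz2 := congrArg (O.subtype) hz
  simp only [f, Polynomial.eval_add, Polynomial.eval_pow, Polynomial.eval_X,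
    Polynomial.eval_finsetSum, Polynomial.eval_mul, Polynomial.eval_C, map_add, map_pow, map_sum,
    map_mul, map_zero] at hz2
  have : (((u : O) : F)) ^ (n + 1) * (1 + (((u : O) : F))⁻¹ +
      ∑ k ∈ Finset.range n, c k * (((u : O) : F))⁻¹ ^ (k + 2)) = 0 := by
    rw [← hz2, mul_add, mul_add, add_assoc, Finset.mul_sum]
    congr 1
    · simp
    congr 1
    · rw [pow_succ, mul_assoc, mul_inv_cancel₀ hu0, mul_one]; rfl
    · refine Finset.sum_congr rfl fun k hk => ?_
      have hk' := Finset.mem_range.1 hk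
      have : n + 1 = (n - 1 - k) + (k + 2) := by omega
      rw [this, pow_add]
      change _ = (c' k : F) * ((u : O) : F) ^ (n - 1 - k)
      rw [hc' k hk', inv_pow]
      field_simp
  exact (mul_eq_zero.1 this).resolve_left (pow_ne_zero _ hu0)

open Polynomial in
/-- Hensel's lemma for approximate simple roots of polynomials with integral coefficients. -/
lemma HenF.newton (h : HenF O) (f : F[X]) (hf : ∀ i, f.coeff i ∈ O) {a : F} (ha : a ∈ O)
    (h0 : O.valuation (f.eval a) < 1) (h1 : O.valuation (f.derivative.eval a) = 1) :
    ∃ b ∈ O, f.eval b = 0 ∧ O.valuation (b - a) < 1 := by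
  obtain ⟨f, rfl⟩ : f ∈ Polynomial.lifts (O.subtype) :=
    (Polynomial.lifts_iff_coeff_lifts f).2 fun i => ⟨⟨_, hf i⟩, rfl⟩
  obtain ⟨a, rfl⟩ : ∃ a' : O, a' = a := ⟨⟨a, ha⟩, rfl⟩
  rw [← taylor_coeff_one] at h1
  rw [← taylor_coeff_zero] at h0
  set g : F[X] := taylor (a : F) ((mapRingHom O.subtype) f) with hg
  have hgO (i) : g.coeff i ∈ O := by
    have : g = (taylor a f).map O.subtype := by
      rw [hg, map_taylor]; rfl
    rw [this, coeff_map]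
    exact Subtype.mem _
  have hev (s : F) : ((mapRingHom O.subtype) f).eval (a + s) = g.eval s := by
    rw [hg, taylor_eval, add_comm]
  rcases eq_or_ne (g.coeff 0) 0 with hz | hz
  · refine ⟨a, ha, ?_, by simp⟩
    rw [hg, taylor_coeff_zero] at hz
    exact hz
  have hg1 : g.coeff 1 ≠ 0 := by
    intro h
    rw [h, map_zero] at h1
    exact zero_ne_one h1
  set ε := g.coeff 0 / g.coeff 1 with hε
  have hεlt : O.valuation ε < 1 := by rwa [hε, map_div₀, h1, div_one]
  have hginv : (g.coeff 1)⁻¹ ∈ O := ((O.valuation_eq_one_iff' hg1).1 h1).2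
  obtain ⟨y, hy, hy'⟩ := h g.natDegree (fun k => g.coeff (k + 2) * ε ^ (k + 1) / g.coeff 1)
    fun k _ => by
      rw [div_eq_mul_inv]
      exact O.mul_lt_one (O.mul_lt_one' (hgO _) (O.pow_lt_one hεlt (Nat.succ_ne_zero k))) hginv
  refine ⟨a + ε * y, O.add_mem _ _ ha (O.mul_mem _ _ (O.mem_of_lt_one hεlt) hy), ?_, ?_⟩
  · rw [hev, eval_eq_sum_range' (n := g.natDegree + 2) (by omega), Finset.sum_range_succ',
      Finset.sum_range_succ']
    have : ∑ k ∈ Finset.range g.natDegree, g.coeff (k + 1 + 1) * (ε * y) ^ (k + 1 + 1) +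
        g.coeff (0 + 1) * (ε * y) ^ (0 + 1) + g.coeff 0 * (ε * y) ^ 0 = g.coeff 0 * 0 := by
      rw [← hy', mul_add, mul_add, Finset.mul_sum]
      have e1 : ε * g.coeff 1 = g.coeff 0 := div_mul_cancel₀ _ hg1
      rw [add_assoc, add_comm]
      congr 1
      · rw [zero_add, pow_one, pow_zero, mul_one, add_comm, ← mul_assoc,
          mul_comm (g.coeff 1), e1]
      · refine Finset.sum_congr rfl fun k _ => ?_
        rw [← e1]
        field_simp
        ring
    rw [this, mul_zero]
  · rw [add_sub_cancel_left]
    exact O.mul_lt_one hεlt hy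

end HenF

/-- A place of `F` with residue field `R`. The residue map takes irrelevant values outside the
valuation ring. -/
structure FPlace (F R : Type*) [Field F] [Field R] where
  /-- The valuation ring. -/
  O : ValuationSubring F
  /-- The residue map. -/
  res : F → R
  res_one : res 1 = 1
  res_add : ∀ a ∈ O, ∀ b ∈ O, res (a + b) = res a + res b
  res_mul : ∀ a ∈ O, ∀ b ∈ O, res (a * b) = res a * res b
  surj : ∀ r, ∃ a ∈ O, res a = r

namespace FPlace

variable {F R : Type*} [Field F] [Field R] (P : FPlace F R)

lemma res_zero : P.res 0 = 0 := by
  have := P.res_add 0 P.O.zero_mem 0 P.O.zero_mem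
  rwa [add_zero, left_eq_add] at this

/-- The residue map as a ring homomorphism. -/
def hom : P.O →+* R where
  toFun a := P.res a
  map_one' := P.res_one
  map_zero' := P.res_zero
  map_add' a b := P.res_add a a.2 b b.2
  map_mul' a b := P.res_mul a a.2 b b.2

lemma res_neg {a : F} (ha : a ∈ P.O) : P.res (-a) = - P.res a := map_neg P.hom ⟨a, ha⟩

lemma res_sub {a b : F} (ha : a ∈ P.O) (hb : b ∈ P.O) : P.res (a - b) = P.res a - P.res b :=
  map_sub P.hom ⟨a, ha⟩ ⟨b, hb⟩

lemma res_pow {a : F} (ha : a ∈ P.O) (n : ℕ) : P.res (a ^ n) = P.res a ^ n :=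
  map_pow P.hom ⟨a, ha⟩ n

lemma res_sum {α : Type*} (s : Finset α) {f : α → F} (h : ∀ i, f i ∈ P.O) :
    P.res (∑ i ∈ s, f i) = ∑ i ∈ s, P.res (f i) := by
  have e : ∑ i ∈ s, f i = ((∑ i ∈ s, (⟨f i, h i⟩ : P.O) : P.O) : F) := by
    simp
  rw [e]
  exact map_sum P.hom (fun i => ⟨f i, h i⟩) s

lemma res_eq_zero_iff {a : F} (ha : a ∈ P.O) : P.res a = 0 ↔ P.O.valuation a < 1 := by
  have unit {b : F} (hb : P.O.valuation b = 1) : P.res b ≠ 0 := by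
    intro h
    have hb0 : b ≠ 0 := by
      rintro rfl
      simp at hb
    obtain ⟨h1, h2⟩ := (P.O.valuation_eq_one_iff' hb0).1 hb
    have := P.res_mul b h1 b⁻¹ h2
    rw [mul_inv_cancel₀ hb0, P.res_one, h, zero_mul] at this
    exact one_ne_zero this
  constructor
  · intro h
    exact lt_of_le_of_ne ((P.O.valuation_le_one_iff a).2 ha) fun h' => unit h' h
  · intro h
    by_contra hne
    obtain ⟨b, hb, hb'⟩ := P.surj (P.res a)⁻¹
    have hab := P.O.mul_lt_one h hb
    apply unit (Valuation.map_one_sub_of_lt _ hab)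
    rw [P.res_sub P.O.one_mem (P.O.mul_mem _ _ ha hb), P.res_mul _ ha _ hb, hb', P.res_one,
      mul_inv_cancel₀ hne, sub_self]

lemma res_eq_iff {a b : F} (ha : a ∈ P.O) (hb : b ∈ P.O) :
    P.res a = P.res b ↔ P.O.valuation (a - b) < 1 := by
  rw [← P.res_eq_zero_iff (P.O.sub_mem' ha hb), P.res_sub ha hb, sub_eq_zero]

lemma valuation_eq_one {a : F} (ha : a ∈ P.O) (h : P.res a ≠ 0) : P.O.valuation a = 1 :=
  le_antisymm ((P.O.valuation_le_one_iff a).2 ha) (not_lt.1 fun h' => h ((P.res_eq_zero_iff ha).2 h'))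

lemma inv_mem {a : F} (ha : a ∈ P.O) (h : P.res a ≠ 0) : a⁻¹ ∈ P.O := by
  refine ((P.O.valuation_eq_one_iff' ?_).1 (P.valuation_eq_one ha h)).2
  rintro rfl
  exact h P.res_zero

lemma res_inv {a : F} (ha : a ∈ P.O) (h : P.res a ≠ 0) : P.res a⁻¹ = (P.res a)⁻¹ := by
  have h0 : a ≠ 0 := by
    rintro rfl
    exact h P.res_zero
  refine eq_inv_of_mul_eq_one_left ?_
  rw [← P.res_mul _ (P.inv_mem ha h) _ ha, inv_mul_cancel₀ h0, P.res_one]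

/-- The refinement of a place by a valuation ring of the residue field. -/
def comp (V : ValuationSubring R) : ValuationSubring F where
  carrier := {a | a ∈ P.O ∧ P.res a ∈ V}
  mul_mem' {a b} ha hb := ⟨P.O.mul_mem _ _ ha.1 hb.1, by
    rw [P.res_mul _ ha.1 _ hb.1]; exact V.mul_mem _ _ ha.2 hb.2⟩
  add_mem' {a b} ha hb := ⟨P.O.add_mem _ _ ha.1 hb.1, by
    rw [P.res_add _ ha.1 _ hb.1]; exact V.add_mem _ _ ha.2 hb.2⟩
  one_mem' := ⟨P.O.one_mem, by rw [P.res_one]; exact V.one_mem⟩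
  zero_mem' := ⟨P.O.zero_mem, by rw [P.res_zero]; exact V.zero_mem⟩
  neg_mem' {a} ha := ⟨P.O.neg_mem _ ha.1, by rw [P.res_neg ha.1]; exact V.neg_mem _ ha.2⟩
  mem_or_inv_mem' a := by
    by_cases h0 : a ∈ P.O ∧ P.res a = 0
    · exact Or.inl ⟨h0.1, by rw [h0.2]; exact V.zero_mem⟩
    by_cases h0' : a⁻¹ ∈ P.O ∧ P.res a⁻¹ = 0
    · exact Or.inr ⟨h0'.1, by rw [h0'.2]; exact V.zero_mem⟩
    rcases P.O.mem_or_inv_mem a with h | h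
    · have h1 : P.res a ≠ 0 := fun h' => h0 ⟨h, h'⟩
      rcases V.mem_or_inv_mem (P.res a) with h2 | h2
      · exact Or.inl ⟨h, h2⟩
      · exact Or.inr ⟨P.inv_mem h h1, by rwa [P.res_inv h h1]⟩
    · have h1 : P.res a⁻¹ ≠ 0 := fun h' => h0' ⟨h, h'⟩
      rcases V.mem_or_inv_mem (P.res a⁻¹) with h2 | h2
      · exact Or.inr ⟨h, h2⟩
      · refine Or.inl ⟨by simpa using P.inv_mem h h1, ?_⟩
        have := P.res_inv h h1
        rw [inv_inv] at this
        rwa [this]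

lemma comp_le (V : ValuationSubring R) : P.comp V ≤ P.O := fun _ h => h.1

lemma comp_top : P.comp ⊤ = P.O := by
  ext a
  exact ⟨fun h => h.1, fun h => ⟨h, ValuationSubring.mem_top _⟩⟩

lemma comp_lt_one {V : ValuationSubring R} {a : F} :
    (P.comp V).valuation a < 1 ↔ a ∈ P.O ∧ V.valuation (P.res a) < 1 := by
  rcases eq_or_ne a 0 with rfl | ha
  · simp [P.res_zero, P.O.zero_mem]
  constructor
  · intro h
    have hm := ((P.comp V).mem_of_lt_one h)
    refine ⟨hm.1, ?_⟩
    rw [ValuationSubring.lt_one_iff] at h ⊢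
    by_contra! hc
    refine (h.resolve_left ha) ⟨P.inv_mem hm.1 hc.1, ?_⟩
    rw [P.res_inv hm.1 hc.1]
    exact hc.2
  · rintro ⟨h1, h2⟩
    rw [ValuationSubring.lt_one_iff] at h2 ⊢
    right
    rintro ⟨h3, h4⟩
    have h5 : P.res a * P.res a⁻¹ = 1 := by
      rw [← P.res_mul _ h1 _ h3, mul_inv_cancel₀ ha, P.res_one]
    rcases h2 with h2 | h2
    · rw [h2, zero_mul] at h5
      exact zero_ne_one h5
    · rw [← eq_inv_of_mul_eq_one_right h5] at h2
      exact h2 h4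

/-- The residue place of a valuation ring. -/
noncomputable def ofValuationSubring (O : ValuationSubring F) : FPlace F (ResF O) where
  O := O
  res a := by
    classical
    exact if h : a ∈ O then IsLocalRing.residue O ⟨a, h⟩ else 0
  res_one := by
    rw [dif_pos O.one_mem]
    exact map_one _
  res_add a ha b hb := by
    rw [dif_pos ha, dif_pos hb, dif_pos (O.add_mem _ _ ha hb), ← map_add]
    rfl
  res_mul a ha b hb := by
    rw [dif_pos ha, dif_pos hb, dif_pos (O.mul_mem _ _ ha hb), ← map_mul]
    rfl
  surj r := by
    obtain ⟨a, rfl⟩ := IsLocalRing.residue_surjective r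
    exact ⟨a, a.2, dif_pos a.2⟩

/-- The ultrapower of a place. -/
noncomputable def up {I : Type*} (U : Ultrafilter I) : FPlace (UP U F) (UP U R) where
  O := upO U P.O
  res := Filter.Germ.map P.res
  res_one := congrArg (fun r => ((fun _ => r : I → R) : UP U R)) P.res_one
  res_add a := by
    refine Filter.Germ.inductionOn a fun f hf b => ?_
    refine Filter.Germ.inductionOn b fun g hg => ?_
    refine (up_eq U).2 ?_
    filter_upwards [hf, hg] with i h1 h2 using P.res_add _ h1 _ h2
  res_mul a := by
    refine Filter.Germ.inductionOn a fun f hf b => ?_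
    refine Filter.Germ.inductionOn b fun g hg => ?_
    refine (up_eq U).2 ?_
    filter_upwards [hf, hg] with i h1 h2 using P.res_mul _ h1 _ h2
  surj r := by
    refine Filter.Germ.inductionOn r fun f => ?_
    choose g hg hg' using fun i => P.surj (f i)
    exact ⟨(g : UP U F), Filter.Eventually.of_forall hg, (up_eq U).2 (Filter.Eventually.of_forall hg')⟩

lemma up_comp {I : Type*} (U : Ultrafilter I) (V : ValuationSubring R) :
    (P.up U).comp (upO U V) = upO U (P.comp V) := by
  ext a
  refine Filter.Germ.inductionOn a fun f => ?_
  exact Filter.eventually_and.symm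

end FPlace

/-- An explicit form of separability of the field extension `κ` in characteristic `p`. -/
def SepP (p : ℕ) {k R : Type*} [Field k] [Field R] (κ : k →+* R) : Prop :=
  ∀ (n : ℕ) (c : Fin n → k), ∃ (m : ℕ) (e : Fin m → k) (d : Fin n → Fin m → k),
    (∀ i, c i = ∑ j, d i j ^ p * e j) ∧
      ∀ y : Fin m → R, ∑ j, y j ^ p * κ (e j) = 0 → ∀ j, y j = 0

section SepP

variable {p : ℕ} {k R : Type*} [Field k] [Field R]

lemma SepP.of_comp {R' : Type*} [Field R'] {κ : k →+* R} (e : R →+* R')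
    (h : SepP p (e.comp κ)) : SepP p κ := by
  intro n c
  obtain ⟨m, a, d, h1, h2⟩ := h n c
  refine ⟨m, a, d, h1, fun y hy j => ?_⟩
  have := h2 (fun j => e (y j)) (by
    have := congrArg e hy
    simpa using this) j
  exact (map_eq_zero e).1 this

lemma SepP.linearIndepOn_pow [Fact p.Prime] [CharP k p] [Algebra k R] (h : SepP p (algebraMap k R))
    (s : Finset R) (hs : LinearIndepOn k _root_.id (s : Set R)) :
    LinearIndepOn k (fun x : R => x ^ p) (s : Set R) := by
  have : CharP R p := charP_of_injective_algebraMap (algebraMap k R).injective p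
  let e : Fin s.card ≃ s := s.equivFin.symm
  rw [LinearIndepOn, ← linearIndependent_equiv e] at hs ⊢
  rw [Fintype.linearIndependent_iff] at hs ⊢
  intro c hc
  obtain ⟨m, a, d, h1, h2⟩ := h _ c
  have key : ∑ j, (∑ i, d i j • (e i : R)) ^ p * algebraMap k R (a j) = 0 := by
    rw [← hc]
    simp_rw [sum_pow_char p, Finset.sum_mul]
    rw [Finset.sum_comm]
    refine Finset.sum_congr rfl fun i _ => ?_
    rw [h1 i, Algebra.smul_def, map_sum, Finset.sum_mul]
    refine Finset.sum_congr rfl fun j _ => ?_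
    simp only [Algebra.smul_def, map_mul, map_pow, mul_pow, Function.comp]
    ring
  have h3 := h2 _ key
  intro i
  rw [h1 i]
  refine Finset.sum_eq_zero fun j _ => ?_
  have h4 := hs (fun i => d i j) (h3 j) i
  rw [h4, zero_pow (Fact.out : p.Prime).ne_zero, zero_mul]

end SepP

namespace FPlace

variable {F R : Type*} [Field F] [Field R] (P : FPlace F R)
variable {R₁ : Type*} [Field R₁] (e : R₁ →+* R)

lemma res_ne_zero_of_mem {T : Subfield F} (hT : ∀ x ∈ T, x ∈ P.O) {x : F} (hx : x ∈ T)
    (h0 : x ≠ 0) : P.res x ≠ 0 := by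
  intro h
  have := P.res_mul x (hT x hx) x⁻¹ (hT _ (T.inv_mem hx))
  rw [mul_inv_cancel₀ h0, P.res_one, h, zero_mul] at this
  exact one_ne_zero this

lemma res_injOn {T : Subfield F} (hT : ∀ x ∈ T, x ∈ P.O) {x y : F} (hx : x ∈ T) (hy : y ∈ T)
    (h : P.res x = P.res y) : x = y := by
  by_contra hne
  refine P.res_ne_zero_of_mem hT (T.sub_mem hx hy) (sub_ne_zero.2 hne) ?_
  rw [P.res_sub (hT x hx) (hT y hy), h, sub_self]

/-- The subfield of elements whose residue lifts to a given subfield of the valuation ring. -/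
def liftable (T : Subfield F) (hT : ∀ x ∈ T, x ∈ P.O) : Subfield R₁ where
  carrier := {z | ∃ τ ∈ T, P.res τ = e z}
  mul_mem' := by
    rintro a b ⟨x, hx, hx'⟩ ⟨y, hy, hy'⟩
    exact ⟨x * y, T.mul_mem hx hy, by rw [P.res_mul _ (hT x hx) _ (hT y hy), hx', hy', map_mul]⟩
  add_mem' := by
    rintro a b ⟨x, hx, hx'⟩ ⟨y, hy, hy'⟩
    exact ⟨x + y, T.add_mem hx hy, by rw [P.res_add _ (hT x hx) _ (hT y hy), hx', hy', map_add]⟩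
  one_mem' := ⟨1, T.one_mem, by rw [P.res_one, map_one]⟩
  zero_mem' := ⟨0, T.zero_mem, by rw [P.res_zero, map_zero]⟩
  neg_mem' := by
    rintro a ⟨x, hx, hx'⟩
    exact ⟨-x, T.neg_mem hx, by rw [P.res_neg (hT x hx), hx', map_neg]⟩
  inv_mem' := by
    rintro a ⟨x, hx, hx'⟩
    refine ⟨x⁻¹, T.inv_mem hx, ?_⟩
    rcases eq_or_ne x 0 with rfl | h0
    · rw [P.res_zero] at hx'
      rw [inv_zero, P.res_zero, map_inv₀, ← hx', inv_zero]
    · rw [P.res_inv (hT x hx) (P.res_ne_zero_of_mem hT hx h0), hx', map_inv₀]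

lemma exists_lift (T : Subfield F) (hT : ∀ x ∈ T, x ∈ P.O) :
    ∃ g : P.liftable e T hT →+* F, ∀ z, g z ∈ T ∧ P.res (g z) = e z := by
  choose g hg hg' using fun z : P.liftable e T hT => z.2
  have key (z : P.liftable e T hT) {x : F} (hx : x ∈ T) (h : P.res x = e z) : g z = x :=
    P.res_injOn hT (hg z) hx ((hg' z).trans h.symm)
  refine ⟨{ toFun := g, map_one' := ?_, map_mul' := ?_, map_zero' := ?_, map_add' := ?_ },
    fun z => ⟨hg z, hg' z⟩⟩
  · exact key _ T.one_mem (by rw [P.res_one]; exact (map_one e).symm)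
  · intro x y
    refine key _ (T.mul_mem (hg x) (hg y)) ?_
    rw [P.res_mul _ (hT _ (hg x)) _ (hT _ (hg y)), hg', hg']
    exact (map_mul e _ _).symm
  · exact key _ T.zero_mem (by rw [P.res_zero]; exact (map_zero e).symm)
  · intro x y
    refine key _ (T.add_mem (hg x) (hg y)) ?_
    rw [P.res_add _ (hT _ (hg x)) _ (hT _ (hg y)), hg', hg']
    exact (map_add e _ _).symm

variable {k : Type*} [Field k] {ι : k →+* F} {κ : k →+* R₁}

lemma closure_le_of_algebraicIndependent (hι : ∀ c, ι c ∈ P.O)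
    (hc : ∀ c, P.res (ι c) = e (κ c)) {B : Type*} (b : B → R₁) (ℓ : B → F)
    (hb : letI := κ.toAlgebra; AlgebraicIndependent k b)
    (hℓ : ∀ i, ℓ i ∈ P.O) (hℓ' : ∀ i, P.res (ℓ i) = e (b i)) :
    ∀ x ∈ Subfield.closure (Set.range ι ∪ Set.range ℓ), x ∈ P.O := by
  let _ := κ.toAlgebra
  have hle : Subring.closure (Set.range ι ∪ Set.range ℓ) ≤ (MvPolynomial.eval₂Hom ι ℓ).range := by
    rw [Subring.closure_le]
    rintro x (⟨c, rfl⟩ | ⟨i, rfl⟩)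
    · exact ⟨MvPolynomial.C c, by simp⟩
    · exact ⟨MvPolynomial.X i, by simp⟩
  have hq (q : MvPolynomial B k) : MvPolynomial.eval₂Hom ι ℓ q ∈ P.O ∧
      P.res (MvPolynomial.eval₂Hom ι ℓ q) = e (MvPolynomial.aeval b q) := by
    induction q using MvPolynomial.induction_on with
    | C c => simpa using ⟨hι c, hc c⟩
    | add q r hq hr =>
      rw [map_add, map_add, map_add, P.res_add _ hq.1 _ hr.1, hq.2, hr.2]
      exact ⟨P.O.add_mem _ _ hq.1 hr.1, rfl⟩
    | mul_X q i hq =>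
      have : MvPolynomial.eval₂Hom ι ℓ (MvPolynomial.X i) = ℓ i := by simp
      rw [map_mul, map_mul, map_mul, this, MvPolynomial.aeval_X, P.res_mul _ hq.1 _ (hℓ i), hq.2, hℓ']
      exact ⟨P.O.mul_mem _ _ hq.1 (hℓ i), rfl⟩
  intro x hx
  obtain ⟨y, hy, z, hz, rfl⟩ := Subfield.mem_closure_iff.1 hx
  obtain ⟨r, rfl⟩ := hle hy
  obtain ⟨s, rfl⟩ := hle hz
  rw [div_eq_mul_inv]
  refine P.O.mul_mem _ _ (hq r).1 ?_
  rcases eq_or_ne s 0 with rfl | hs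
  · simp
  · refine P.inv_mem (hq s).1 ?_
    rw [(hq s).2, map_ne_zero]
    intro h0
    exact hs ((injective_iff_map_eq_zero _).1 hb s h0)

/-- Elements algebraic over a subfield of the valuation ring are in the valuation ring. -/
lemma exists_algebraicClosure (T : Subfield F) (hT : ∀ x ∈ T, x ∈ P.O) :
    ∃ T' : Subfield F, T ≤ T' ∧ (∀ x ∈ T', x ∈ P.O) ∧ ∀ x : F, IsAlgebraic T x → x ∈ T' := by
  refine ⟨(algebraicClosure T F).toSubfield, ?_, ?_, ?_⟩
  · intro x hx
    exact (algebraicClosure T F).algebraMap_mem ⟨x, hx⟩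
  · intro x hx
    have hx : IsAlgebraic T x := mem_algebraicClosure_iff.1 hx
    obtain ⟨q, hq, hq'⟩ := isAlgebraic_iff_isIntegral.1 hx
    have hxint : IsIntegral P.O x := by
      let i : T →+* P.O := T.subtype.codRestrict P.O fun x => hT _ x.2
      refine ⟨q.map i, hq.map i, ?_⟩
      rw [Polynomial.eval₂_map]
      exact hq'
    obtain ⟨y, hy⟩ := IsIntegrallyClosed.isIntegral_iff.1 hxint
    rw [← hy]
    exact y.2
  · intro x hx
    exact mem_algebraicClosure_iff.2 hx

lemma exists_algebraic_root (hH : HenF P.O) (T : Subfield F) (hT : ∀ x ∈ T, x ∈ P.O) {z : R₁}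
    (hz : IsSeparable (P.liftable e T hT) z) : ∃ b : F, IsAlgebraic T b ∧ b ∈ P.O ∧ P.res b = e z := by
  obtain ⟨g, hg⟩ := P.exists_lift e T hT
  let E := P.liftable e T hT
  set m := minpoly E z
  set f := m.map g with hf
  have hfO (i) : f.coeff i ∈ P.O := by
    rw [hf, Polynomial.coeff_map]
    exact hT _ (hg _).1
  obtain ⟨a, ha, ha'⟩ := P.surj (e z)
  have hres (q : Polynomial E) : (q.map g).eval a ∈ P.O ∧
      P.res ((q.map g).eval a) = e (Polynomial.aeval z q) := by
    induction q using Polynomial.induction_on' with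
    | add q r hq hr =>
      rw [Polynomial.map_add, Polynomial.eval_add, map_add, map_add, P.res_add _ hq.1 _ hr.1, hq.2, hr.2]
      exact ⟨P.O.add_mem _ _ hq.1 hr.1, rfl⟩
    | monomial n c =>
      have h1 := P.O.pow_mem' ha n
      have h2 := hT _ (hg c).1
      simp only [Polynomial.map_monomial, Polynomial.eval_monomial, Polynomial.aeval_monomial]
      rw [map_mul, map_pow, P.res_mul _ h2 _ h1, P.res_pow ha, ha', (hg c).2]
      exact ⟨P.O.mul_mem _ _ h2 h1, rfl⟩
  have hxint : IsIntegral E z := hz.isIntegral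
  obtain ⟨b, hb, hb0, hba⟩ := hH.newton f hfO ha (by
    rw [← P.res_eq_zero_iff (hres m).1, (hres m).2, minpoly.aeval, map_zero]) (by
    rw [hf, Polynomial.derivative_map]
    refine P.valuation_eq_one (hres _).1 ?_
    rw [(hres _).2, map_ne_zero]
    exact Polynomial.Separable.aeval_derivative_ne_zero hz (minpoly.aeval E z))
  refine ⟨b, ?_, hb, ?_⟩
  · let g' : E →+* T := g.codRestrict T fun z => (hg z).1
    refine ⟨m.map g', ((minpoly.monic hxint).map g').ne_zero, ?_⟩
    rw [Polynomial.aeval_def, Polynomial.eval₂_map, ← hb0, Polynomial.eval_map]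
    rfl
  · rw [← ha']
    exact (P.res_eq_iff hb ha).2 hba

open IntermediateField in
/-- Finitely generated separable extensions of the constants lift along a henselian place. -/
lemma exists_partial_section {p : ℕ} [Fact p.Prime] [CharP k p] (hH : HenF P.O)
    (hι : ∀ c, ι c ∈ P.O) (hc : ∀ c, P.res (ι c) = e (κ c)) (hS : SepP p κ) (S : Finset R₁) :
    ∃ (E : Subfield R₁) (g : E →+* F), (∀ z ∈ S, z ∈ E) ∧
      (∀ z, g z ∈ P.O ∧ P.res (g z) = e z) ∧ ∀ c, ∃ h : κ c ∈ E, g ⟨κ c, h⟩ = ι c := by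
  let _ := κ.toAlgebra
  let K : IntermediateField k R₁ := adjoin k (S : Set R₁)
  have hSK : SepP p (algebraMap k K) := SepP.of_comp (algebraMap K R₁) hS
  have hfg : Algebra.EssFiniteType k K := by
    rw [essFiniteType_iff]
    exact ⟨S, rfl⟩
  obtain ⟨B, hB, hsep⟩ :=
    exists_isTranscendenceBasis_and_isSeparable_of_linearIndepOn_pow_of_essFiniteType (k := k)
      (K := K) p Fact.out hSK.linearIndepOn_pow
  let b : B → R₁ := fun i => ((i : K) : R₁)
  have hb : AlgebraicIndependent k b := hB.1.map' (f := K.val) K.val.injective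
  choose ℓ hℓ hℓ' using fun i => P.surj (e (b i))
  let T₀ := Subfield.closure (Set.range ι ∪ Set.range ℓ)
  have hT₀ := P.closure_le_of_algebraicIndependent e hι hc b ℓ hb hℓ hℓ'
  have hιT₀ (c) : ι c ∈ T₀ := Subfield.subset_closure (Or.inl ⟨c, rfl⟩)
  obtain ⟨T, hle, hT, halg⟩ := P.exists_algebraicClosure T₀ hT₀
  obtain ⟨g, hg⟩ := P.exists_lift e T hT
  have hκ (c) : κ c ∈ P.liftable e T hT := ⟨ι c, hle (hιT₀ c), hc c⟩
  refine ⟨P.liftable e T hT, g, fun z hz => ?_, fun z => ⟨hT _ (hg z).1, (hg z).2⟩,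
    fun c => ⟨hκ c, P.res_injOn hT (hg _).1 (hle (hιT₀ c)) ?_⟩⟩
  · let z' : K := ⟨z, subset_adjoin k _ hz⟩
    let E₀ := P.liftable e T₀ hT₀
    have hz' : IsSeparable (adjoin k (B : Set K)) z' := hsep.isSeparable' z'
    have hin (y : adjoin k (B : Set K)) : ((y : K) : R₁) ∈ E₀ := by
      have h1 : adjoin k (B : Set K) ≤
          (E₀.toIntermediateField (fun c => ⟨ι c, hιT₀ c, hc c⟩)).comap K.val := by
        rw [adjoin_le_iff]
        intro y hy
        exact ⟨ℓ ⟨y, hy⟩, Subfield.subset_closure (Or.inr ⟨_, rfl⟩), hℓ' _⟩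
      exact h1 y.2
    have hz2 : IsSeparable E₀ z := by
      let i : adjoin k (B : Set K) →+* E₀ :=
        ((algebraMap K R₁).comp (algebraMap _ K)).codRestrict E₀ hin
      refine Polynomial.Separable.of_dvd (Polynomial.Separable.map (f := i) hz') (minpoly.dvd _ _ ?_)
      rw [Polynomial.aeval_def, Polynomial.eval₂_map]
      have : (algebraMap E₀ R₁).comp i = (algebraMap K R₁).comp (algebraMap _ K) := rfl
      change Polynomial.eval₂ _ (algebraMap K R₁ z') _ = 0
      rw [this, ← Polynomial.hom_eval₂, ← Polynomial.aeval_def, minpoly.aeval, map_zero]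
    obtain ⟨x, hx, -, hx'⟩ := P.exists_algebraic_root e hH T₀ hT₀ hz2
    exact ⟨x, halg x hx, hx'⟩
  · rw [(hg _).2, hc]

/-- Sections of a henselian place on a separable extension of the constants, in an ultrapower. -/
lemma exists_section {p : ℕ} [Fact p.Prime] [CharP k p] (hH : HenF P.O)
    (hι : ∀ c, ι c ∈ P.O) (hc : ∀ c, P.res (ι c) = e (κ c)) (hS : SepP p κ) :
    ∃ (U : Ultrafilter (Finset R₁)) (σ : R₁ →+* UP U F), (∀ z, σ z ∈ (P.up U).O) ∧
      (∀ z, (P.up U).res (σ z) = upConst U R (e z)) ∧ ∀ c, σ (κ c) = upConst U F (ι c) := by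
  classical
  choose E g hE hg hgc using P.exists_partial_section e hH hι hc hS
  let U : Ultrafilter (Finset R₁) := Ultrafilter.of Filter.atTop
  have hU (z : R₁) : ∀ᶠ S in (U : Filter (Finset R₁)), z ∈ S := by
    refine Ultrafilter.of_le Filter.atTop ?_
    filter_upwards [Filter.eventually_ge_atTop {z}] with S hS
    exact hS (Finset.mem_singleton_self z)
  let s : R₁ → Finset R₁ → F := fun z S => if h : z ∈ E S then g S ⟨z, h⟩ else 0
  have hs (z S) (h : z ∈ E S) : s z S = g S ⟨z, h⟩ := dif_pos h
  let σ : R₁ →+* UP U F :=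
    { toFun := fun z => (s z : UP U F)
      map_one' := by
        refine (up_eq U).2 (Filter.Eventually.of_forall fun S => ?_)
        exact (hs 1 S (E S).one_mem).trans (map_one (g S))
      map_mul' := fun x y => by
        refine (up_eq U).2 ?_
        filter_upwards [hU x, hU y] with S hx hy
        have hx := hE S x hx
        have hy := hE S y hy
        rw [hs _ S hx, hs _ S hy, hs _ S ((E S).mul_mem hx hy), ← map_mul]
        rfl
      map_zero' := by
        refine (up_eq U).2 (Filter.Eventually.of_forall fun S => ?_)
        exact (hs 0 S (E S).zero_mem).trans (map_zero (g S))
      map_add' := fun x y => by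
        refine (up_eq U).2 ?_
        filter_upwards [hU x, hU y] with S hx hy
        have hx := hE S x hx
        have hy := hE S y hy
        rw [hs _ S hx, hs _ S hy, hs _ S ((E S).add_mem hx hy), ← map_add]
        rfl }
  refine ⟨U, σ, fun z => ?_, fun z => ?_, fun c => ?_⟩
  · change ∀ᶠ S in (U : Filter (Finset R₁)), s z S ∈ P.O
    filter_upwards [hU z] with S hz
    rw [hs _ _ (hE S z hz)]
    exact (hg S _).1
  · refine (up_eq U).2 ?_
    filter_upwards [hU z] with S hz
    change P.res (s z S) = e z
    rw [hs _ _ (hE S z hz)]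
    exact (hg S _).2
  · refine (up_eq U).2 (Filter.Eventually.of_forall fun S => ?_)
    obtain ⟨h, h'⟩ := hgc S c
    exact (hs _ _ h).trans h'

end FPlace

section SepPInstances

variable {p : ℕ} [hp : Fact p.Prime] {k : Type*} [Field k]

lemma SepP.refl [CharP k p] : SepP p (RingHom.id k) := by
  intro n c
  let K : Subfield k := (frobenius k p).fieldRange
  let W : Submodule K k := Submodule.span K (Set.range c)
  have : FiniteDimensional K W := FiniteDimensional.span_of_finite K (Set.finite_range c)
  let b := Module.finBasis K W
  have hK (x : K) : ∃ y : k, y ^ p = x := x.2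
  choose r hr using hK
  have hc (i) : c i ∈ W := Submodule.subset_span ⟨i, rfl⟩
  refine ⟨_, fun j => (b j : k), fun i j => r (b.repr ⟨c i, hc i⟩ j), fun i => ?_, fun y hy j => ?_⟩
  · have := congrArg (W.subtype) (b.sum_repr ⟨c i, hc i⟩)
    rw [map_sum] at this
    simp only [map_smul, Submodule.subtype_apply] at this
    rw [← this]
    exact Finset.sum_congr rfl fun j _ => by rw [hr]; rfl
  · have hli : LinearIndependent K (fun j => (b j : k)) :=
      b.linearIndependent.map' W.subtype (Submodule.ker_subtype _)
    rw [Fintype.linearIndependent_iff] at hli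
    have := hli (fun j => ⟨y j ^ p, ⟨y j, rfl⟩⟩) hy j
    have h2 : y j ^ p = 0 := congrArg Subtype.val this
    exact pow_eq_zero_iff hp.out.ne_zero |>.1 h2

lemma SepP.of_perfect [CharP k p] [PerfectField k] {R : Type*} [Field R] (κ : k →+* R) : SepP p κ := by
  intro n c
  have := PerfectField.toPerfectRing (K := k) p
  refine ⟨1, fun _ => 1, fun i _ => (frobeniusEquiv k p).symm (c i), fun i => ?_, fun y hy j => ?_⟩
  · simp
  · rw [Subsingleton.elim j 0]
    simpa [hp.out.ne_zero] using hy

/-- Separability lifts from the residue field. -/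
lemma SepP.of_res {F R : Type*} [Field F] [Field R] (P : FPlace F R) {ι : k →+* F} {κ : k →+* R}
    (hι : ∀ c, ι c ∈ P.O) (hc : ∀ c, P.res (ι c) = κ c) (h : SepP p κ) : SepP p ι := by
  intro n c
  obtain ⟨m, e, d, h1, h2⟩ := h n c
  refine ⟨m, e, d, h1, fun y hy => ?_⟩
  by_contra! hne
  obtain ⟨j, hj⟩ := hne
  obtain ⟨i, -, hi⟩ := Finset.exists_max_image Finset.univ (fun i => P.O.valuation (y i)) ⟨j, Finset.mem_univ j⟩
  have hi0 : y i ≠ 0 := by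
    intro h0
    have := hi j (Finset.mem_univ j)
    rw [h0, map_zero, le_zero_iff, map_eq_zero] at this
    exact hj this
  have hO (l) : y l / y i ∈ P.O := by
    rw [← P.O.valuation_le_one_iff, map_div₀]
    refine div_le_one_of_le₀ (hi l (Finset.mem_univ l)) zero_le
  have h3 : ∑ l, (y l / y i) ^ p * ι (e l) = 0 := by
    have : ∑ l, (y l / y i) ^ p * ι (e l) = (∑ l, y l ^ p * ι (e l)) * (y i ^ p)⁻¹ := by
      rw [Finset.sum_mul]
      refine Finset.sum_congr rfl fun l _ => ?_
      rw [div_pow]; ring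
    rw [this, hy, zero_mul]
  have h4 : ∑ l, P.res (y l / y i) ^ p * κ (e l) = 0 := by
    rw [← P.res_zero, ← h3, P.res_sum _ fun l => P.O.mul_mem _ _ (P.O.pow_mem' (hO l) p) (hι _)]
    refine Finset.sum_congr rfl fun l _ => ?_
    rw [P.res_mul _ (P.O.pow_mem' (hO l) p) _ (hι _), P.res_pow (hO l), hc]
  have := h2 _ h4 i
  rw [div_self hi0, P.res_one] at this
  exact one_ne_zero this

lemma SepP.up {R I : Type*} [Field R] (U : Ultrafilter I) {κ : k →+* R} (h : SepP p κ) :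
    SepP p ((upConst U R).comp κ) := by
  intro n c
  obtain ⟨m, e, d, h1, h2⟩ := h n c
  refine ⟨m, e, d, h1, fun y hy j => ?_⟩
  have hy' : ∑ j, ((upRep U (y j) : I → R) : UP U R) ^ p * ((fun _ => κ (e j) : I → R) : UP U R) = 0 := by
    rw [← hy]
    refine Finset.sum_congr rfl fun j _ => ?_
    rw [upRep_spec]
    rfl
  simp_rw [up_pow, up_mul] at hy'
  rw [up_sum, up_zero, up_eq] at hy'
  rw [← upRep_spec U (y j), up_zero, up_eq]
  filter_upwards [hy'] with i hi using h2 _ hi j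

/-- A field which is separable algebraic over a rational function field over a perfect field
is generated over its `p`-th powers by the variable. -/
lemma exists_pow_expansion {C : Type*} [Field C] [CharP C p] (t : C) (C₀ : Subfield C)
    [PerfectField C₀] [Algebra.IsSeparable (IntermediateField.adjoin C₀ {t}) C] (c : C) :
    ∃ d : Fin p → C, c = ∑ j, d j ^ p * t ^ (j : ℕ) := by
  let S : Subring C := (Polynomial.eval₂RingHom (frobenius C p) t).range
  have hS (x : C) : x ^ p ∈ S := ⟨Polynomial.C x, by simp [frobenius_def]⟩
  have htS : t ∈ S := ⟨Polynomial.X, by simp⟩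
  have hinv (x : C) (hx : x ∈ S) : x⁻¹ ∈ S := by
    rcases eq_or_ne x 0 with rfl | h0
    · simpa using S.zero_mem
    have : x⁻¹ = x⁻¹ ^ p * x ^ (p - 1) := by
      have h1 : p = (p - 1) + 1 := (Nat.sub_add_cancel hp.out.one_le).symm
      rw [h1, pow_succ, Nat.add_sub_cancel, mul_right_comm, ← mul_pow, inv_mul_cancel₀ h0, one_pow,
        one_mul]
    rw [this]
    exact S.mul_mem (hS _) (S.pow_mem hx _)
  let S' : Subfield C := { S with inv_mem' := hinv }
  have hcS : c ∈ S := by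
    let A := IntermediateField.adjoin C₀ {t}
    have hCp : CharP C₀ p := charP_of_injective_algebraMap (algebraMap C₀ C).injective p |> fun _ =>
      (RingHom.charP_iff (algebraMap C₀ C) (algebraMap C₀ C).injective p).2 inferInstance
    have := PerfectField.toPerfectRing (K := C₀) p
    have hC₀ (x : C₀) : (x : C) ∈ S' := by
      have := hS ((frobeniusEquiv C₀ p).symm x : C₀)
      rw [← SubmonoidClass.coe_pow, ← frobenius_def, frobenius_apply_frobeniusEquiv_symm] at this
      exact this
    have hA (x : A) : (x : C) ∈ S' := by
      have : A ≤ S'.toIntermediateField hC₀ := by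
        rw [IntermediateField.adjoin_le_iff]
        rintro _ rfl
        exact htS
      exact this x.2
    have : CharP A p := (RingHom.charP_iff (algebraMap A C) (algebraMap A C).injective p).2 inferInstance
    have h1 := IntermediateField.adjoin_simple_eq_adjoin_pow_expChar_of_isSeparable' A C c p
    have h2 : IntermediateField.adjoin A {c ^ p} ≤ S'.toIntermediateField hA := by
      rw [IntermediateField.adjoin_le_iff]
      rintro _ rfl
      exact hS c
    rw [← h1] at h2
    exact h2 (IntermediateField.mem_adjoin_simple_self A c)
  obtain ⟨q, rfl⟩ := hcS
  have hlt (i : ℕ) : i % p < p := Nat.mod_lt _ hp.out.pos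
  refine ⟨fun j => ∑ i ∈ q.support with (⟨i % p, hlt i⟩ : Fin p) = j, q.coeff i * t ^ (i / p), ?_⟩
  rw [Polynomial.coe_eval₂RingHom, Polynomial.eval₂_eq_sum, Polynomial.sum,
    ← Finset.sum_fiberwise _ (fun i => (⟨i % p, hlt i⟩ : Fin p))]
  refine Finset.sum_congr rfl fun j _ => ?_
  rw [sum_pow_char p, Finset.sum_mul]
  refine Finset.sum_congr rfl fun i hi => ?_
  rw [← (Finset.mem_filter.1 hi).2, frobenius_def, mul_pow, ← pow_mul, mul_assoc, ← pow_add,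
    Nat.div_add_mod']

lemma eq_zero_of_sum_pow {E : Type*} [Field E] [CharP E p] {t : E} (ht : ∀ s, s ^ p ≠ t)
    (y : Fin p → E) (hy : ∑ j, y j ^ p * t ^ (j : ℕ) = 0) (j : Fin p) : y j = 0 := by
  let K : Subfield E := (frobenius E p).fieldRange
  let a : K := ⟨t ^ p, ⟨t, rfl⟩⟩
  have hirr : Irreducible (Polynomial.X ^ p - Polynomial.C a) := by
    refine X_pow_sub_C_irreducible_of_prime hp.out fun b hb => ?_
    have hb : (b : E) ^ p = t ^ p := congrArg Subtype.val hb
    obtain ⟨s, hs⟩ := b.2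
    refine ht s ?_
    rw [← frobenius_def, ← frobenius_def] at hb
    rw [← frobenius_inj E p hb, ← hs, frobenius_def]
  have hmin : minpoly K t = Polynomial.X ^ p - Polynomial.C a :=
    (minpoly.eq_of_irreducible_of_monic hirr (by
      rw [map_sub, map_pow, Polynomial.aeval_X, Polynomial.aeval_C]
      exact sub_self _) (Polynomial.monic_X_pow_sub_C a hp.out.ne_zero)).symm
  let q : Polynomial K := ∑ j : Fin p, Polynomial.C ⟨y j ^ p, ⟨y j, rfl⟩⟩ * Polynomial.X ^ (j : ℕ)
  have hq : Polynomial.aeval t q = 0 := by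
    rw [← hy, map_sum]
    refine Finset.sum_congr rfl fun j _ => ?_
    rw [map_mul, map_pow, Polynomial.aeval_X, Polynomial.aeval_C]
    rfl
  have hq0 : q = 0 := by
    by_contra h0
    have h1 := minpoly.degree_le_of_ne_zero K t h0 hq
    rw [hmin, Polynomial.degree_X_pow_sub_C hp.out.pos] at h1
    refine absurd (Polynomial.degree_sum_fin_lt fun j => (⟨y j ^ p, ⟨y j, rfl⟩⟩ : K)) (not_lt.2 h1)
  have h3 : q.coeff j = ⟨y j ^ p, ⟨y j, rfl⟩⟩ := by
    rw [Polynomial.finsetSum_coeff]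
    simp only [Polynomial.coeff_C_mul, Polynomial.coeff_X_pow, mul_ite, mul_one, mul_zero]
    rw [Finset.sum_eq_single j]
    · simp
    · intro i _ hij
      rw [if_neg]
      intro h
      exact hij (Fin.ext h.symm)
    · simp
  rw [hq0, Polynomial.coeff_zero] at h3
  have h4 : y j ^ p = 0 := (congrArg Subtype.val h3).symm
  exact pow_eq_zero_iff hp.out.ne_zero |>.1 h4

lemma SepP.of_not_pow {C : Type*} [Field C] [CharP C p] (t : C) (C₀ : Subfield C)
    [PerfectField C₀] [Algebra.IsSeparable (IntermediateField.adjoin C₀ {t}) C]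
    {E : Type*} [Field E] (ι : C →+* E) (ht : ∀ s, s ^ p ≠ ι t) : SepP p ι := by
  have : CharP E p := charP_of_injective_ringHom ι.injective p
  intro n c
  choose d hd using exists_pow_expansion (p := p) t C₀
  refine ⟨p, fun j => t ^ (j : ℕ), fun i => d (c i), fun i => hd (c i), fun y hy => ?_⟩
  simp_rw [map_pow] at hy
  exact eq_zero_of_sum_pow ht y hy

end SepPInstances

section PowerSeriesPlace

open LaurentSeries PowerSeries

variable (K : Type*) [Field K]

/-- The valuation ring of formal power series in the field of Laurent series. -/
noncomputable def psO : ValuationSubring K⸨X⸩ :=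
  { (HahnSeries.ofPowerSeries ℤ K).range with
    mem_or_inv_mem' := fun f => by
      have key (g : K⸨X⸩) (h : 0 ≤ g.order) : g ∈ (HahnSeries.ofPowerSeries ℤ K).range := by
        obtain ⟨n, hn⟩ := Int.eq_ofNat_of_zero_le h
        exact ⟨_, LaurentSeries.X_order_mul_powerSeriesPart hn.symm⟩
      rcases eq_or_ne f 0 with rfl | h0
      · exact Or.inl ⟨0, map_zero _⟩
      rcases le_total 0 f.order with h | h
      · exact Or.inl (key f h)
      · refine Or.inr (key _ ?_)
        have := HahnSeries.order_mul h0 (inv_ne_zero h0)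
        rw [mul_inv_cancel₀ h0, HahnSeries.order_one] at this
        omega }

/-- The place of the field of Laurent series with residue the constant coefficient. -/
noncomputable def psPlace : FPlace K⸨X⸩ K where
  O := psO K
  res f := f.coeff 0
  res_one := by simp
  res_add a _ b _ := rfl
  res_mul := by
    rintro _ ⟨f, rfl⟩ _ ⟨g, rfl⟩
    rw [← map_mul]
    have h (f : K⟦X⟧) : (HahnSeries.ofPowerSeries ℤ K f).coeff 0 = PowerSeries.constantCoeff f := by
      have := LaurentSeries.coeff_coe_powerSeries f 0
      simpa using this
    rw [h, h, h, map_mul]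
  surj r := ⟨HahnSeries.C r, ⟨PowerSeries.C r, HahnSeries.ofPowerSeries_C r⟩, by simp⟩

/-- The variable of the field of Laurent series. -/
noncomputable def psX : K⸨X⸩ := HahnSeries.ofPowerSeries ℤ K PowerSeries.X

variable {K}

lemma psX_ne_zero : psX K ≠ 0 := by
  rw [psX, map_ne_zero_iff _ HahnSeries.ofPowerSeries_injective]
  exact PowerSeries.X_ne_zero

lemma C_mem_psO (a : K) : (HahnSeries.C a : K⸨X⸩) ∈ psO K := ⟨PowerSeries.C a, HahnSeries.ofPowerSeries_C a⟩

lemma psO_res (f : K⟦X⟧) : (psPlace K).res (HahnSeries.ofPowerSeries ℤ K f) = PowerSeries.constantCoeff f := by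
  have := LaurentSeries.coeff_coe_powerSeries f 0
  simpa [psPlace] using this

lemma psO_lt_one (f : K⟦X⟧) : (psO K).valuation (HahnSeries.ofPowerSeries ℤ K f) < 1 ↔
    PowerSeries.constantCoeff f = 0 := by
  rw [← psO_res]
  exact ((psPlace K).res_eq_zero_iff ⟨f, rfl⟩).symm

lemma psX_lt_one : (psO K).valuation (psX K) < 1 := by
  rw [psX, psO_lt_one]
  simp

/-- `x` is a generator of the maximal ideal of a discrete valuation ring. -/
def Unif {F : Type*} [Field F] (V : ValuationSubring F) (x : F) : Prop :=
  x ≠ 0 ∧ V.valuation x < 1 ∧ ∀ y, V.valuation y < 1 → x⁻¹ * y ∈ V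

lemma psX_unif : Unif (psO K) (psX K) := by
  refine ⟨psX_ne_zero, psX_lt_one, fun y hy => ?_⟩
  obtain ⟨f, rfl⟩ := (psO K).mem_of_lt_one hy
  rw [psO_lt_one, ← PowerSeries.X_dvd_iff] at hy
  obtain ⟨g, rfl⟩ := hy
  refine ⟨g, ?_⟩
  rw [map_mul]
  exact (inv_mul_cancel_left₀ psX_ne_zero _).symm

lemma psO_henF : HenF (psO K) := by
  have h1 : HenselianLocalRing K⟦X⟧ := by
    refine ⟨fun f hf a h1 h2 => ?_⟩
    rw [PowerSeries.maximalIdeal_eq_span_X] at h1 ⊢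
    exact HenselianRing.is_henselian (I := Ideal.span {(PowerSeries.X : K⟦X⟧)}) f hf a h1
      (h2.map (Ideal.Quotient.mk _))
  let e : K⟦X⟧ ≃+* psO K :=
    RingEquiv.ofBijective ((HahnSeries.ofPowerSeries ℤ K).codRestrict (psO K) fun f => ⟨f, rfl⟩)
      ⟨fun f g h => HahnSeries.ofPowerSeries_injective (congrArg Subtype.val h),
        fun ⟨_, f, hf⟩ => ⟨f, Subtype.ext hf⟩⟩
  refine HenF.of_henselianLocalRing ⟨fun f hf a ha ha' => ?_⟩
  have ev (q : Polynomial (psO K)) (b : psO K) : (q.map (e.symm : psO K →+* K⟦X⟧)).eval (e.symm b) =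
      e.symm (q.eval b) := Polynomial.eval_map_apply (e.symm : psO K →+* K⟦X⟧) b
  have hm (b : psO K) : e.symm b ∈ IsLocalRing.maximalIdeal K⟦X⟧ ↔ b ∈ IsLocalRing.maximalIdeal (psO K) := by
    simp [IsLocalRing.mem_maximalIdeal, mem_nonunits_iff]
  obtain ⟨r, hr, hr'⟩ := h1.is_henselian (f.map (e.symm : psO K →+* K⟦X⟧)) (hf.map _) (e.symm a)
    (by rw [ev, hm]; exact ha) (by
      rw [Polynomial.derivative_map, ev]
      exact ha'.map e.symm)
  refine ⟨e r, ?_, ?_⟩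
  · have h2 : r = e.symm (e r) := (e.symm_apply_apply r).symm
    rw [h2, Polynomial.IsRoot, ev] at hr
    exact (map_eq_zero_iff e.symm e.symm.injective).1 hr
  · rw [← hm, map_sub, e.symm_apply_apply]
    exact hr'

end PowerSeriesPlace

/-- The localisation of a valuation ring at a multiplicative set. -/
def ValuationSubring.loc {F : Type*} [Field F] (O : ValuationSubring F) (S : Submonoid F)
    (hS : ∀ s ∈ S, s ∈ O) : ValuationSubring F where
  carrier := {g | ∃ s ∈ S, s * g ∈ O}
  one_mem' := ⟨1, S.one_mem, by simp [O.one_mem]⟩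
  zero_mem' := ⟨1, S.one_mem, by simp [O.zero_mem]⟩
  mul_mem' := by
    rintro a b ⟨s, hs, h⟩ ⟨r, hr, h'⟩
    refine ⟨s * r, S.mul_mem hs hr, ?_⟩
    rw [mul_mul_mul_comm]
    exact O.mul_mem _ _ h h'
  add_mem' := by
    rintro a b ⟨s, hs, h⟩ ⟨r, hr, h'⟩
    refine ⟨s * r, S.mul_mem hs hr, ?_⟩
    have : s * r * (a + b) = r * (s * a) + s * (r * b) := by ring
    rw [this]
    exact O.add_mem _ _ (O.mul_mem _ _ (hS r hr) h) (O.mul_mem _ _ (hS s hs) h')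
  neg_mem' := by
    rintro a ⟨s, hs, h⟩
    refine ⟨s, hs, ?_⟩
    rw [mul_neg]
    exact O.neg_mem _ h
  mem_or_inv_mem' a := (O.mem_or_inv_mem a).imp (fun h => ⟨1, S.one_mem, by rwa [one_mul]⟩)
    fun h => ⟨1, S.one_mem, by rwa [one_mul]⟩

namespace ValuationSubring

variable {F : Type*} [Field F] {O : ValuationSubring F} {S : Submonoid F} {hS : ∀ s ∈ S, s ∈ O}

lemma mem_loc {a : F} : a ∈ O.loc S hS ↔ ∃ s ∈ S, s * a ∈ O := Iff.rfl

lemma le_loc : O ≤ O.loc S hS := fun a h => ⟨1, S.one_mem, by rwa [one_mul]⟩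

lemma loc_lt_one {a : F} (h : ∀ s ∈ S, s ≠ 0 ∧ O.valuation (s⁻¹ * a) < 1) :
    (O.loc S hS).valuation a < 1 := by
  rw [lt_one_iff, or_iff_not_imp_left]
  rintro h0 ⟨s, hs, hsa⟩
  have := O.mul_lt_one' hsa (h s hs).2
  have hs0 := (h s hs).1
  have e : s * a⁻¹ * (s⁻¹ * a) = 1 := by field_simp
  rw [e, map_one] at this
  exact lt_irrefl _ this

end ValuationSubring

section PowerSeriesEmbedding

open LaurentSeries PowerSeries

/-- Evaluating power series approximately at a topologically nilpotent element gives a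
homomorphism to a residue field of an ultrapower. -/
lemma exists_psHom {G T : Type} [Field G] [Field T] (O : ValuationSubring G) (τ : T →+* G)
    (hτ : ∀ z, τ z ∈ O) {π : G} (hπ : O.valuation π < 1) (hπ0 : π ≠ 0) :
    ∃ (U : Ultrafilter ℕ) (R : Type) (_ : Field R) (P : FPlace (UP U G) R) (φ : T⸨X⸩ →+* R),
      upO U O ≤ P.O ∧ (∀ a, φ (HahnSeries.C a) = P.res (upConst U G (τ a))) ∧
      φ (psX T) = P.res (upConst U G π) ∧
      ∀ f ∈ psO T, ∃ g ∈ upO U O, φ f = P.res g ∧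
        (upO U O).valuation (g - upConst U G (τ (f.coeff 0))) < 1 := by
  let U : Ultrafilter ℕ := Filter.hyperfilter ℕ
  have hU (n : ℕ) : ∀ᶠ i in (U : Filter ℕ), n ≤ i :=
    Nat.hyperfilter_le_atTop (Filter.eventually_ge_atTop n)
  have hπO := O.mem_of_lt_one hπ
  let S : Submonoid (UP U G) := Submonoid.powers (upConst U G π)
  have hS : ∀ s ∈ S, s ∈ upO U O := by
    rintro _ ⟨n, rfl⟩
    exact (upO U O).pow_mem' (upConst_mem_upO U |>.2 hπO) n
  let P := FPlace.ofValuationSubring ((upO U O).loc S hS)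
  have hle : upO U O ≤ P.O := ValuationSubring.le_loc (hS := hS)
  have hev (q : Polynomial T) : q.eval₂ τ π ∈ O := by
    rw [Polynomial.eval₂_eq_sum, Polynomial.sum]
    exact O.sum_mem' fun i _ => O.mul_mem _ _ (hτ _) (O.pow_mem' hπO i)
  let tr (f : T⟦X⟧) : UP U G := ((fun i => (trunc i f).eval₂ τ π : ℕ → G) : UP U G)
  have htr (f) : tr f ∈ upO U O := Filter.Eventually.of_forall fun i => hev _
  have hsmall (g : UP U G) (hg : ∀ n : ℕ, ∃ h ∈ upO U O, g = upConst U G π ^ n * h) :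
      P.O.valuation g < 1 := by
    refine ValuationSubring.loc_lt_one (hS := hS) ?_
    rintro _ ⟨n, rfl⟩
    have h0 : upConst U G π ≠ 0 := by rwa [Ne, _root_.map_eq_zero]
    refine ⟨pow_ne_zero n h0, ?_⟩
    obtain ⟨h, hh, rfl⟩ := hg (n + 1)
    dsimp only
    rw [pow_succ, mul_assoc, inv_mul_cancel_left₀ (pow_ne_zero n h0)]
    exact (upO U O).mul_lt_one ((upConst_lt_one U).2 hπ) hh
  have hmul (f g : T⟦X⟧) : P.O.valuation (tr (f * g) - tr f * tr g) < 1 := by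
    have hd (i) : ∃ q : Polynomial T, trunc i (f * g) - trunc i f * trunc i g = Polynomial.X ^ i * q := by
      have : Polynomial.X ^ i ∣ trunc i (f * g) - trunc i f * trunc i g := by
        rw [Polynomial.X_pow_dvd_iff]
        intro d hd
        rw [Polynomial.coeff_sub, coeff_trunc, if_pos hd,
          coeff_mul_eq_coeff_trunc_mul_trunc f g hd]
        rw [← Polynomial.coe_mul, Polynomial.coeff_coe, sub_self]
      exact this
    choose q hq using hd
    refine hsmall _ fun n => ⟨((fun i => π ^ (i - n) * (q i).eval₂ τ π : ℕ → G) : UP U G), ?_, ?_⟩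
    · exact Filter.Eventually.of_forall fun i => O.mul_mem _ _ (O.pow_mem' hπO _) (hev _)
    · rw [up_mul, up_sub, ← map_pow, upConst_apply, up_mul, up_eq]
      filter_upwards [hU n] with i hi
      rw [← Polynomial.eval₂_mul, ← Polynomial.eval₂_sub, hq, Polynomial.eval₂_mul,
        Polynomial.eval₂_X_pow, ← mul_assoc, ← pow_add, Nat.add_sub_cancel' hi]
  have hadd (f g : T⟦X⟧) : tr (f + g) = tr f + tr g := by
    rw [up_add, up_eq]
    exact Filter.Eventually.of_forall fun i => by rw [map_add, Polynomial.eval₂_add]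
  have hC (a : T) : tr (PowerSeries.C a) = upConst U G (τ a) := by
    rw [upConst_apply, up_eq]
    filter_upwards [hU 1] with i hi
    obtain ⟨j, rfl⟩ := Nat.exists_eq_add_of_le' hi
    rw [trunc_C, Polynomial.eval₂_C]
  have hX : tr PowerSeries.X = upConst U G π := by
    rw [upConst_apply, up_eq]
    filter_upwards [hU 2] with i hi
    obtain ⟨j, rfl⟩ := Nat.exists_eq_add_of_le' hi
    rw [trunc_X, Polynomial.eval₂_X]
  let ψ : T⟦X⟧ →+* ResF ((upO U O).loc S hS) :=
    { toFun := fun f => P.res (tr f)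
      map_one' := by
        rw [← map_one (PowerSeries.C (R := T)), hC, map_one, map_one, P.res_one]
      map_zero' := by
        rw [← map_zero (PowerSeries.C (R := T)), hC, map_zero, map_zero, P.res_zero]
      map_add' := fun f g => by rw [hadd, P.res_add _ (hle (htr f)) _ (hle (htr g))]
      map_mul' := fun f g => by
        rw [← P.res_mul _ (hle (htr f)) _ (hle (htr g)),
          P.res_eq_iff (hle (htr _)) (P.O.mul_mem _ _ (hle (htr f)) (hle (htr g)))]
        exact hmul f g }
  have hψX : ψ PowerSeries.X ≠ 0 := by
    change P.res (tr _) ≠ 0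
    rw [hX, Ne, P.res_eq_zero_iff (hle ((upConst_mem_upO U).2 hπO)), ValuationSubring.lt_one_iff]
    push Not
    refine ⟨by rwa [Ne, _root_.map_eq_zero], upConst U G π, ⟨1, pow_one _⟩, ?_⟩
    rw [mul_inv_cancel₀ (by rwa [Ne, _root_.map_eq_zero])]
    exact (upO U O).one_mem
  have hψ : Function.Injective ψ := by
    rw [RingHom.injective_iff_ker_eq_bot]
    by_contra hne
    have h1 : (RingHom.ker ψ).IsMaximal := (RingHom.ker_isPrime ψ).isMaximal hne
    have h2 := IsLocalRing.eq_maximalIdeal h1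
    rw [PowerSeries.maximalIdeal_eq_span_X] at h2
    have : PowerSeries.X ∈ RingHom.ker ψ := by
      rw [h2]
      exact Ideal.mem_span_singleton_self _
    exact hψX this
  let φ : T⸨X⸩ →+* ResF ((upO U O).loc S hS) := IsFractionRing.lift hψ
  have hφ (f : T⟦X⟧) : φ (HahnSeries.ofPowerSeries ℤ T f) = P.res (tr f) :=
    IsFractionRing.lift_algebraMap hψ f
  refine ⟨U, _, inferInstance, P, φ, hle, fun a => ?_, ?_, ?_⟩
  · rw [← HahnSeries.ofPowerSeries_C, hφ, hC]
  · rw [psX, hφ, hX]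
  · rintro _ ⟨f, rfl⟩
    refine ⟨tr f, htr f, hφ f, ?_⟩
    have h1 : (HahnSeries.ofPowerSeries ℤ T f).coeff 0 = PowerSeries.constantCoeff f := psO_res f
    rw [h1, upConst_apply, up_sub, upO_lt_one]
    filter_upwards [hU 1] with i hi
    have hd : (Polynomial.X : Polynomial T) ∣ trunc i f - Polynomial.C (PowerSeries.constantCoeff f) := by
      rw [Polynomial.X_dvd_iff, Polynomial.coeff_sub, coeff_trunc, if_pos (Nat.lt_of_succ_le hi), Polynomial.coeff_C_zero]
      simp
    obtain ⟨q, hq⟩ := hd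
    have := congrArg (Polynomial.eval₂ τ π) hq
    rw [Polynomial.eval₂_sub, Polynomial.eval₂_C, Polynomial.eval₂_mul, Polynomial.eval₂_X] at this
    rw [this]
    exact O.mul_lt_one hπ (hev q)

/-- Separable power series extensions embed approximately into henselian fields. -/
lemma Emb.powerSeries {G T k : Type} [Field G] [Field T] [Field k] {p : ℕ} [Fact p.Prime] [CharP k p]
    {O : ValuationSubring G} (hH : HenF O) (τ : T →+* G)
    (hτ : ∀ z, τ z ∈ O) {π : G} (hπ : O.valuation π < 1) (hπ0 : π ≠ 0)
    (κ : k →+* T⸨X⸩) (ι : k →+* G) (hι : ∀ c, ι c ∈ O) (hS : SepP p κ)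
    (hc : ∀ (U : Ultrafilter ℕ) (R : Type) (_ : Field R) (P : FPlace (UP U G) R) (φ : T⸨X⸩ →+* R),
      upO U O ≤ P.O → (∀ a, φ (HahnSeries.C a) = P.res (upConst U G (τ a))) →
      φ (psX T) = P.res (upConst U G π) →
      (∀ f ∈ psO T, ∃ g ∈ upO U O, φ f = P.res g ∧
        (upO U O).valuation (g - upConst U G (τ (f.coeff 0))) < 1) →
      ∀ c, P.res (upConst U G (ι c)) = φ (κ c)) :
    Emb κ (psO T) ι O := by
  obtain ⟨U, R, _, P, φ, hle, h1, h2, h3⟩ := exists_psHom O τ hτ hπ hπ0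
  obtain ⟨W, σ, hσ, hσ', hσc⟩ := P.exists_section φ ((hH.up U).coarsen hle)
    (ι := (upConst U G).comp ι) (fun c => hle ((upConst_mem_upO U).2 (hι c)))
    (hc U R _ P φ hle h1 h2 h3) hS
  have hdiff (z) (g) (hg : g ∈ upO U O) (h : φ z = P.res g) :
      (upO W (upO U O)).valuation (σ z - upConst W _ g) < 1 := by
    have hle' : upO W (upO U O) ≤ (P.up W).O := fun a => by
      refine Filter.Germ.inductionOn a fun f hf => ?_
      filter_upwards [hf] with i hi using hle hi
    refine ValuationSubring.lt_one_of_le hle' ?_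
    rw [← (P.up W).res_eq_iff (hσ z) (hle' ((upConst_mem_upO W).2 hg)), hσ', h]
    rfl
  refine Emb.trans (Emb.of_up W σ (O := upO U O) (ι := upConst U G ∘ ι) (fun z => ?_) hσc)
    (Emb.of_upConst U)
  have hO (z) (hz : z ∈ psO T) : σ z ∈ upO W (upO U O) := by
    obtain ⟨g, hg, h, -⟩ := h3 z hz
    have := (upO W (upO U O)).add_mem _ _ ((upO W (upO U O)).mem_of_lt_one (hdiff z g hg h))
      ((upConst_mem_upO W).2 hg)
    rwa [sub_add_cancel] at this
  refine ⟨fun hz => ?_, hO z⟩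
  by_contra hn
  have hX : (upO W (upO U O)).valuation (σ (psX T)) < 1 := by
    have h4 := hdiff _ _ ((upConst_mem_upO U).2 (O.mem_of_lt_one hπ)) h2
    have := (upO W (upO U O)).add_lt_one h4 ((upConst_lt_one W).2 ((upConst_lt_one U).2 hπ))
    rwa [sub_add_cancel] at this
  have hz0 : z ≠ 0 := by
    rintro rfl
    exact hn (psO T).zero_mem
  have h5 : (psO T).valuation z⁻¹ < 1 := by
    rw [ValuationSubring.lt_one_iff, inv_inv]
    exact Or.inr hn
  have h6 := (upO W (upO U O)).mul_lt_one hX (hO _ (psX_unif.2.2 _ h5))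
  rw [← map_mul, mul_inv_cancel_left₀ psX_ne_zero] at h6
  have h7 := (upO W (upO U O)).mul_lt_one h6 hz
  rw [← map_mul, inv_mul_cancel₀ hz0, map_one, map_one] at h7
  exact lt_irrefl _ h7

end PowerSeriesEmbedding

section Large

open LaurentSeries

variable {L : Type} [Field L]

lemma sepP_C {p : ℕ} [Fact p.Prime] [CharP L p] : SepP p (HahnSeries.C : L →+* L⸨X⸩) :=
  SepP.of_res (psPlace L) (κ := RingHom.id L) C_mem_psO (fun c => by simp [psPlace]) SepP.refl

/-- Nontrivially valued henselian fields are existentially closed in their Laurent series fields. -/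
lemma existentiallyClosedIn_of_henF (p : ℕ) [Fact p.Prime] [CharP L p] {V : ValuationSubring L} (hV : HenF V) (hne : V ≠ ⊤) :
    ExistentiallyClosedIn (algebraMap L L⸨X⸩) := by
  classical
  let U : Ultrafilter (Finset L) := Ultrafilter.of Filter.atTop
  have hU (z : L) : ∀ᶠ S in (U : Filter (Finset L)), z ∈ S := by
    refine Ultrafilter.of_le Filter.atTop ?_
    filter_upwards [Filter.eventually_ge_atTop {z}] with S hS
    exact hS (Finset.mem_singleton_self z)
  obtain ⟨m, hm0, hm⟩ := ValuationSubring.exists_lt_one hne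
  let π : Finset L → L := fun S => m * ∏ a ∈ S with a ≠ 0 ∧ a ∈ V, a
  have hπ0 (S) : π S ≠ 0 :=
    mul_ne_zero hm0 (Finset.prod_ne_zero_iff.2 fun a ha => (Finset.mem_filter.1 ha).2.1)
  have hπ (S) (a) (ha : a ∈ S) (ha0 : a ≠ 0) (haV : a ∈ V) : V.valuation (a⁻¹ * π S) < 1 := by
    have h1 : a ∈ S.filter fun a => a ≠ 0 ∧ a ∈ V := Finset.mem_filter.2 ⟨ha, ha0, haV⟩
    have h2 : a⁻¹ * π S = m * ∏ b ∈ (S.filter fun a => a ≠ 0 ∧ a ∈ V).erase a, b := by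
      change a⁻¹ * (m * ∏ b ∈ S with b ≠ 0 ∧ b ∈ V, b) = _
      rw [← Finset.mul_prod_erase _ (fun b => b) h1, mul_left_comm m, inv_mul_cancel_left₀ ha0]
    rw [h2]
    refine V.mul_lt_one hm (prod_mem fun b hb => ?_)
    exact (Finset.mem_filter.1 (Finset.mem_of_mem_erase hb)).2.2
  let M : Submonoid (UP U L) := (V.toSubmonoid ⊓ nonZeroDivisors L).map (upConst U L : L →* UP U L)
  have hM : ∀ s ∈ M, s ∈ upO U V := by
    rintro _ ⟨a, ha, rfl⟩
    exact (upConst_mem_upO U).2 ha.1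
  let W := (upO U V).loc M hM
  have hτ (z : L) : upConst U L z ∈ W := by
    rcases eq_or_ne z 0 with rfl | h0
    · rw [map_zero]; exact W.zero_mem
    rcases V.mem_or_inv_mem z with h | h
    · exact ValuationSubring.le_loc (hS := hM) ((upConst_mem_upO U).2 h)
    · refine ⟨upConst U L z⁻¹, ⟨z⁻¹, ⟨h, mem_nonZeroDivisors_of_ne_zero (inv_ne_zero h0)⟩, rfl⟩, ?_⟩
      rw [← map_mul, inv_mul_cancel₀ h0, map_one]
      exact (upO U V).one_mem
  have hπ1 : W.valuation (π : UP U L) < 1 := by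
    refine ValuationSubring.loc_lt_one (hS := hM) ?_
    rintro _ ⟨a, ha, rfl⟩
    have ha0 : a ≠ 0 := nonZeroDivisors.ne_zero ha.2
    refine ⟨by simpa using ha0, ?_⟩
    change (upO U V).valuation (((fun _ => a : Finset L → L) : UP U L)⁻¹ * _) < 1
    rw [up_inv, up_mul, upO_lt_one]
    filter_upwards [hU a] with S hS using hπ S a hS ha0 ha.1
  have hπ2 : (π : UP U L) ≠ 0 := by
    rw [Ne, up_zero, up_eq, ← Ultrafilter.eventually_not]
    exact Filter.Eventually.of_forall hπ0
  have h1 : Emb (HahnSeries.C : L → L⸨X⸩) (psO L) (upConst U L) W :=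
    Emb.powerSeries ((hV.up U).coarsen ValuationSubring.le_loc) (upConst U L) hτ hπ1 hπ2
      HahnSeries.C (upConst U L) hτ (sepP_C (p := p)) fun _ _ _ _ _ _ h _ _ c => (h c).symm
  have h2 : Emb (upConst U L) Set.univ (id : L → L) Set.univ := by
    have := Emb.of_upConst (O := (⊤ : ValuationSubring L)) (ι := (id : L → L)) U
    exact this.univ
  intro φ hφ hs
  have h3 : (algebraMap L L⸨X⸩ : L → L⸨X⸩) = HahnSeries.C := funext fun a => LaurentSeries.algebraMap_apply _ a
  rw [h3] at hs
  exact (h1.univ.trans h2).satRC hφ hs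

end Large

section Transfer

variable {M L : Type} [Field M] [Field L]

lemma emb_of_r4 (r4 : R4) (hL : ExistentiallyClosedIn (algebraMap L (LaurentSeries L)))
    (P : FPlace M L) (l : L →+* M) (hl : ∀ z, l z ∈ P.O) (hl' : ∀ z, P.res (l z) = z) :
    Emb l Set.univ id Set.univ := by
  refine emb_univ_of_satRC (r4 L _ hL M _ l ⟨P.O, hl, fun x hx => ?_, fun r => ?_⟩)
  · exact P.inv_mem (hl x) (by rwa [hl'])
  · obtain ⟨a, rfl⟩ := IsLocalRing.residue_surjective r
    refine ⟨P.res a, ?_⟩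
    refine Ideal.Quotient.eq.2 ?_
    rw [ValuationSubring.valuation_lt_one_iff]
    exact (P.res_eq_iff (hl _) a.2).1 (hl' _)

/-- Every element `a` of the maximal ideal gives an equation `1 + y + a * y ^ 2 = 0` soluble in the
valuation ring. -/
def QHen {F : Type*} [Field F] (O : ValuationSubring F) : Prop :=
  ∀ a, O.valuation a < 1 → ∃ y ∈ O, 1 + y + a * y ^ 2 = 0

lemma Unif.mem_of_quadratic {V : ValuationSubring L} {x : L} (hx : Unif V x) {b y : L}
    (h : 1 + y + x * b ^ 2 * y ^ 2 = 0) : b ∈ V := by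
  have contra {r : L} (hr : r ∈ V) (h : x * r + 1 = 0) : False := by
    have h1 := V.mul_lt_one hx.2.1 hr
    rw [eq_neg_of_add_eq_zero_left h, Valuation.map_neg, map_one] at h1
    exact lt_irrefl _ h1
  have key {c : L} (hc : c ∉ V) : ∃ d ∈ V, c⁻¹ = x * d := by
    have : V.valuation c⁻¹ < 1 := by
      rw [ValuationSubring.lt_one_iff, inv_inv]
      exact Or.inr hc
    exact ⟨_, hx.2.2 _ this, by rw [mul_inv_cancel_left₀ hx.1]⟩
  by_contra hb
  have hb0 : b ≠ 0 := by
    rintro rfl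
    exact hb V.zero_mem
  obtain ⟨b', hb', e⟩ := key hb
  have h1 : 1 + b * y * b⁻¹ + x * (b * y) ^ 2 = 0 := by
    rw [← h]
    field_simp
  by_cases hz : b * y ∈ V
  · refine contra (r := b * y * b' + (b * y) ^ 2) (V.add_mem _ _ (V.mul_mem _ _ hz hb') (V.pow_mem' hz 2)) ?_
    rw [← h1, e]
    ring
  · obtain ⟨w, hw, e'⟩ := key hz
    have hz0 : b * y ≠ 0 := by
      intro h0
      rw [h0] at hz
      exact hz V.zero_mem
    refine contra (r := w ^ 2 + w * b') (V.add_mem _ _ (V.pow_mem' hw 2) (V.mul_mem _ _ hw hb')) ?_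
    have h2 : x * (x * (w ^ 2 + w * b') + 1) = 0 := by
      have h3 : (b * y)⁻¹ ^ 2 + (b * y)⁻¹ * b⁻¹ + x = 0 := by
        have aux (z w : L) (hz : z ≠ 0) :
            z⁻¹ ^ 2 + z⁻¹ * w + x = (1 + z * w + x * z ^ 2) * z⁻¹ ^ 2 := by
          field_simp
        rw [aux _ _ hz0, h1, zero_mul]
      rw [e', e] at h3
      rw [← h3]
      ring
    exact (mul_eq_zero.1 h2).resolve_left hx.1

/-- The transfer of existential sentences from a composite valuation to a discrete one. -/
lemma emb_comp_of_r4 (r4 : R4) {p : ℕ} [Fact p.Prime] [CharP L p]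
    (P : FPlace M L) (l : L →+* M) (hl : ∀ z, l z ∈ P.O) (hl' : ∀ z, P.res (l z) = z)
    {V : ValuationSubring L} (hV : HenF V) {x : L} (hx : Unif V x) (hq : QHen (P.comp V))
    {C : Type} (κ : C → L) : Emb (l ∘ κ) (P.comp V) κ V := by
  have hne : V ≠ ⊤ := by
    rintro rfl
    have := hx.2.1
    rw [ValuationSubring.lt_one_iff] at this
    exact this.elim hx.1 fun h => h (ValuationSubring.mem_top _)
  obtain ⟨𝓕, h𝓕, hr, -, hC⟩ := emb_of_r4 r4 (existentiallyClosedIn_of_henF p hV hne) P l hl hl'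
  have h1 (a) (ha : a ∈ P.comp V) : ∀ᶠ f in 𝓕, f a ∈ V := by
    have hlx : (P.comp V).valuation (l x * a ^ 2) < 1 :=
      (P.comp V).mul_lt_one (P.comp_lt_one.2 ⟨hl x, by rw [hl']; exact hx.2.1⟩) ((P.comp V).pow_mem' ha 2)
    obtain ⟨y, -, hy⟩ := hq _ hlx
    filter_upwards [hr.map_zero, hr.map_one, hr.map_add (1 + y) (l x * a ^ 2 * y ^ 2), hr.map_add 1 y,
      hr.map_mul (l x * a ^ 2) (y ^ 2), hr.map_mul (l x) (a ^ 2), hr.map_pow a 2, hr.map_pow y 2,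
      hC x] with f h0 h1 h2 h3 h4 h5 h6 h7 h8
    refine hx.mem_of_quadratic (y := f y) ?_
    rw [hy, h0, h3, h4, h5, h6, h7, h8, h1] at h2
    exact h2.symm
  refine ⟨𝓕, h𝓕, hr, fun a => ?_, fun c => hC (κ c)⟩
  by_cases ha : a ∈ P.comp V
  · filter_upwards [h1 a ha] with f hf using iff_of_true hf ha
  · have ha0 : a ≠ 0 := by
      rintro rfl
      exact ha (P.comp V).zero_mem
    have h2 : (P.comp V).valuation a⁻¹ < 1 := by
      rw [ValuationSubring.lt_one_iff, inv_inv]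
      exact Or.inr ha
    rw [P.comp_lt_one] at h2
    have h3 : l x⁻¹ * a⁻¹ ∈ P.comp V := by
      refine ⟨P.O.mul_mem _ _ (hl _) h2.1, ?_⟩
      rw [P.res_mul _ (hl _) _ h2.1, hl']
      exact hx.2.2 _ h2.2
    filter_upwards [h1 _ h3, hr.map_mul (l x⁻¹ * a⁻¹) a, hC x⁻¹] with f h4 h5 h6
    rw [mul_assoc, inv_mul_cancel₀ ha0, mul_one, h6] at h5
    refine iff_of_false (fun h => ?_) ha
    have h7 := V.mul_mem _ _ h4 h
    rw [← h5] at h7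
    have h8 := V.mul_lt_one hx.2.1 h7
    rw [id, mul_inv_cancel₀ hx.1, map_one] at h8
    exact lt_irrefl _ h8

end Transfer

section SequentialColimit

/-- The field `L`, with the maps `g n`, is the union of the sequence of fields `A n`. -/
structure IsSeqUnion {A : ℕ → Type} [∀ n, Field (A n)] (s : ∀ n, A n →+* A (n + 1))
    {L : Type} [Field L] (g : ∀ n, A n →+* L) : Prop where
  map_succ : ∀ n x, g (n + 1) (s n x) = g n x
  surj : ∀ a, ∃ n x, g n x = a

variable {A : ℕ → Type} [∀ n, Field (A n)] {s : ∀ n, A n →+* A (n + 1)}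

lemma exists_isSeqUnion (s : ∀ n, A n →+* A (n + 1)) :
    ∃ (L : Type) (_ : Field L) (g : ∀ n, A n →+* L), IsSeqUnion s g := by
  let f (m n : ℕ) (h : m ≤ n) : A m →+* A n :=
    Nat.leRecOn (C := fun n => A m →+* A n) h (fun {k} φ => (s k).comp φ) (RingHom.id (A m))
  have f_self (m) : f m m le_rfl = RingHom.id (A m) := Nat.leRecOn_self _
  have f_succ (m n) (h : m ≤ n) : f m (n + 1) (h.trans n.le_succ) = (s n).comp (f m n h) :=
    Nat.leRecOn_succ h _
  have : DirectedSystem A (f · · ·) :=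
    { map_self := fun i x => by rw [f_self, RingHom.id_apply]
      map_map := fun k j i hij hjk x => by
        induction k, hjk using Nat.le_induction with
        | base => rw [f_self, RingHom.id_apply]
        | succ n hn ih => rw [f_succ j n hn, f_succ i n (hij.trans hn), RingHom.comp_apply, ih,
            RingHom.comp_apply] }
  refine ⟨DirectLimit A f, inferInstance, fun n => DirectLimit.Ring.of A f n, fun n x => ?_, fun a => ?_⟩
  · have h := f_succ n n le_rfl
    rw [f_self, RingHom.comp_id] at h
    rw [← h]
    exact (DirectLimit.mk_apply (f := f) n (n + 1) x n.le_succ)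
  · obtain ⟨n, x, rfl⟩ := DirectLimit.exists_eq_mk f a
    exact ⟨n, x, rfl⟩

namespace IsSeqUnion

variable {L : Type} [Field L] {g : ∀ n, A n →+* L} (h : IsSeqUnion s g)
include h

lemma exists_le {n m : ℕ} (hnm : n ≤ m) (x : A n) : ∃ y, g m y = g n x := by
  induction m, hnm using Nat.le_induction with
  | base => exact ⟨x, rfl⟩
  | succ k _ ih =>
    obtain ⟨y, hy⟩ := ih
    exact ⟨s _ y, (h.map_succ _ _).trans hy⟩

lemma exists_pair (a b : L) : ∃ n x y, g n x = a ∧ g n y = b := by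
  obtain ⟨n, x, rfl⟩ := h.surj a
  obtain ⟨m, y, rfl⟩ := h.surj b
  obtain ⟨x', hx⟩ := h.exists_le (le_max_left n m) x
  obtain ⟨y', hy⟩ := h.exists_le (le_max_right n m) y
  exact ⟨_, x', y', hx, hy⟩

lemma exists_family {N : ℕ} (c : ℕ → L) : ∃ n, ∀ k < N, ∃ x, g n x = c k := by
  induction N with
  | zero => exact ⟨0, by simp⟩
  | succ N ih =>
    obtain ⟨n, hn⟩ := ih
    obtain ⟨m, x, hx⟩ := h.surj (c N)
    refine ⟨max n m, fun k hk => ?_⟩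
    rcases Nat.lt_succ_iff_lt_or_eq.1 hk with hk | rfl
    · obtain ⟨y, hy⟩ := hn k hk
      obtain ⟨z, hz⟩ := h.exists_le (le_max_left n m) y
      exact ⟨z, hz.trans hy⟩
    · obtain ⟨z, hz⟩ := h.exists_le (le_max_right n m) x
      exact ⟨z, hz.trans hx⟩

lemma map_eq {B : Type*} {f : ∀ n, A n → B} (hf : ∀ n x, f (n + 1) (s n x) = f n x) {n m : ℕ}
    {x : A n} {y : A m} (e : g n x = g m y) : f n x = f m y := by
  have key (n) (x : A n) (M) (hM : n ≤ M) : ∃ z, g M z = g n x ∧ f M z = f n x := by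
    induction M, hM using Nat.le_induction with
    | base => exact ⟨x, rfl, rfl⟩
    | succ k _ ih =>
      obtain ⟨z, h1, h2⟩ := ih
      exact ⟨s _ z, (h.map_succ _ _).trans h1, (hf _ _).trans h2⟩
  obtain ⟨z, h1, h2⟩ := key n x _ (le_max_left n m)
  obtain ⟨z', h1', h2'⟩ := key m y _ (le_max_right n m)
  have : z = z' := (g _).injective (by rw [h1, h1', e])
  rw [← h2, this, h2']

lemma exists_desc {B : Type*} (f : ∀ n, A n → B) (hf : ∀ n x, f (n + 1) (s n x) = f n x) :
    ∃ F : L → B, ∀ n x, F (g n x) = f n x := by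
  choose n x hx using h.surj
  exact ⟨fun a => f (n a) (x a), fun m y => h.map_eq hf (hx _)⟩

lemma exists_descHom {B : Type*} [Field B] (f : ∀ n, A n →+* B)
    (hf : ∀ n x, f (n + 1) (s n x) = f n x) : ∃ F : L →+* B, ∀ n x, F (g n x) = f n x := by
  obtain ⟨F, hF⟩ := h.exists_desc (fun n => f n) hf
  refine ⟨⟨⟨⟨F, ?_⟩, fun a b => ?_⟩, ?_, fun a b => ?_⟩, hF⟩
  · rw [← map_one (g 0), hF, map_one]
  · obtain ⟨n, x, y, rfl, rfl⟩ := h.exists_pair a b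
    change F _ = F _ * F _
    rw [← map_mul, hF, hF, hF, map_mul]
  · change F 0 = 0
    rw [← map_zero (g 0), hF, map_zero]
  · obtain ⟨n, x, y, rfl, rfl⟩ := h.exists_pair a b
    change F _ = F _ + F _
    rw [← map_add, hF, hF, hF, map_add]

lemma exists_valuationSubring (O : ∀ n, ValuationSubring (A n))
    (hO : ∀ n x, s n x ∈ O (n + 1) ↔ x ∈ O n) :
    ∃ V : ValuationSubring L, ∀ n x, g n x ∈ V ↔ x ∈ O n := by
  obtain ⟨F, hF⟩ := h.exists_desc (fun n x => x ∈ O n) fun n x => propext (hO n x)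
  refine ⟨⟨⟨⟨⟨⟨{a | F a}, fun {a b} ha hb => ?_⟩, ?_⟩, fun {a b} ha hb => ?_, ?_⟩, fun {a} ha => ?_⟩,
    fun a => ?_⟩, fun n x => (hF n x).to_iff⟩
  · obtain ⟨n, x, y, rfl, rfl⟩ := h.exists_pair a b
    change F _
    rw [← map_mul, hF]
    exact (O n).mul_mem _ _ ((hF n x).to_iff.1 ha) ((hF n y).to_iff.1 hb)
  · change F 1
    rw [← map_one (g 0), hF]
    exact (O 0).one_mem
  · obtain ⟨n, x, y, rfl, rfl⟩ := h.exists_pair a b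
    change F _
    rw [← map_add, hF]
    exact (O n).add_mem _ _ ((hF n x).to_iff.1 ha) ((hF n y).to_iff.1 hb)
  · change F 0
    rw [← map_zero (g 0), hF]
    exact (O 0).zero_mem
  · obtain ⟨n, x, rfl⟩ := h.surj a
    change F _
    rw [← map_neg, hF]
    exact (O n).neg_mem _ ((hF n x).to_iff.1 ha)
  · obtain ⟨n, x, rfl⟩ := h.surj a
    change F _ ∨ F _
    rw [← map_inv₀, hF, hF]
    exact (O n).mem_or_inv_mem x

lemma henF {O : ∀ n, ValuationSubring (A n)} {V : ValuationSubring L}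
    (hV : ∀ n x, g n x ∈ V ↔ x ∈ O n) (hO : ∀ n, HenF (O n)) : HenF V := by
  intro N c hc
  obtain ⟨n, hn⟩ := h.exists_family (N := N) c
  choose! x hx using hn
  have hx' (k) (hk : k < N) : (O n).valuation (x k) < 1 := by
    have := hc k hk
    rw [← hx k hk, ValuationSubring.lt_one_iff, map_eq_zero, ← map_inv₀, hV] at this
    exact (ValuationSubring.lt_one_iff _ _).2 this
  obtain ⟨y, hy, e⟩ := hO n N x hx'
  refine ⟨g n y, (hV n y).2 hy, ?_⟩
  have e' := congrArg (g n) e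
  simp only [map_add, map_one, map_sum, map_mul, map_pow, map_zero] at e'
  rw [← e']
  congr 1
  refine Finset.sum_congr rfl fun k hk => ?_
  rw [hx k (Finset.mem_range.1 hk)]

lemma emb {C B : Type*} [Field B] {V : Set L} {W : Set B} {O : ∀ n, Set (A n)}
    (hV : ∀ n x, g n x ∈ V ↔ x ∈ O n) {ι : ∀ n, C → A n} (hι : ∀ n c, s n (ι n c) = ι (n + 1) c)
    {κ : C → B} (hE : ∀ n, Emb (ι n) (O n) κ W) : Emb (g 0 ∘ ι 0) V κ W := by
  classical
  choose 𝓕 hne hr hO hC using hE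
  let q (n : ℕ) (f : A n → B) (a : L) : B := if ha : ∃ x, g n x = a then f ha.choose else 0
  have hq (n) (f : A n → B) (x) : q n f (g n x) = f x := by
    have ha : ∃ y, g n y = g n x := ⟨x, rfl⟩
    simp only [q, dif_pos ha]
    rw [(g n).injective ha.choose_spec]
  have key {Q : (L → B) → Prop} (N : ℕ) (hQ : ∀ n, N ≤ n → ∀ᶠ f in 𝓕 n, Q (q n f)) :
      ∀ᶠ f in Filter.atTop.bind fun n => (𝓕 n).map (q n), Q f := by
    rw [Filter.eventually_bind]
    filter_upwards [Filter.eventually_ge_atTop N] with n hn using hQ n hn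
  have hB : (Filter.atTop.bind fun n => (𝓕 n).map (q n)).NeBot := by
    refine Filter.neBot_iff.2 fun hbot => ?_
    have h0 := Filter.empty_mem_iff_bot.2 hbot
    obtain ⟨n, hn⟩ := Filter.nonempty_of_mem (f := Filter.atTop) (Filter.mem_bind'.1 h0)
    have := hne n
    exact Filter.empty_notMem ((𝓕 n).map (q n)) hn
  refine ⟨Filter.atTop.bind fun n => (𝓕 n).map (q n), hB, ⟨fun a b => ?_, fun a b => ?_, ?_⟩,
    fun a => ?_, fun c => ?_⟩
  · obtain ⟨N, x, y, rfl, rfl⟩ := h.exists_pair a b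
    refine key N fun n hn => ?_
    obtain ⟨x', hx⟩ := h.exists_le hn x
    obtain ⟨y', hy⟩ := h.exists_le hn y
    rw [← hx, ← hy]
    filter_upwards [(hr n).map_add x' y'] with f hf
    rw [← map_add, hq, hq, hq, hf]
  · obtain ⟨N, x, y, rfl, rfl⟩ := h.exists_pair a b
    refine key N fun n hn => ?_
    obtain ⟨x', hx⟩ := h.exists_le hn x
    obtain ⟨y', hy⟩ := h.exists_le hn y
    rw [← hx, ← hy]
    filter_upwards [(hr n).map_mul x' y'] with f hf
    rw [← map_mul, hq, hq, hq, hf]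
  · refine key 0 fun n _ => ?_
    filter_upwards [(hr n).map_one] with f hf
    rw [← map_one (g n), hq, hf]
  · obtain ⟨N, x, rfl⟩ := h.surj a
    refine key N fun n hn => ?_
    obtain ⟨x', hx⟩ := h.exists_le hn x
    rw [← hx]
    filter_upwards [hO n x'] with f hf
    rw [hq, hV, hf]
  · refine key 0 fun n _ => ?_
    have : g n (ι n c) = g 0 (ι 0 c) := by
      clear key
      induction n with
      | zero => rfl
      | succ n ih => rw [← hι, h.map_succ, ih (Nat.zero_le _)]
    filter_upwards [hC n c] with f hf
    rw [Function.comp_apply, ← this, hq, hf]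

end IsSeqUnion

end SequentialColimit

section EmbTransfer

variable {A B C : Type*} [Field A] [Field B] {ιA : C → A} {ιB : C → B}
  {V : ValuationSubring A} {W : ValuationSubring B}

lemma RingApprox.eventually_inv {𝓕 : Filter (A → B)} [𝓕.NeBot] (h : RingApprox 𝓕) (a : A) :
    ∀ᶠ f in 𝓕, f a⁻¹ = (f a)⁻¹ := by
  rcases eq_or_ne a 0 with rfl | h0
  · filter_upwards [h.map_zero] with f hf
    rw [inv_zero, hf, inv_zero]
  · filter_upwards [h.map_mul a⁻¹ a, h.map_one] with f h1 h2
    rw [inv_mul_cancel₀ h0, h2] at h1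
    exact eq_inv_of_mul_eq_one_left h1.symm

lemma RingApprox.lt_one_iff {𝓕 : Filter (A → B)} [𝓕.NeBot] (h : RingApprox 𝓕)
    (hO : ∀ a, ∀ᶠ f in 𝓕, f a ∈ W ↔ a ∈ V) (a : A) :
    ∀ᶠ f in 𝓕, W.valuation (f a) < 1 ↔ V.valuation a < 1 := by
  rcases eq_or_ne a 0 with rfl | h0
  · filter_upwards [h.map_zero] with f hf
    simp [hf]
  · filter_upwards [h.eventually_inv a, hO a⁻¹, h.map_ne_zero h0] with f h1 h2 h3
    rw [ValuationSubring.lt_one_iff, ValuationSubring.lt_one_iff, ← h1, h2]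
    simp [h0, h3]

lemma Emb.unif (h : Emb ιA (V : Set A) ιB (W : Set B)) {c : C} (hc : Unif W (ιB c)) :
    Unif V (ιA c) := by
  obtain ⟨𝓕, hne, hr, hO, hC⟩ := h
  refine ⟨?_, ?_, fun y hy => ?_⟩
  · intro h0
    obtain ⟨f, h1, h2⟩ := ((hC c).and hr.map_zero).exists
    rw [h0, h2] at h1
    exact hc.1 h1.symm
  · obtain ⟨f, h1, h2⟩ := ((hC c).and (hr.lt_one_iff hO (ιA c))).exists
    rw [h1] at h2
    exact h2.1 hc.2.1
  · obtain ⟨f, h1, h2, h3, h4, h5⟩ := ((hC c).and ((hr.lt_one_iff hO y).and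
      ((hr.map_mul (ιA c)⁻¹ y).and ((hr.eventually_inv (ιA c)).and (hO ((ιA c)⁻¹ * y)))))).exists
    refine h5.1 ?_
    change _ ∈ W
    rw [h3, h4, h1]
    exact hc.2.2 _ (h2.2 hy)

/-- The elements of positive value of the form `t - s ^ p` are uniformizers. -/
def UnifPow (V : ValuationSubring A) (p : ℕ) (t : A) : Prop :=
  ∀ s, V.valuation (t - s ^ p) < 1 → Unif V (t - s ^ p)

lemma UnifPow.of_emb {p : ℕ} (h : Emb ιA (V : Set A) ιB (W : Set B)) {c : C}
    (hc : UnifPow W p (ιB c)) : UnifPow V p (ιA c) := by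
  intro s hs
  obtain ⟨𝓕, hne, hr, hO, hC⟩ := h
  let x := ιA c - s ^ p
  have hx : ∀ᶠ f in 𝓕, Unif W (f x) := by
    filter_upwards [hr.map_sub (ιA c) (s ^ p), hr.map_pow s p, hC c, hr.lt_one_iff hO x] with f h1 h2 h3 h4
    have h5 := h4.2 hs
    have h6 : f x = ιB c - f s ^ p := by rw [h1, h2, h3]
    rw [h6] at h5 ⊢
    exact hc _ h5
  refine ⟨?_, hs, fun y hy => ?_⟩
  · intro h0
    obtain ⟨f, h1, h2⟩ := (hx.and hr.map_zero).exists
    change x = 0 at h0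
    rw [h0, h2] at h1
    exact h1.1 rfl
  · obtain ⟨f, h1, h2, h3, h4, h5⟩ := (hx.and ((hr.lt_one_iff hO y).and
      ((hr.map_mul x⁻¹ y).and ((hr.eventually_inv x).and (hO (x⁻¹ * y)))))).exists
    refine h5.1 ?_
    change _ ∈ W
    rw [h3, h4]
    exact h1.2.2 _ (h2.2 hy)

end EmbTransfer

section Chain

/-- A henselian place together with a partial section of the residue map, defined on a subfield
over which the residue field is separable. -/
structure SectionDatum (p : ℕ) where
  /-- the domain of the partial section -/
  k : Type
  /-- the field -/
  F : Type
  /-- the residue field -/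
  R : Type
  [fieldk : Field k]
  [fieldF : Field F]
  [fieldR : Field R]
  [char : CharP k p]
  /-- the place -/
  P : FPlace F R
  /-- a valuation on the residue field -/
  V : ValuationSubring R
  /-- the partial section -/
  ι : k →+* F
  /-- the inclusion of the domain of the section -/
  κ : k →+* R
  mem : ∀ c, ι c ∈ P.O
  res_eq : ∀ c, P.res (ι c) = κ c
  hen : HenF (P.comp V)
  sep : SepP p κ

namespace SectionDatum

attribute [instance] fieldk fieldF fieldR char

variable {p : ℕ} [Fact p.Prime] (X : SectionDatum p)

lemma exists_extension : ∃ (U : Ultrafilter (Finset X.R)) (σ : X.R →+* UP U X.F),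
    (∀ z, σ z ∈ (X.P.up U).O) ∧ (∀ z, (X.P.up U).res (σ z) = upConst U X.R z) ∧
      ∀ c, σ (X.κ c) = upConst U X.F (X.ι c) :=
  X.P.exists_section (RingHom.id X.R) (X.hen.coarsen (X.P.comp_le X.V)) X.mem X.res_eq X.sep

/-- The ultrafilter used to extend the partial section. -/
noncomputable def U : Ultrafilter (Finset X.R) := X.exists_extension.choose

/-- The extended section. -/
noncomputable def σ : X.R →+* UP X.U X.F := X.exists_extension.choose_spec.choose

lemma σ_mem (z) : X.σ z ∈ (X.P.up X.U).O := X.exists_extension.choose_spec.choose_spec.1 z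

lemma res_σ (z) : (X.P.up X.U).res (X.σ z) = upConst X.U X.R z :=
  X.exists_extension.choose_spec.choose_spec.2.1 z

lemma σ_κ (c) : X.σ (X.κ c) = upConst X.U X.F (X.ι c) :=
  X.exists_extension.choose_spec.choose_spec.2.2 c

/-- The datum given by the extended section. -/
noncomputable def next : SectionDatum p where
  k := X.R
  F := UP X.U X.F
  R := UP X.U X.R
  char := charP_of_injective_ringHom X.κ.injective p
  P := X.P.up X.U
  V := upO X.U X.V
  ι := X.σ
  κ := upConst X.U X.R
  mem := X.σ_mem
  res_eq := X.res_σ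
  hen := by
    rw [FPlace.up_comp]
    exact X.hen.up X.U
  sep := by
    have : CharP X.R p := charP_of_injective_ringHom X.κ.injective p
    exact SepP.refl.up X.U

/-- The iterated extensions of a datum. -/
noncomputable def iter : ℕ → SectionDatum p
  | 0 => X
  | n + 1 => (iter n).next

/-- The embedding of a field in the next one. -/
noncomputable def stepF (n : ℕ) : (X.iter n).F →+* (X.iter (n + 1)).F :=
  upConst (X.iter n).U (X.iter n).F

/-- The embedding of a residue field in the next one. -/
noncomputable def stepR (n : ℕ) : (X.iter n).R →+* (X.iter (n + 1)).R :=
  upConst (X.iter n).U (X.iter n).R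

/-- The embedding of the first field. -/
noncomputable def inclF : ∀ n, X.F →+* (X.iter n).F
  | 0 => RingHom.id X.F
  | n + 1 => (X.stepF n).comp (inclF n)

/-- The embedding of the first residue field. -/
noncomputable def inclR : ∀ n, X.R →+* (X.iter n).R
  | 0 => RingHom.id X.R
  | n + 1 => (X.stepR n).comp (inclR n)

lemma emb_inclF (n : ℕ) : Emb (X.inclF n) ((X.iter n).P.O : Set (X.iter n).F) id (X.P.O : Set X.F) := by
  induction n with
  | zero => exact Emb.of_ringHom (RingHom.id X.F) (fun _ => Iff.rfl) fun _ => rfl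
  | succ n ih => exact Emb.trans (Emb.of_upConst (X.iter n).U) ih

lemma emb_inclR (n : ℕ) : Emb (X.inclR n) ((X.iter n).V : Set (X.iter n).R) id (X.V : Set X.R) := by
  induction n with
  | zero => exact Emb.of_ringHom (RingHom.id X.R) (fun _ => Iff.rfl) fun _ => rfl
  | succ n ih => exact Emb.trans (Emb.of_upConst (X.iter n).U) ih

/-- The limit of the iterated extensions: the residue map has a section. -/
theorem exists_limit : ∃ (F' R' : Type) (_ : Field F') (_ : Field R') (P' : FPlace F' R')
    (V' : ValuationSubring R') (j : X.F →+* F') (r : X.R →+* R') (l : R' →+* F'),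
    (∀ x, j x ∈ P'.O ↔ x ∈ X.P.O) ∧ (∀ x, P'.res (j x) = r (X.P.res x)) ∧
    (∀ z, r z ∈ V' ↔ z ∈ X.V) ∧ (∀ z, l z ∈ P'.O) ∧ (∀ z, P'.res (l z) = z) ∧
    (∀ c, l (r (X.κ c)) = j (X.ι c)) ∧ HenF (P'.comp V') ∧
    Emb r (V' : Set R') id (X.V : Set X.R) ∧ Emb j (P'.O : Set F') id (X.P.O : Set X.F) := by
  obtain ⟨F', _, gF, hF⟩ := exists_isSeqUnion X.stepF
  obtain ⟨R', _, gR, hR⟩ := exists_isSeqUnion X.stepR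
  obtain ⟨O', hO'⟩ := hF.exists_valuationSubring (fun n => (X.iter n).P.O)
    fun n x => upConst_mem_upO (X.iter n).U
  obtain ⟨V', hV'⟩ := hR.exists_valuationSubring (fun n => (X.iter n).V)
    fun n x => upConst_mem_upO (X.iter n).U
  obtain ⟨res, hres⟩ := hF.exists_desc (fun n x => gR n ((X.iter n).P.res x)) fun n x =>
    hR.map_succ n ((X.iter n).P.res x)
  obtain ⟨l, hl⟩ := hR.exists_descHom (fun n => (gF (n + 1)).comp (X.iter n).σ) fun n z => by
    refine Eq.trans ?_ (hF.map_succ (n + 1) ((X.iter n).σ z))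
    exact congrArg (gF (n + 2)) ((X.iter (n + 1)).σ_κ z)
  let P' : FPlace F' R' :=
    { O := O'
      res := res
      res_one := by rw [← map_one (gF 0), hres, FPlace.res_one, map_one]
      res_add := fun a ha b hb => by
        obtain ⟨n, x, y, rfl, rfl⟩ := hF.exists_pair a b
        rw [← map_add, hres, hres, hres, (X.iter n).P.res_add _ ((hO' n x).1 ha) _ ((hO' n y).1 hb),
          map_add]
      res_mul := fun a ha b hb => by
        obtain ⟨n, x, y, rfl, rfl⟩ := hF.exists_pair a b
        rw [← map_mul, hres, hres, hres, (X.iter n).P.res_mul _ ((hO' n x).1 ha) _ ((hO' n y).1 hb),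
          map_mul]
      surj := fun z => by
        obtain ⟨n, z, rfl⟩ := hR.surj z
        obtain ⟨a, ha, rfl⟩ := (X.iter n).P.surj z
        exact ⟨gF n a, (hO' n a).2 ha, hres n a⟩ }
  refine ⟨F', R', _, _, P', V', gF 0, gR 0, l, hO' 0, hres 0, hV' 0, fun z => ?_, fun z => ?_,
    fun c => ?_, ?_, ?_, ?_⟩
  · obtain ⟨n, z, rfl⟩ := hR.surj z
    rw [hl]
    exact (hO' (n + 1) _).2 ((X.iter n).σ_mem z)
  · obtain ⟨n, z, rfl⟩ := hR.surj z
    rw [hl]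
    refine (hres (n + 1) _).trans (Eq.trans (congrArg (gR (n + 1)) ?_) (hR.map_succ n z))
    exact (X.iter n).res_σ z
  · exact (hl 0 (X.κ c)).trans ((congrArg (gF 1) (X.σ_κ c)).trans (hF.map_succ 0 (X.ι c)))
  · refine hF.henF (O := fun n => (X.iter n).P.comp (X.iter n).V) (fun n x => ?_) fun n => (X.iter n).hen
    exact and_congr (hO' n x) ((iff_of_eq (congrArg (· ∈ V') (hres n x))).trans (hV' n _))
  · exact hR.emb (ι := fun n => X.inclR n) hV' (fun _ _ => rfl) X.emb_inclR
  · exact hF.emb (ι := fun n => X.inclF n) hO' (fun _ _ => rfl) X.emb_inclF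

end SectionDatum

end Chain

section Exact

variable {Ω L : Type} [Field Ω] [Field L] (W : ValuationSubring Ω) (j : L →+* Ω)

/-- A subfield on which the valuation has no more residues than `L`. -/
def ExactOver (H : Subfield Ω) : Prop := ∀ a ∈ H, a ∈ W → ∃ z, W.valuation (a - j z) < 1

variable {W j}

lemma ExactOver.exists_maximal {H₀ : Subfield Ω} (h₀ : ExactOver W j H₀) :
    ∃ H, H₀ ≤ H ∧ ExactOver W j H ∧ ∀ H', ExactOver W j H' → H ≤ H' → H' ≤ H := by
  obtain ⟨H, hle, hmax⟩ := zorn_le_nonempty₀ {H | ExactOver W j H} (fun c hc hchain y hy => by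
    refine ⟨sSup c, fun a ha => ?_, fun z hz => le_sSup hz⟩
    rw [Subfield.mem_sSup_of_directedOn ⟨y, hy⟩ hchain.directedOn] at ha
    obtain ⟨H, hH, ha⟩ := ha
    exact hc hH a ha) H₀ h₀
  exact ⟨H, hle, hmax.prop, fun H' h h' => hmax.le_of_ge h h'⟩

/-- The quadratic extension of a subfield by a root of `z ^ 2 + z + a`. -/
def quadSubfield (H : Subfield Ω) {a z : Ω} (ha : a ∈ H) (hz : z ^ 2 + z + a = 0) (hzH : z ∉ H) :
    Subfield Ω where
  carrier := {x | ∃ b ∈ H, ∃ c ∈ H, x = b + c * z}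
  mul_mem' := by
    rintro _ _ ⟨b, hb, c, hc, rfl⟩ ⟨b', hb', c', hc', rfl⟩
    refine ⟨b * b' - c * c' * a, H.sub_mem (H.mul_mem hb hb') (H.mul_mem (H.mul_mem hc hc') ha),
      b * c' + c * b' - c * c', H.sub_mem (H.add_mem (H.mul_mem hb hc') (H.mul_mem hc hb'))
        (H.mul_mem hc hc'), ?_⟩
    linear_combination c * c' * hz
  one_mem' := ⟨1, H.one_mem, 0, H.zero_mem, by ring⟩
  add_mem' := by
    rintro _ _ ⟨b, hb, c, hc, rfl⟩ ⟨b', hb', c', hc', rfl⟩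
    exact ⟨b + b', H.add_mem hb hb', c + c', H.add_mem hc hc', by ring⟩
  zero_mem' := ⟨0, H.zero_mem, 0, H.zero_mem, by ring⟩
  neg_mem' := by
    rintro _ ⟨b, hb, c, hc, rfl⟩
    exact ⟨-b, H.neg_mem hb, -c, H.neg_mem hc, by ring⟩
  inv_mem' := by
    rintro _ ⟨b, hb, c, hc, rfl⟩
    rcases eq_or_ne (b + c * z) 0 with h0 | h0
    · exact ⟨0, H.zero_mem, 0, H.zero_mem, by rw [h0, inv_zero]; ring⟩
    have hN : (b + c * z) * (b - c - c * z) = b ^ 2 - b * c + c ^ 2 * a := by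
      linear_combination -c ^ 2 * hz
    have hNH : b ^ 2 - b * c + c ^ 2 * a ∈ H :=
      H.add_mem (H.sub_mem (H.pow_mem hb 2) (H.mul_mem hb hc)) (H.mul_mem (H.pow_mem hc 2) ha)
    have h1 : b - c - c * z ≠ 0 := by
      intro h1
      rcases eq_or_ne c 0 with rfl | hc0
      · refine h0 ?_
        linear_combination h1
      · refine hzH ?_
        have : z = (b - c) * c⁻¹ := by
          rw [eq_mul_inv_iff_mul_eq₀ hc0]
          linear_combination -h1
        rw [this]
        exact H.mul_mem (H.sub_mem hb hc) (H.inv_mem hc)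
    refine ⟨(b - c) * (b ^ 2 - b * c + c ^ 2 * a)⁻¹, H.mul_mem (H.sub_mem hb hc) (H.inv_mem hNH),
      -c * (b ^ 2 - b * c + c ^ 2 * a)⁻¹, H.mul_mem (H.neg_mem hc) (H.inv_mem hNH), ?_⟩
    rw [← hN]
    field_simp
    ring

lemma ExactOver.quadSubfield {H : Subfield Ω} (h : ExactOver W j H) {a z : Ω} (ha : a ∈ H)
    (hz : z ^ 2 + z + a = 0) (hzH : z ∉ H) (hz1 : W.valuation z < 1) :
    ExactOver W j (quadSubfield H ha hz hzH) := by
  rintro _ ⟨b, hb, c, hc, rfl⟩ hx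
  have hzW := W.mem_of_lt_one hz1
  by_cases hcW : c ∈ W
  · have hbW : b ∈ W := by
      have := W.sub_mem' hx (W.mul_mem _ _ hcW hzW)
      rwa [add_sub_cancel_right] at this
    obtain ⟨y, hy⟩ := h b hb hbW
    refine ⟨y, ?_⟩
    have := W.add_lt_one hy (W.mul_lt_one' hcW hz1)
    rwa [sub_add_eq_add_sub] at this
  · have hc0 : c ≠ 0 := by
      rintro rfl
      exact hcW W.zero_mem
    have hc1 : W.valuation c⁻¹ < 1 := (ValuationSubring.lt_one_iff _ _).2 (Or.inr (by rwa [inv_inv]))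
    set e := b * c⁻¹ with he
    have hbe : b = e * c := by rw [he, inv_mul_cancel_right₀ hc0]
    have he1 : W.valuation e < 1 := by
      have := W.sub_lt_one (W.mul_lt_one hc1 hx) hz1
      have h2 : c⁻¹ * (b + c * z) - z = e := by
        rw [he]
        field_simp
        ring
      rwa [h2] at this
    have heH : e ∈ H := H.mul_mem hb (H.inv_mem hc)
    let w := e - 1 - z
    have hw1 : W.valuation (e - z) < 1 := W.sub_lt_one he1 hz1
    have hw : W.valuation w = 1 := by
      have h2 : w = -(1 - (e - z)) := by ring
      rw [h2, Valuation.map_neg]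
      exact Valuation.map_one_sub_of_lt _ hw1
    have hw0 : w ≠ 0 := by
      intro h0
      rw [h0, map_zero] at hw
      exact zero_ne_one hw
    obtain ⟨hwW, hwW'⟩ := (W.valuation_eq_one_iff' hw0).1 hw
    have hN : (b + c * z) * w = c * (e ^ 2 - e + a) := by
      rw [hbe]
      linear_combination -c * hz
    obtain ⟨y, hy⟩ := h (c * (e ^ 2 - e + a)) (H.mul_mem hc (H.add_mem (H.sub_mem (H.pow_mem heH 2) heH) ha))
      (hN ▸ W.mul_mem _ _ hx hwW)
    refine ⟨-y, ?_⟩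
    rw [← hN] at hy
    have h3 := W.sub_lt_one (W.mul_lt_one hw1 hx) hy
    have h4 : (e - z) * (b + c * z) - ((b + c * z) * w - j y) = b + c * z - j (-y) := by
      rw [map_neg]
      ring
    rwa [h4] at h3

/-- Subfields without additional residues define places. -/
lemma ExactOver.exists_place {H : Subfield Ω} (h : ExactOver W j H) (hj : ∀ z, j z ∈ W)
    (hjH : ∀ z, j z ∈ H) : ∃ (Q : FPlace H L), (∀ a : H, a ∈ Q.O ↔ (a : Ω) ∈ W) ∧
      ∀ z, Q.res ⟨j z, hjH z⟩ = z := by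
  classical
  have uniq {z z' : L} {a : Ω} (h1 : W.valuation (a - j z) < 1) (h2 : W.valuation (a - j z') < 1) :
      z = z' := by
    by_contra hne
    have h3 := W.sub_lt_one h2 h1
    have h4 : a - j z' - (a - j z) = j (z - z') := by
      rw [map_sub]
      ring
    rw [h4] at h3
    have h5 := W.mul_lt_one h3 (hj (z - z')⁻¹)
    rw [← map_mul, mul_inv_cancel₀ (sub_ne_zero.2 hne), map_one, map_one] at h5
    exact lt_irrefl _ h5
  let res (a : H) : L := if ha : (a : Ω) ∈ W then (h a a.2 ha).choose else 0
  have hres (a : H) (ha : (a : Ω) ∈ W) : W.valuation (a - j (res a)) < 1 := by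
    simp only [res, dif_pos ha]
    exact (h a a.2 ha).choose_spec
  refine ⟨⟨W.comap H.subtype, res, ?_, fun a ha b hb => ?_, fun a ha b hb => ?_, fun z => ?_⟩,
    fun a => Iff.rfl, fun z => ?_⟩
  · refine uniq (hres 1 W.one_mem) ?_
    simp
  · refine uniq (hres _ (W.add_mem _ _ ha hb)) ?_
    have := W.add_lt_one (hres a ha) (hres b hb)
    rw [map_add]
    convert this using 2
    push_cast
    ring
  · refine uniq (hres _ (W.mul_mem _ _ ha hb)) ?_
    have := W.add_lt_one (W.mul_lt_one (hres a ha) (hj (res b))) (W.mul_lt_one' (a := (a : Ω)) ha (hres b hb))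
    rw [map_mul]
    convert this using 2
    push_cast
    ring
  · refine ⟨⟨j z, hjH z⟩, hj z, uniq (hres _ (hj z)) ?_⟩
    simp
  · refine uniq (hres _ (hj z)) ?_
    simp

lemma exists_small_root {a : Ω} [IsAlgClosed Ω] (ha : W.valuation a < 1) :
    ∃ z, W.valuation z < 1 ∧ z ^ 2 + z + a = 0 := by
  obtain ⟨z, hz⟩ : ∃ z : Ω, z ^ 2 + z + a = 0 := by
    let f : Polynomial Ω := Polynomial.X ^ 2 + Polynomial.X + Polynomial.C a
    have hf : f.degree = 2 := by
      unfold f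
      compute_degree!
    obtain ⟨z, hz⟩ := IsAlgClosed.exists_root f (by rw [hf]; decide)
    exact ⟨z, by simpa [f] using hz⟩
  have hzW : z ∈ W := by
    by_contra hzW
    have hz0 : z ≠ 0 := by
      rintro rfl
      exact hzW W.zero_mem
    have hz1 : W.valuation z⁻¹ < 1 := (ValuationSubring.lt_one_iff _ _).2 (Or.inr (by rwa [inv_inv]))
    refine hzW ?_
    have : z = -1 - a * z⁻¹ := by
      field_simp
      linear_combination hz
    rw [this]
    exact W.sub_mem' (W.neg_mem _ W.one_mem) (W.mul_mem _ _ (W.mem_of_lt_one ha) (W.mem_of_lt_one hz1))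
  have hprod : z * (1 + z) = -a := by linear_combination hz
  by_cases hz1 : W.valuation z < 1
  · exact ⟨z, hz1, hz⟩
  · refine ⟨-1 - z, ?_, by linear_combination hz⟩
    have hz2 : z⁻¹ ∈ W := by
      by_contra h
      exact hz1 ((ValuationSubring.lt_one_iff _ _).2 (Or.inr h))
    have hz0 : z ≠ 0 := by
      rintro rfl
      exact hz1 (by simp)
    have h2 : -1 - z = a * z⁻¹ := by
      field_simp
      linear_combination -hz
    rw [h2]
    exact W.mul_lt_one ha hz2

lemma ExactOver.qHen [IsAlgClosed Ω] {H : Subfield Ω} (h : ExactOver W j H)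
    (hmax : ∀ H', ExactOver W j H' → H ≤ H' → H' ≤ H) : QHen (W.comap H.subtype) := by
  intro a ha
  have hlt (b : H) : (W.comap H.subtype).valuation b < 1 ↔ W.valuation (b : Ω) < 1 := by
    rw [ValuationSubring.lt_one_iff, ValuationSubring.lt_one_iff, ValuationSubring.mem_comap]
    simp
  rw [hlt] at ha
  obtain ⟨z, hz1, hz⟩ := exists_small_root ha
  have hzH : z ∈ H := by
    by_contra hzH
    refine hzH (hmax _ (h.quadSubfield a.2 hz hzH hz1) ?_ ?_)
    · exact fun b hb => ⟨b, hb, 0, H.zero_mem, by ring⟩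
    · exact ⟨0, H.zero_mem, 1, H.one_mem, by ring⟩
  have hu : W.valuation (1 + z) = 1 := Valuation.map_one_add_of_lt _ hz1
  have hu0 : 1 + z ≠ 0 := by
    intro h0
    rw [h0, map_zero] at hu
    exact zero_ne_one hu
  refine ⟨-⟨1 + z, H.add_mem H.one_mem hzH⟩⁻¹, ?_, ?_⟩
  · refine ValuationSubring.neg_mem _ _ ?_
    exact ((W.valuation_eq_one_iff' hu0).1 hu).2
  · apply Subtype.ext
    push_cast
    field_simp
    linear_combination hz

end Exact

section PlaceExtension

/-- A ring homomorphism from a subring to a domain is induced by a valuation of the field. -/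
lemma exists_valuationSubring_of_ker {A B Ω : Type*} [CommRing A] [CommRing B] [IsDomain B] [Field Ω]
    (g : A →+* Ω) (hg : Function.Injective g) (q : A →+* B) :
    ∃ W : ValuationSubring Ω, (∀ a, g a ∈ W) ∧ ∀ a, W.valuation (g a) < 1 ↔ q a = 0 := by
  have hp : (RingHom.ker q).IsPrime := RingHom.ker_isPrime q
  let f : Localization.AtPrime (RingHom.ker q) →+* Ω :=
    IsLocalization.lift (M := (RingHom.ker q).primeCompl) (g := g) fun y => by
      refine isUnit_iff_ne_zero.2 fun h0 => y.2 ?_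
      rw [hg (h0.trans (map_zero g).symm)]
      exact Ideal.zero_mem _
  have hf (a : A) : f (algebraMap _ _ a) = g a := IsLocalization.lift_eq _ a
  obtain ⟨W, h, hloc⟩ := IsLocalRing.exists_factor_valuationRing f
  refine ⟨W, fun a => hf a ▸ h _, fun a => ?_⟩
  have h1 : IsUnit (algebraMap A (Localization.AtPrime (RingHom.ker q)) a) ↔ ¬ q a = 0 :=
    IsLocalization.AtPrime.isUnit_to_map_iff _ (RingHom.ker q) a
  have h2 : IsUnit (⟨f (algebraMap _ _ a), h _⟩ : W.toSubring) ↔ ¬ q a = 0 := by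
    rw [← h1]
    refine ⟨fun hu => hloc.1 _ hu, fun hu => hu.map (f.codRestrict W.toSubring h)⟩
  have h3 := W.valuation_lt_one_iff (⟨f (algebraMap _ _ a), h _⟩ : W)
  change _ ↔ W.valuation (f (algebraMap _ _ a)) < 1 at h3
  rw [← hf a, ← h3, IsLocalRing.mem_maximalIdeal, mem_nonunits_iff]
  change ¬ IsUnit (⟨f (algebraMap _ _ a), h _⟩ : W.toSubring) ↔ _
  rw [h2, not_not]

end PlaceExtension

section JointField

open LaurentSeries PowerSeries

variable {F K : Type} [Field F] [Field K]

/-- A common extension of a field with a section of its place and of the Laurent series field over the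
residue field, in which the place extends trivially to the Laurent series. -/
lemma exists_jointField (P : FPlace F K) (l : K →+* F) (hl : ∀ z, l z ∈ P.O)
    (hl' : ∀ z, P.res (l z) = z) :
    ∃ (Ω : Type) (_ : Field Ω) (_ : IsAlgClosed Ω) (W : ValuationSubring Ω) (jF : F →+* Ω)
      (jL : K⸨X⸩ →+* Ω), (∀ a ∈ P.O, jF a ∈ W) ∧ (∀ a, P.O.valuation a < 1 → W.valuation (jF a) < 1) ∧
      (∀ z, jL z ∈ W) ∧ ∀ z, jF (l z) = jL (HahnSeries.C z) := by
  let Ω := AlgebraicClosure F⸨X⸩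
  let g₀ : F⟦X⟧ →+* Ω := (algebraMap F⸨X⸩ Ω).comp (HahnSeries.ofPowerSeries ℤ F)
  have hg₀ : Function.Injective g₀ :=
    (algebraMap F⸨X⸩ Ω).injective.comp HahnSeries.ofPowerSeries_injective
  let g : P.O⟦X⟧ →+* Ω := g₀.comp (PowerSeries.map P.O.subtype)
  have hg : Function.Injective g :=
    hg₀.comp (PowerSeries.map_injective _ Subtype.coe_injective)
  obtain ⟨W, hW, hW'⟩ := exists_valuationSubring_of_ker g hg (PowerSeries.map P.hom)
  let lO : K →+* P.O := l.codRestrict P.O.toSubring hl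
  let jF : F →+* Ω := g₀.comp PowerSeries.C
  have hlO : P.hom.comp lO = RingHom.id K := RingHom.ext hl'
  let jL₀ : K⟦X⟧ →+* Ω := g.comp (PowerSeries.map lO)
  have hjL₀ : Function.Injective jL₀ := by
    refine hg.comp (PowerSeries.map_injective _ lO.injective)
  have hC (a : P.O) : g (PowerSeries.C a) = jF a := by
    simp [g, jF]
  let jL : K⸨X⸩ →+* Ω := IsFractionRing.lift hjL₀
  have hjL (z : K⟦X⟧) : jL (HahnSeries.ofPowerSeries ℤ K z) = jL₀ z := IsFractionRing.lift_algebraMap hjL₀ z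
  refine ⟨Ω, inferInstance, inferInstance, W, jF, jL, fun a ha => ?_, fun a ha => ?_, fun z => ?_, fun z => ?_⟩
  · rw [← hC ⟨a, ha⟩]
    exact hW _
  · have ha' := P.O.mem_of_lt_one ha
    rw [← hC ⟨a, ha'⟩, hW', PowerSeries.map_C]
    have : P.hom ⟨a, ha'⟩ = 0 := (P.res_eq_zero_iff ha').2 ha
    rw [this, map_zero]
  · obtain ⟨x, y, hy, rfl⟩ := IsFractionRing.div_surjective (A := K⟦X⟧) z
    have h0 := nonZeroDivisors.ne_zero hy
    rw [map_div₀]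
    change jL (HahnSeries.ofPowerSeries ℤ K x) / jL (HahnSeries.ofPowerSeries ℤ K y) ∈ W
    rw [hjL, hjL, div_eq_mul_inv]
    refine W.mul_mem _ _ (hW _) ?_
    by_contra hc
    have h1 : W.valuation (jL₀ y) < 1 := (ValuationSubring.lt_one_iff _ _).2 (Or.inr hc)
    refine h0 ?_
    have h2 := (hW' _).1 h1
    rwa [← RingHom.comp_apply, ← PowerSeries.map_comp, hlO, PowerSeries.map_id] at h2
  · have h1 : (HahnSeries.C z : K⸨X⸩) = HahnSeries.ofPowerSeries ℤ K (PowerSeries.C z) :=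
      (HahnSeries.ofPowerSeries_C z).symm
    rw [h1, hjL]
    change _ = g (PowerSeries.map lO (PowerSeries.C z))
    rw [PowerSeries.map_C, hC]
    rfl

end JointField

section Compositum

variable {F K L Ω : Type} [Field F] [Field K] [Field L] [Field Ω] {P : FPlace F K} {l : K →+* F}
  {W : ValuationSubring Ω} {jF : F →+* Ω} {jL : L →+* Ω} {c : K →+* L}

lemma mem_of_map_mem {V : ValuationSubring F}
    (hm : ∀ a, V.valuation a < 1 → W.valuation (jF a) < 1) {a : F} (h : jF a ∈ W) : a ∈ V := by
  by_contra ha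
  have ha0 : jF a ≠ 0 := by
    rw [Ne, map_eq_zero]
    rintro rfl
    exact ha V.zero_mem
  have h1 : V.valuation a⁻¹ < 1 := by
    rw [ValuationSubring.lt_one_iff, inv_inv]
    exact Or.inr ha
  have h2 := W.mul_lt_one (hm _ h1) h
  rw [map_inv₀, inv_mul_cancel₀ ha0, map_one] at h2
  exact lt_irrefl _ h2

/-- An element is, up to a principal unit, a product of elements of the two fields. -/
def IsProductUpToUnit (W : ValuationSubring Ω) (jF : F →+* Ω) (jL : L →+* Ω) (x : Ω) : Prop :=
  ∃ a b u, W.valuation (u - 1) < 1 ∧ x = jF a * jL b * u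

lemma ValuationSubring.valuation_principal_unit {u : Ω} (hu : W.valuation (u - 1) < 1) :
    u ≠ 0 ∧ u ∈ W ∧ u⁻¹ ∈ W := by
  have h : W.valuation u = 1 := by
    have := Valuation.map_one_add_of_lt W.valuation hu
    rwa [add_sub_cancel] at this
  have h0 : u ≠ 0 := by
    rintro rfl
    rw [map_zero] at h
    exact zero_ne_one h
  exact ⟨h0, (W.valuation_eq_one_iff' h0).1 h⟩

lemma isProductUpToUnit_sum (hl : ∀ z, l z ∈ P.O) (hl' : ∀ z, P.res (l z) = z)
    (hm : ∀ a, P.O.valuation a < 1 → W.valuation (jF a) < 1) (hL : ∀ z, jL z ∈ W)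
    (hc : ∀ z, jF (l z) = jL (c z)) {α : Type} (f : α → F) (z : α → L) (s : Finset α) :
    IsProductUpToUnit W jF jL (∑ i ∈ s, jF (f i) * jL (z i)) := by
  classical
  induction h : s.card generalizing s f with
  | zero =>
    rw [Finset.card_eq_zero] at h
    exact ⟨0, 0, 1, by simp, by simp [h]⟩
  | succ n ih =>
    have hne : s.Nonempty := by
      rw [← Finset.card_pos]
      omega
    obtain ⟨i₀, hi₀, hmax⟩ := s.exists_max_image (fun i => P.O.valuation (f i)) hne
    rcases eq_or_ne (f i₀) 0 with h0 | h0
    · refine ⟨0, 0, 1, by simp, ?_⟩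
      rw [map_zero, zero_mul, zero_mul]
      refine Finset.sum_eq_zero fun i hi => ?_
      have := hmax i hi
      rw [h0, map_zero, le_zero_iff, Valuation.zero_iff] at this
      rw [this, map_zero, zero_mul]
    have hO (i) (hi : i ∈ s) : f i * (f i₀)⁻¹ ∈ P.O := by
      rw [← ValuationSubring.valuation_le_one_iff, map_mul, map_inv₀]
      exact mul_inv_le_one_of_le₀ (hmax i hi) zero_le
    let τ (i : α) : K := P.res (f i * (f i₀)⁻¹)
    let f' (i : α) : F := f i - l (τ i) * f i₀
    have hf' (i) (hi : i ∈ s) : P.O.valuation (f' i * (f i₀)⁻¹) < 1 := by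
      have h1 : f' i * (f i₀)⁻¹ = f i * (f i₀)⁻¹ - l (τ i) := by
        simp only [f']
        field_simp
      rw [h1, ← P.res_eq_iff (hO i hi) (hl _), hl']
    have hf₀ : f' i₀ = 0 := by
      simp only [f', τ]
      rw [mul_inv_cancel₀ h0, P.res_one, map_one, one_mul, sub_self]
    let b := ∑ i ∈ s, c (τ i) * z i
    have hsum : ∑ i ∈ s, jF (f i) * jL (z i) = jF (f i₀) * jL b + ∑ i ∈ s, jF (f' i) * jL (z i) := by
      simp only [b, f', map_sum, Finset.mul_sum]
      rw [← Finset.sum_add_distrib]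
      refine Finset.sum_congr rfl fun i _ => ?_
      rw [map_mul, map_sub, map_mul, hc]
      ring
    rcases eq_or_ne b 0 with hb | hb
    · rw [hsum, hb, map_zero, mul_zero, zero_add, ← Finset.add_sum_erase s _ hi₀, hf₀, map_zero,
        zero_mul, zero_add]
      refine ih f' _ ?_
      rw [Finset.card_erase_of_mem hi₀, h, Nat.add_sub_cancel]
    · have hb' : jL b ≠ 0 := by simpa using hb
      have h0' : jF (f i₀) ≠ 0 := by simpa using h0
      refine ⟨f i₀, b, 1 + ∑ i ∈ s, jF (f' i * (f i₀)⁻¹) * jL (z i * b⁻¹), ?_, ?_⟩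
      · rw [add_sub_cancel_left]
        exact W.sum_lt_one fun i hi => W.mul_lt_one (hm _ (hf' i hi)) (hL _)
      · rw [hsum, mul_add, mul_one, Finset.mul_sum]
        congr 1
        refine Finset.sum_congr rfl fun i _ => ?_
        simp only [map_mul, map_inv₀]
        field_simp

lemma isProductUpToUnit_of_mem (hl : ∀ z, l z ∈ P.O) (hl' : ∀ z, P.res (l z) = z)
    (hm : ∀ a, P.O.valuation a < 1 → W.valuation (jF a) < 1) (hL : ∀ z, jL z ∈ W)
    (hc : ∀ z, jF (l z) = jL (c z)) {x : Ω}
    (hx : x ∈ Subfield.closure (Set.range jF ∪ Set.range jL)) : IsProductUpToUnit W jF jL x := by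
  have key (y : Ω) (hy : y ∈ Subring.closure (Set.range jF ∪ Set.range jL)) :
      ∃ (α : Type) (_ : Fintype α) (f : α → F) (z : α → L), y = ∑ i, jF (f i) * jL (z i) := by
    induction hy using Subring.closure_induction with
    | mem x hx =>
      rcases hx with ⟨a, rfl⟩ | ⟨a, rfl⟩
      · exact ⟨Unit, inferInstance, fun _ => a, fun _ => 1, by simp⟩
      · exact ⟨Unit, inferInstance, fun _ => 1, fun _ => a, by simp⟩
    | zero => exact ⟨Empty, inferInstance, nofun, nofun, by simp⟩
    | one => exact ⟨Unit, inferInstance, fun _ => 1, fun _ => 1, by simp⟩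
    | add x y _ _ hx hy =>
      obtain ⟨α, _, f, z, rfl⟩ := hx
      obtain ⟨β, _, g, w, rfl⟩ := hy
      exact ⟨α ⊕ β, inferInstance, Sum.elim f g, Sum.elim z w, by simp⟩
    | neg x _ hx =>
      obtain ⟨α, _, f, z, rfl⟩ := hx
      exact ⟨α, inferInstance, fun i => - f i, z, by simp⟩
    | mul x y _ _ hx hy =>
      obtain ⟨α, _, f, z, rfl⟩ := hx
      obtain ⟨β, _, g, w, rfl⟩ := hy
      refine ⟨α × β, inferInstance, fun i => f i.1 * g i.2, fun i => z i.1 * w i.2, ?_⟩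
      rw [Finset.sum_mul_sum, Fintype.sum_prod_type]
      simp only [map_mul, mul_mul_mul_comm]
  obtain ⟨y, hy, y', hy', rfl⟩ := Subfield.mem_closure_iff.1 hx
  obtain ⟨α, _, f, z, rfl⟩ := key y hy
  obtain ⟨α', _, f', z', rfl⟩ := key y' hy'
  obtain ⟨a, b, u, hu, e⟩ := isProductUpToUnit_sum hl hl' hm hL hc f z Finset.univ
  obtain ⟨a', b', u', hu', e'⟩ := isProductUpToUnit_sum hl hl' hm hL hc f' z' Finset.univ
  rw [e, e']
  obtain ⟨h0, h1, h2⟩ := W.valuation_principal_unit hu'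
  refine ⟨a / a', b / b', u / u', ?_, ?_⟩
  · have h3 : u / u' - 1 = (u - 1 - (u' - 1)) * u'⁻¹ := by
      field_simp
      ring
    rw [h3]
    exact W.mul_lt_one (W.sub_lt_one hu hu') h2
  · rw [map_div₀, map_div₀, mul_div_mul_comm, mul_div_mul_comm]

/-- The compositum has no new residues. -/
lemma exactOver_closure (hl : ∀ z, l z ∈ P.O) (hl' : ∀ z, P.res (l z) = z)
    (hO : ∀ a ∈ P.O, jF a ∈ W)
    (hm : ∀ a, P.O.valuation a < 1 → W.valuation (jF a) < 1) (hL : ∀ z, jL z ∈ W)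
    (hc : ∀ z, jF (l z) = jL (c z)) :
    ExactOver W jL (Subfield.closure (Set.range jF ∪ Set.range jL)) := by
  intro x hx hxW
  obtain ⟨a, b, u, hu, rfl⟩ := isProductUpToUnit_of_mem hl hl' hm hL hc hx
  obtain ⟨hu0, huW, huW'⟩ := W.valuation_principal_unit hu
  rcases eq_or_ne b 0 with rfl | hb
  · exact ⟨0, by simp⟩
  have hb' : jL b ≠ 0 := by simpa using hb
  have ha : a ∈ P.O := by
    refine mem_of_map_mem hm ?_
    have h1 : jF a = jF a * jL b * u * (jL b⁻¹ * u⁻¹) := by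
      rw [map_inv₀]
      field_simp
    rw [h1]
    exact W.mul_mem _ _ hxW (W.mul_mem _ _ (hL b⁻¹) huW')
  refine ⟨c (P.res a) * b, ?_⟩
  have h4 : jF a * jL b * u - jL (c (P.res a) * b) =
      jF a * jL b * (u - 1) + jF (a - l (P.res a)) * jL b := by
    rw [map_mul, ← hc, map_sub]
    ring
  rw [h4]
  refine W.add_lt_one (W.mul_lt_one' (W.mul_mem _ _ (hO a ha) (hL b)) hu) (W.mul_lt_one (hm _ ?_) (hL b))
  rw [← P.res_eq_iff ha (hl _), hl']

end Compositum

/-- The quadratic equations are soluble in a composite valuation ring if they are so for both parts. -/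
lemma QHen.comp {F R : Type} [Field F] [Field R] {Q : FPlace F R} (hQ : QHen Q.O)
    {V : ValuationSubring R} (hV : HenF V) : QHen (Q.comp V) := by
  intro a ha
  obtain ⟨haO, haV⟩ := Q.comp_lt_one.1 ha
  obtain ⟨r, hr, hr0⟩ := hV.quad haV
  obtain ⟨ρ, hρ, rfl⟩ := Q.surj r
  let B := 1 + 2 * a * ρ
  have h2 : (2 : F) * a ∈ Q.O := by
    rw [two_mul]
    exact Q.O.add_mem _ _ haO haO
  have hB : B ∈ Q.O := Q.O.add_mem _ _ Q.O.one_mem (Q.O.mul_mem _ _ h2 hρ)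
  have hresB : Q.res B = 1 + (Q.res a * Q.res ρ + Q.res a * Q.res ρ) := by
    have e : B = 1 + (a * ρ + a * ρ) := by
      simp only [B]
      ring
    have h3 := Q.O.mul_mem _ _ haO hρ
    rw [e, Q.res_add _ Q.O.one_mem _ (Q.O.add_mem _ _ h3 h3), Q.res_add _ h3 _ h3, Q.res_one,
      Q.res_mul _ haO _ hρ]
  have hB0 : Q.res B ≠ 0 := by
    have h3 := V.mul_lt_one haV hr
    have h4 := Valuation.map_one_add_of_lt V.valuation (V.add_lt_one h3 h3)
    intro h0
    rw [← hresB, h0, map_zero] at h4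
    exact zero_ne_one h4
  have hBi := Q.inv_mem hB hB0
  have hB0' : B ≠ 0 := by
    intro h0
    rw [h0, Q.res_zero] at hB0
    exact hB0 rfl
  let ε := 1 + ρ + a * ρ ^ 2
  have hρ2 := Q.O.pow_mem' hρ 2
  have haρ := Q.O.mul_mem _ _ haO hρ2
  have h1ρ := Q.O.add_mem _ _ Q.O.one_mem hρ
  have hε : Q.O.valuation ε < 1 := by
    rw [← Q.res_eq_zero_iff (Q.O.add_mem _ _ h1ρ haρ), Q.res_add _ h1ρ _ haρ,
      Q.res_add _ Q.O.one_mem _ hρ, Q.res_mul _ haO _ hρ2, Q.res_pow hρ, Q.res_one, hr0]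
  have hεB : Q.O.valuation (ε * B⁻¹) < 1 := Q.O.mul_lt_one hε hBi
  obtain ⟨η, hη, hη0⟩ := hQ (a * ε * (B⁻¹) ^ 2)
    (Q.O.mul_lt_one (Q.O.mul_lt_one' haO hε) (Q.O.pow_mem' hBi 2))
  have hεη := Q.O.mul_lt_one hεB hη
  refine ⟨ρ + ε * B⁻¹ * η, ⟨Q.O.add_mem _ _ hρ (Q.O.mem_of_lt_one hεη), ?_⟩, ?_⟩
  · rw [Q.res_add _ hρ _ (Q.O.mem_of_lt_one hεη), (Q.res_eq_zero_iff (Q.O.mem_of_lt_one hεη)).2 hεη,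
      add_zero]
    exact hr
  · have h5 : 1 + (ρ + ε * B⁻¹ * η) + a * (ρ + ε * B⁻¹ * η) ^ 2 =
        ε + ε * (B * B⁻¹) * η + ε * (a * ε * B⁻¹ ^ 2 * η ^ 2) := by
      simp only [ε, B]
      ring
    rw [h5, mul_inv_cancel₀ hB0']
    linear_combination ε * hη0

section Series

open LaurentSeries

/-- A valued field with a section of its residue map is existentially embedded in the Laurent
series field over its residue field. -/
lemma emb_psO_of_section (r4 : R4) {F K : Type} [Field F] [Field K] (p : ℕ) [Fact p.Prime] [CharP K p]
    (P : FPlace F K) (l : K →+* F) (hl : ∀ z, l z ∈ P.O) (hl' : ∀ z, P.res (l z) = z) :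
    Emb l P.O (HahnSeries.C : K → K⸨X⸩) (psO K) := by
  obtain ⟨Ω, _, _, W, jF, jL, hO, hm, hL, hc⟩ := exists_jointField P l hl hl'
  obtain ⟨H, hH, hex, hmax⟩ := (exactOver_closure hl hl' hO hm hL hc).exists_maximal
  have hFH (a : F) : jF a ∈ H := hH (Subfield.subset_closure (Or.inl ⟨a, rfl⟩))
  have hLH (a : K⸨X⸩) : jL a ∈ H := hH (Subfield.subset_closure (Or.inr ⟨a, rfl⟩))
  obtain ⟨Q, hQ, hQres⟩ := hex.exists_place hL hLH
  have hQm (a : H) : Q.O.valuation a < 1 ↔ W.valuation (a : Ω) < 1 := by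
    rw [ValuationSubring.lt_one_iff, ValuationSubring.lt_one_iff, hQ]
    simp
  have hqO : QHen Q.O := by
    have e : Q.O = W.comap H.subtype := by
      ext a
      exact hQ a
    rw [e]
    exact hex.qHen hmax
  have : CharP K⸨X⸩ p := charP_of_injective_ringHom (HahnSeries.C : K →+* K⸨X⸩).injective p
  let jL' : K⸨X⸩ →+* H := jL.codRestrict H hLH
  let jF' : F →+* H := jF.codRestrict H hFH
  refine Emb.trans (Emb.of_ringHom jF' (fun a => ?_) fun z => ?_)
    (emb_comp_of_r4 r4 (p := p) Q jL' (fun z => (hQ _).2 (hL z)) hQres (psO_henF (K := K))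
      psX_unif (hqO.comp psO_henF) HahnSeries.C)
  · refine ⟨fun h => mem_of_map_mem hm ((hQ _).1 h.1), fun h => ?_⟩
    have h1 : jF' a ∈ Q.O := (hQ _).2 (hO a h)
    refine ⟨h1, ?_⟩
    have h2 : Q.res (jF' a) = HahnSeries.C (P.res a) := by
      rw [← hQres (HahnSeries.C (P.res a)), Q.res_eq_iff h1 ((hQ _).2 (hL _)), hQm]
      have h3 := hm (a - l (P.res a)) (by rw [← P.res_eq_iff h (hl _), hl'])
      rw [map_sub, hc] at h3
      exact h3
    rw [h2]
    exact C_mem_psO _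
  · exact Subtype.ext (hc z)

end Series

/-- The composition of the residue map with a homomorphism into the valuation ring. -/
def FPlace.resHom {C F R : Type*} [Field C] [Field F] [Field R] (P : FPlace F R) (ι : C →+* F)
    (h : ∀ c, ι c ∈ P.O) : C →+* R :=
  P.hom.comp (ι.codRestrict P.O.toSubring h)

lemma HenF.of_comp {F R : Type*} [Field F] [Field R] {P : FPlace F R} {V : ValuationSubring R}
    (h : HenF (P.comp V)) : HenF V := by
  intro n c hc
  choose a ha hac using fun k => P.surj (c k)
  obtain ⟨y, hy, h0⟩ := h n a fun k hk => P.comp_lt_one.2 ⟨ha k, by rw [hac]; exact hc k hk⟩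
  refine ⟨P.res y, hy.2, ?_⟩
  have h1 (k) : a k * y ^ (k + 2) ∈ P.O := P.O.mul_mem _ _ (ha k) (P.O.pow_mem' hy.1 _)
  have h2 := congrArg P.res h0
  rw [P.res_add _ (P.O.add_mem _ _ P.O.one_mem hy.1) _ (P.O.sum_mem' fun k _ => h1 k),
    P.res_add _ P.O.one_mem _ hy.1, P.res_one, P.res_sum _ h1, P.res_zero] at h2
  rw [← h2]
  congr 1
  refine Finset.sum_congr rfl fun k _ => ?_
  rw [P.res_mul _ (ha k) _ (P.O.pow_mem' hy.1 _), P.res_pow hy.1, hac]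

lemma Emb.exists_pow_eq {A B C : Type*} [Field A] [Field B] {ιA : C → A} {ιB : C → B} {V : Set A}
    {W : Set B} (h : Emb ιA V ιB W) {c : C} {n : ℕ} {s : A} (hs : s ^ n = ιA c) :
    ∃ s, s ^ n = ιB c := by
  obtain ⟨𝓕, hne, hr, -, hC⟩ := h
  obtain ⟨f, h1, h2⟩ := ((hC c).and (hr.map_pow s n)).exists
  exact ⟨f s, by rw [← h2, hs, h1]⟩

lemma Unif.pow_ne {F : Type*} [Field F] {V : ValuationSubring F} {x : F} (hx : Unif V x) {n : ℕ}
    (hn : 1 < n) (y : F) : y ^ n ≠ x := by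
  rintro rfl
  have hn0 : n ≠ 0 := by omega
  have hy0 : y ≠ 0 := by
    rintro rfl
    exact hx.1 (zero_pow hn0)
  have hy : V.valuation y < 1 := by
    have := hx.2.1
    rw [map_pow] at this
    exact lt_of_not_ge fun h => absurd this (not_lt.2 (one_le_pow₀ h))
  obtain ⟨m, rfl⟩ : ∃ m, n = m + 2 := ⟨n - 2, by omega⟩
  have h1 := V.mul_lt_one' (hx.2.2 y hy) (V.pow_lt_one hy (n := m + 1) (by omega))
  have h2 : (y ^ (m + 2))⁻¹ * y * y ^ (m + 1) = 1 := by
    field_simp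
    ring
  rw [h2, map_one] at h1
  exact lt_irrefl _ h1

section Lift

variable {p : ℕ} [Fact p.Prime] {C k F K K₁ : Type} [Field C] [Field k] [CharP k p] [Field F]
  [Field K] [Field K₁] (P : FPlace F K)

/-- An approximate embedding of residue fields lifts to an elementary extension of a henselian
field, respecting a subfield over which the source is separable. -/
lemma FPlace.exists_lift_of_emb (hP : HenF P.O) (ι : C →+* F) (hι : ∀ c, ι c ∈ P.O) (κ : C →+* K₁)
    (h : Emb κ Set.univ (P.resHom ι hι) Set.univ) (i : k →+* C) (hS : SepP p (κ.comp i)) :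
    ∃ (G K' : Type) (_ : Field G) (_ : Field K') (P' : FPlace G K') (θ : F →+* G) (σ : K₁ →+* G),
      HenF P'.O ∧ Emb θ P'.O id P.O ∧ (∀ a, θ a ∈ P'.O ↔ a ∈ P.O) ∧ (∀ z, σ z ∈ P'.O) ∧
      (∀ c, P'.res (σ (κ c)) = P'.res (θ (ι c))) ∧ ∀ c, σ (κ (i c)) = θ (ι (i c)) := by
  have h' : Emb κ Set.univ (P.resHom ι hι) ((⊤ : ValuationSubring K) : Set K) := by
    have e : ((⊤ : ValuationSubring K) : Set K) = Set.univ :=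
      Set.eq_univ_of_forall fun x => ValuationSubring.mem_top x
    rwa [e]
  obtain ⟨U, e, -, he⟩ := h'.exists_up
  obtain ⟨V, σ, h1, h2, h3⟩ := (P.up U).exists_section e (hP.up U)
    (ι := (upConst U F).comp (ι.comp i)) (κ := κ.comp i)
    (fun c => (upConst_mem_upO U).2 (hι _)) (fun c => by
      refine Eq.trans ?_ (he (i c)).symm
      rfl) hS
  refine ⟨UP V (UP U F), UP V (UP U K), inferInstance, inferInstance, (P.up U).up V,
    (upConst V _).comp (upConst U F), σ, (hP.up U).up V, ?_, fun a => ?_, h1, fun c => ?_, h3⟩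
  · exact (Emb.of_upConst (U := V) (O := upO U P.O) (ι := upConst U F)).trans
      (Emb.of_upConst (U := U) (O := P.O) (ι := id))
  · exact (upConst_mem_upO V).trans (upConst_mem_upO U)
  · rw [h2, he]
    rfl

end Lift

section TranscendentalCase

open LaurentSeries

/-- The approximate embedding when the distinguished element has no root in the residue field. -/
lemma emb_of_forall_pow_ne (r4 : R4) {p : ℕ} [Fact p.Prime] {C : Type} [Field C] [CharP C p] (t : C)
    (C₀ : Subfield C) [PerfectField C₀] [Algebra.IsSeparable (IntermediateField.adjoin C₀ {t}) C]
    {F K F' K' : Type} [Field F] [Field K] [Field F'] [Field K'] (P : FPlace F K) (P' : FPlace F' K')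
    (ι : C →+* F) (hι : ∀ c, ι c ∈ P.O) (ι' : C →+* F') (hι' : ∀ c, ι' c ∈ P'.O)
    (hP : HenF P.O) (hP' : HenF P'.O) (hne : P'.O ≠ ⊤)
    (h : Emb (P.resHom ι hι) Set.univ (P'.resHom ι' hι') Set.univ)
    (ht : ∀ s, s ^ p ≠ P.resHom ι hι t) : Emb ι P.O ι' P'.O := by
  let X : SectionDatum p :=
    { k := C, F := F, R := K, P := P, V := ⊤, ι := ι, κ := P.resHom ι hι, mem := hι
      res_eq := fun _ => rfl
      hen := by rwa [P.comp_top]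
      sep := SepP.of_not_pow t C₀ _ ht }
  obtain ⟨F₁, K₁, _, _, P₁, V₁, j, r, l, hj, -, -, hl, hl', hlr, -, hr, -⟩ := X.exists_limit
  let κ := r.comp (P.resHom ι hι)
  have : CharP K₁ p := charP_of_injective_ringHom κ.injective p
  have hκ : Emb κ Set.univ (P.resHom ι hι) Set.univ := hr.univ.comp (P.resHom ι hι)
  have hS : SepP p κ := SepP.of_not_pow t C₀ _ fun s hs => by
    obtain ⟨s', hs'⟩ := hκ.exists_pow_eq hs
    exact ht s' hs'
  obtain ⟨G, R, _, _, P₂, θ, σ, hG, hθ, hθO, hσ, -, hσθ⟩ :=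
    P'.exists_lift_of_emb hP' ι' hι' κ (hκ.trans h) (RingHom.id C) hS
  obtain ⟨π, hπ0, hπ⟩ := ValuationSubring.exists_lt_one hne
  have e1 : Emb ι P.O (j.comp ι) P₁.O := Emb.of_ringHom j hj fun _ => rfl
  have e2 : Emb (j.comp ι) P₁.O ((HahnSeries.C : K₁ →+* K₁⸨X⸩).comp κ) (psO K₁) := by
    have := (emb_psO_of_section r4 p P₁ l hl hl').comp κ
    have e : ⇑l ∘ ⇑κ = j.comp ι := funext hlr
    rwa [e] at this
  have e3 : Emb ((HahnSeries.C : K₁ →+* K₁⸨X⸩).comp κ) (psO K₁) (θ.comp ι') P₂.O := by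
    refine Emb.powerSeries hG σ hσ (π := θ π) ?_ (by simpa using hπ0) _ _
      (fun c => (hθO _).2 (hι' c)) (p := p) ?_ fun U R _ Q φ hle h1 h2 h3 c => ?_
    · rw [ValuationSubring.lt_one_iff] at hπ ⊢
      rw [← map_inv₀, hθO]
      exact Or.inr (hπ.resolve_left hπ0)
    · exact SepP.of_res (psPlace K₁) (fun c => C_mem_psO _) (fun c => by simp [psPlace]) hS
    · rw [RingHom.comp_apply, RingHom.comp_apply, h1]
      exact congrArg (fun z => Q.res (upConst U G z)) (hσθ c).symm
  exact ((e1.trans e2).trans e3).trans (hθ.comp ι')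

end TranscendentalCase

section Expansion

open PowerSeries LaurentSeries

variable {F T : Type} [Field F] [Field T] {P : FPlace F T} {l : T →+* F} {x : F}

lemma eval₂_mem (hl : ∀ z, l z ∈ P.O) (hx : x ∈ P.O) (q : Polynomial T) : q.eval₂ l x ∈ P.O := by
  rw [Polynomial.eval₂_eq_sum_range]
  exact P.O.sum_mem' fun i _ => P.O.mul_mem _ _ (hl _) (P.O.pow_mem' hx i)

lemma res_eval₂ (hl : ∀ z, l z ∈ P.O) (hl' : ∀ z, P.res (l z) = z) (hx : P.O.valuation x < 1)
    (q : Polynomial T) : P.res (q.eval₂ l x) = q.coeff 0 := by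
  have hxO := P.O.mem_of_lt_one hx
  rw [← Polynomial.divX_mul_X_add q, Polynomial.eval₂_add, Polynomial.eval₂_mul, Polynomial.eval₂_X,
    Polynomial.eval₂_C, P.res_add _ (P.O.mul_mem _ _ (eval₂_mem hl hxO _) hxO) _ (hl _),
    P.res_mul _ (eval₂_mem hl hxO _) _ hxO, (P.res_eq_zero_iff hxO).2 hx, hl']
  simp

lemma X_pow_dvd_of_eval₂ (hl : ∀ z, l z ∈ P.O) (hl' : ∀ z, P.res (l z) = z) (hx : Unif P.O x) {n : ℕ}
    {q : Polynomial T} {b : F} (hb : b ∈ P.O) (h : q.eval₂ l x = x ^ n * b) : Polynomial.X ^ n ∣ q := by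
  have hxO := P.O.mem_of_lt_one hx.2.1
  induction n generalizing q with
  | zero => simp
  | succ n ih =>
    have h0 : q.coeff 0 = 0 := by
      rw [← res_eval₂ hl hl' hx.2.1, h, P.res_eq_zero_iff (P.O.mul_mem _ _ (P.O.pow_mem' hxO _) hb)]
      exact P.O.mul_lt_one (P.O.pow_lt_one hx.2.1 n.succ_ne_zero) hb
    obtain ⟨q', rfl⟩ := Polynomial.X_dvd_iff.2 h0
    rw [pow_succ']
    refine mul_dvd_mul_left _ (ih ?_)
    rw [Polynomial.eval₂_mul, Polynomial.eval₂_X, pow_succ', mul_assoc] at h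
    exact mul_left_cancel₀ hx.1 h

lemma exists_polynomial_approx (hl : ∀ z, l z ∈ P.O) (hl' : ∀ z, P.res (l z) = z) (hx : Unif P.O x)
    {a : F} (ha : a ∈ P.O) (n : ℕ) : ∃ q : Polynomial T, ∃ b ∈ P.O, a - q.eval₂ l x = x ^ n * b := by
  induction n with
  | zero => exact ⟨0, a, ha, by simp⟩
  | succ n ih =>
    obtain ⟨q, b, hb, h⟩ := ih
    refine ⟨q + Polynomial.C (P.res b) * Polynomial.X ^ n, x⁻¹ * (b - l (P.res b)), hx.2.2 _ ?_, ?_⟩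
    · rw [← P.res_eq_iff hb (hl _), hl']
    · have hx0 := hx.1
      rw [Polynomial.eval₂_add, Polynomial.eval₂_mul, Polynomial.eval₂_X_pow, Polynomial.eval₂_C,
        pow_succ]
      field_simp
      linear_combination h

lemma coeff_eq_of_approx (hl : ∀ z, l z ∈ P.O) (hl' : ∀ z, P.res (l z) = z) (hx : Unif P.O x)
    {a : F} {q q' : Polynomial T} {b b' : F} {n m i : ℕ} (hb : b ∈ P.O) (hb' : b' ∈ P.O)
    (h : a - q.eval₂ l x = x ^ n * b) (h' : a - q'.eval₂ l x = x ^ m * b') (hn : i < n) (hm : i < m) :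
    q.coeff i = q'.coeff i := by
  have hxO := P.O.mem_of_lt_one hx.2.1
  obtain ⟨n, rfl⟩ := Nat.exists_eq_add_of_lt hn
  obtain ⟨m, rfl⟩ := Nat.exists_eq_add_of_lt hm
  have hd : Polynomial.X ^ (i + 1) ∣ q - q' := by
    refine X_pow_dvd_of_eval₂ hl hl' hx (b := x ^ m * b' - x ^ n * b)
      (P.O.sub_mem' (P.O.mul_mem _ _ (P.O.pow_mem' hxO _) hb') (P.O.mul_mem _ _ (P.O.pow_mem' hxO _) hb)) ?_
    rw [Polynomial.eval₂_sub]
    linear_combination h' - h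
  have := (Polynomial.X_pow_dvd_iff.1 hd) i (Nat.lt_succ_self i)
  rwa [Polynomial.coeff_sub, sub_eq_zero] at this

/-- The expansion of the elements of a valuation ring in powers of a uniformizer. -/
lemma exists_expansion (hl : ∀ z, l z ∈ P.O) (hl' : ∀ z, P.res (l z) = z) (hx : Unif P.O x) :
    ∃ E : P.O →+* T⟦X⟧, ∀ (a : P.O) (q : Polynomial T) (n : ℕ), ∀ b ∈ P.O,
      (a : F) - q.eval₂ l x = x ^ n * b → ∀ i < n, coeff i (E a) = q.coeff i := by
  choose q b hb h using fun (a : P.O) => exists_polynomial_approx hl hl' hx a.2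
  let e (a : P.O) : T⟦X⟧ := PowerSeries.mk fun i => (q a (i + 1)).coeff i
  have key (a : P.O) (q' : Polynomial T) (n : ℕ) (b') (hb' : b' ∈ P.O)
      (h' : (a : F) - q'.eval₂ l x = x ^ n * b') (i) (hi : i < n) : coeff i (e a) = q'.coeff i := by
    rw [coeff_mk]
    exact coeff_eq_of_approx hl hl' hx (hb a _) hb' (h a _) h' (Nat.lt_succ_self i) hi
  have hxO := P.O.mem_of_lt_one hx.2.1
  have keyC (a : P.O) (z : T) (ha : (a : F) = l z) : e a = C z := by
    ext i
    rw [key a (Polynomial.C z) (i + 1) 0 P.O.zero_mem (by simp [ha]) i (Nat.lt_succ_self i),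
      Polynomial.coeff_C, PowerSeries.coeff_C]
  have keymul (a a' : P.O) : e (a * a') = e a * e a' := by
    ext i
    rw [key (a * a') (q a (i + 1) * q a' (i + 1)) (i + 1)
      (a * b a' (i + 1) + (q a' (i + 1)).eval₂ l x * b a (i + 1))
      (P.O.add_mem _ _ (P.O.mul_mem _ _ a.2 (hb _ _))
        (P.O.mul_mem _ _ (eval₂_mem hl hxO _) (hb _ _))) ?_ i (Nat.lt_succ_self i)]
    · rw [coeff_mul, Polynomial.coeff_mul]
      refine Finset.sum_congr rfl fun ij hij => ?_
      have := Finset.HasAntidiagonal.mem_antidiagonal.1 hij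
      rw [key a _ _ _ (hb a (i + 1)) (h a (i + 1)) _ (by omega),
        key a' _ _ _ (hb a' (i + 1)) (h a' (i + 1)) _ (by omega)]
    · rw [Polynomial.eval₂_mul]
      push_cast
      linear_combination (a : F) * h a' (i + 1) + (q a' (i + 1)).eval₂ l x * h a (i + 1)
  have keyadd (a a' : P.O) : e (a + a') = e a + e a' := by
    ext i
    rw [key (a + a') (q a (i + 1) + q a' (i + 1)) (i + 1) (b a' (i + 1) + b a (i + 1))
      (P.O.add_mem _ _ (hb _ _) (hb _ _)) ?_ i (Nat.lt_succ_self i)]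
    · rw [map_add, Polynomial.coeff_add, key a _ _ _ (hb a (i + 1)) (h a (i + 1)) _ (by omega),
        key a' _ _ _ (hb a' (i + 1)) (h a' (i + 1)) _ (by omega)]
    · rw [Polynomial.eval₂_add]
      push_cast
      linear_combination h a' (i + 1) + h a (i + 1)
  exact ⟨
    { toFun := e
      map_one' := by rw [keyC 1 1 (by simp), map_one]
      map_zero' := by rw [keyC 0 0 (by simp), map_zero]
      map_mul' := keymul
      map_add' := keyadd }, key⟩

end Expansion

section Coarsening

open PowerSeries LaurentSeries

variable {F T : Type} [Field F] [Field T] {P : FPlace F T} {l : T →+* F} {x : F}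

/-- The coarsening of a valuation with a section obtained by inverting a uniformizer: its residue
field embeds in the Laurent series field. -/
lemma exists_coarsening (hl : ∀ z, l z ∈ P.O) (hl' : ∀ z, P.res (l z) = z) (hx : Unif P.O x) :
    ∃ (R : Type) (_ : Field R) (Q : FPlace F R) (E : R →+* T⸨X⸩), Q.comp ((psO T).comap E) = P.O ∧
      (∀ z, E (Q.res (l z)) = HahnSeries.C z) ∧ E (Q.res x) = psX T ∧
      ∀ a ∈ P.O, (E (Q.res a)).coeff 0 = P.res a := by
  have hxO := P.O.mem_of_lt_one hx.2.1
  obtain ⟨E₀, hE₀⟩ := exists_expansion hl hl' hx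
  have hC (z : T) : E₀ ⟨l z, hl z⟩ = C z := by
    ext i
    rw [hE₀ ⟨l z, hl z⟩ (Polynomial.C z) (i + 1) 0 P.O.zero_mem (by simp) i (Nat.lt_succ_self i),
      Polynomial.coeff_C, PowerSeries.coeff_C]
  have hX : E₀ ⟨x, hxO⟩ = X := by
    ext i
    rw [hE₀ ⟨x, hxO⟩ Polynomial.X (i + 1) 0 P.O.zero_mem (by simp) i (Nat.lt_succ_self i),
      Polynomial.coeff_X, PowerSeries.coeff_X]
    simp only [eq_comm]
  have hcoeff (a : P.O) (n : ℕ) : (∀ i < n, coeff i (E₀ a) = 0) ↔ ∃ b ∈ P.O, (a : F) = x ^ n * b := by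
    constructor
    · intro h
      obtain ⟨q, b, hb, e⟩ := exists_polynomial_approx hl hl' hx a.2 n
      obtain ⟨q', rfl⟩ := Polynomial.X_pow_dvd_iff.2 fun i hi => by
        rw [← hE₀ a q n b hb e i hi, h i hi]
      refine ⟨b + q'.eval₂ l x, P.O.add_mem _ _ hb (eval₂_mem hl hxO _), ?_⟩
      rw [Polynomial.eval₂_mul, Polynomial.eval₂_X_pow] at e
      linear_combination e
    · rintro ⟨b, hb, e⟩ i hi
      rw [hE₀ a 0 n b hb (by simpa using e) i hi, Polynomial.coeff_zero]
  let G (a : P.O) : T⸨X⸩ := HahnSeries.ofPowerSeries ℤ T (E₀ a)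
  have hS : ∀ s ∈ Submonoid.powers x, s ∈ P.O := by
    rintro _ ⟨n, rfl⟩
    exact P.O.pow_mem' hxO n
  have hGX (n : ℕ) (h) : G ⟨x ^ n, h⟩ = HahnSeries.ofPowerSeries ℤ T (X ^ n) := by
    have : (⟨x ^ n, h⟩ : P.O) = ⟨x, hxO⟩ ^ n := rfl
    simp only [G, this, map_pow, hX]
  have hG0 (s) (hs : s ∈ Submonoid.powers x) : G ⟨s, hS s hs⟩ ≠ 0 := by
    obtain ⟨n, rfl⟩ := hs
    rw [hGX, Ne, map_eq_zero_iff _ HahnSeries.ofPowerSeries_injective]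
    exact pow_ne_zero _ X_ne_zero
  have hmul (a b : P.O) : G (a * b) = G a * G b := by simp only [G, map_mul]
  have hadd (a b : P.O) : G (a + b) = G a + G b := by simp only [G, map_add]
  let Ow := P.O.loc (Submonoid.powers x) hS
  choose s hs hsO using fun g : Ow => ValuationSubring.mem_loc.1 g.2
  let e (g : Ow) : T⸨X⸩ := G ⟨s g * g, hsO g⟩ * (G ⟨s g, hS _ (hs g)⟩)⁻¹
  have he (g : Ow) (r : F) (hr : r ∈ Submonoid.powers x) (h : r * g ∈ P.O) :
      e g * G ⟨r, hS r hr⟩ = G ⟨r * g, h⟩ := by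
    rw [mul_right_comm, mul_inv_eq_iff_eq_mul₀ (hG0 _ (hs g)), ← hmul, ← hmul]
    congr 1
    apply Subtype.ext
    change s g * g * r = r * g * s g
    ring
  have heO (a : P.O) (h) : e ⟨a, h⟩ = G a := by
    have h1 := he ⟨a, h⟩ 1 (Submonoid.one_mem _) (by simp)
    have h2 : G ⟨1, hS 1 (Submonoid.one_mem _)⟩ = 1 := by
      have : (⟨1, hS 1 (Submonoid.one_mem _)⟩ : P.O) = 1 := rfl
      simp only [G, this, map_one]
    rw [h2, mul_one] at h1
    rw [h1]
    congr 1
    exact Subtype.ext (one_mul _)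
  let eh : Ow →+* T⸨X⸩ :=
    { toFun := e
      map_one' := by
        refine (heO 1 Ow.one_mem).trans ?_
        simp only [G, map_one]
      map_zero' := by
        refine (heO 0 Ow.zero_mem).trans ?_
        simp only [G, map_zero]
      map_mul' := fun g h => by
        have h1 := Submonoid.mul_mem _ (hs g) (hs h)
        have h2 : s g * s h * ((g * h : Ow) : F) = (s g * g) * (s h * h) := by
          push_cast
          ring
        have h3 := P.O.mul_mem _ _ (hsO g) (hsO h)
        refine mul_right_cancel₀ (hG0 _ h1) ?_
        rw [he (g * h) _ h1 (by rwa [h2])]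
        have h4 : (⟨s g * s h * ((g * h : Ow) : F), by rwa [h2]⟩ : P.O) =
            ⟨s g * g, hsO g⟩ * ⟨s h * h, hsO h⟩ := Subtype.ext h2
        have h5 : (⟨s g * s h, hS _ h1⟩ : P.O) = ⟨s g, hS _ (hs g)⟩ * ⟨s h, hS _ (hs h)⟩ := rfl
        rw [h4, h5, hmul, hmul, ← he g _ (hs g), ← he h _ (hs h)]
        ring
      map_add' := fun g h => by
        have h1 := Submonoid.mul_mem _ (hs g) (hs h)
        have h2 : s g * s h * ((g + h : Ow) : F) = (s g * g) * s h + (s h * h) * s g := by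
          push_cast
          ring
        have h3 := P.O.add_mem _ _ (P.O.mul_mem _ _ (hsO g) (hS _ (hs h)))
          (P.O.mul_mem _ _ (hsO h) (hS _ (hs g)))
        refine mul_right_cancel₀ (hG0 _ h1) ?_
        rw [he (g + h) _ h1 (by rwa [h2])]
        have h4 : (⟨s g * s h * ((g + h : Ow) : F), by rwa [h2]⟩ : P.O) =
            ⟨s g * g, hsO g⟩ * ⟨s h, hS _ (hs h)⟩ + ⟨s h * h, hsO h⟩ * ⟨s g, hS _ (hs g)⟩ :=
          Subtype.ext h2
        have h5 : (⟨s g * s h, hS _ h1⟩ : P.O) = ⟨s g, hS _ (hs g)⟩ * ⟨s h, hS _ (hs h)⟩ := rfl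
        rw [h4, h5, hadd, hmul, hmul, hmul, ← he g _ (hs g), ← he h _ (hs h)]
        ring }
  have hloc : IsLocalHom eh := by
    refine ⟨fun g hg => ?_⟩
    have hg0 : e g ≠ 0 := hg.ne_zero
    let a : P.O := ⟨s g * g, hsO g⟩
    have ha : E₀ a ≠ 0 := by
      intro h0
      refine hg0 ?_
      simp only [e]
      have : G a = 0 := by simp only [G, h0, map_zero]
      rw [this, zero_mul]
    obtain ⟨i, hi⟩ : ∃ i, coeff i (E₀ a) ≠ 0 := by
      by_contra! hc
      exact ha (PowerSeries.ext fun i => by simpa using hc i)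
    have ha0 : (a : F) ≠ 0 := by
      intro h0
      have : a = 0 := Subtype.ext h0
      rw [this, map_zero] at ha
      exact ha rfl
    have hxi : x ^ i * (a : F)⁻¹ ∈ P.O := by
      by_contra hc
      have h1 : P.O.valuation ((x ^ i)⁻¹ * a) < 1 := by
        rw [ValuationSubring.lt_one_iff, mul_inv, inv_inv]
        exact Or.inr hc
      refine hi ((hcoeff a (i + 1)).2 ⟨_, hx.2.2 _ h1, ?_⟩ i (Nat.lt_succ_self i))
      have hx0 := hx.1
      field_simp
      ring
    have hinv : (g : F)⁻¹ ∈ Ow := by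
      refine ⟨x ^ i, ⟨i, rfl⟩, ?_⟩
      have h1 := P.O.mul_mem _ _ (hS _ (hs g)) hxi
      have h2 : s g * (x ^ i * (a : F)⁻¹) = x ^ i * (g : F)⁻¹ := by
        have h3 : s g ≠ 0 := left_ne_zero_of_mul ha0
        have h4 : (g : F) ≠ 0 := right_ne_zero_of_mul ha0
        simp only [a]
        field_simp
      rwa [h2] at h1
    have h4 : (g : F) ≠ 0 := right_ne_zero_of_mul ha0
    exact IsUnit.of_mul_eq_one ⟨(g : F)⁻¹, hinv⟩ (Subtype.ext (mul_inv_cancel₀ h4))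
  have hle : P.O ≤ Ow := ValuationSubring.le_loc
  let Q := FPlace.ofValuationSubring Ow
  let E : ResF Ow →+* T⸨X⸩ := IsLocalRing.ResidueField.lift eh
  have hE (g : F) (hg : g ∈ Ow) : E (Q.res g) = e ⟨g, hg⟩ := by
    have : Q.res g = IsLocalRing.residue Ow ⟨g, hg⟩ := dif_pos hg
    rw [this]
    exact IsLocalRing.ResidueField.lift_residue_apply _ _
  have hEO (a : F) (ha : a ∈ P.O) : E (Q.res a) = G ⟨a, ha⟩ := (hE a (hle ha)).trans (heO ⟨a, ha⟩ _)
  refine ⟨ResF Ow, inferInstance, Q, E, ?_, fun z => ?_, ?_, fun a ha => ?_⟩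
  · ext g
    constructor
    · rintro ⟨hg, f, hf⟩
      have hloc' : ∃ s ∈ Submonoid.powers x, s * g ∈ P.O := hg
      obtain ⟨_, ⟨n, rfl⟩, hn⟩ := hloc'
      rw [hE g hg] at hf
      have h1 := he ⟨g, hg⟩ (x ^ n) ⟨n, rfl⟩ hn
      rw [← hf, hGX, ← map_mul] at h1
      have h2 := HahnSeries.ofPowerSeries_injective h1
      obtain ⟨b, hb, h3⟩ := (hcoeff ⟨x ^ n * g, hn⟩ n).1 fun i hi => by
        rw [← h2, coeff_mul_X_pow', if_neg (by omega)]
      rw [mul_left_cancel₀ (pow_ne_zero n hx.1) h3]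
      exact hb
    · intro hg
      refine ⟨hle hg, ?_⟩
      rw [ValuationSubring.mem_comap, hEO g hg]
      exact ⟨_, rfl⟩
  · rw [hEO _ (hl z)]
    simp only [G, hC, HahnSeries.ofPowerSeries_C]
  · rw [hEO _ hxO]
    simp only [G, hX]
    rfl
  · rw [hEO _ ha]
    refine (psO_res _).trans ?_
    rw [← coeff_zero_eq_constantCoeff_apply]
    obtain ⟨q, b, hb, e⟩ := exists_polynomial_approx hl hl' hx ha 1
    rw [hE₀ ⟨a, ha⟩ q 1 b hb e 0 one_pos, ← res_eval₂ hl hl' hx.2.1,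
      P.res_eq_iff (eval₂_mem hl hxO _) ha, ← neg_sub, Valuation.map_neg, e, pow_one]
    exact P.O.mul_lt_one hx.2.1 hb

end Coarsening

section Separable

open Polynomial

/-- Two homomorphisms agreeing on a subfield over which the source is separable, and agreeing up to
elements of the maximal ideal of a local ring, are equal. -/
lemma hom_eq_of_isSeparable {k C A R : Type*} [Field k] [Field C] [Algebra k C]
    [Algebra.IsSeparable k C] [CommRing A] [IsLocalRing A] [Field R] (τ : C →+* A) (χ : A →+* R)
    (h : C →+* R) (hk : ∀ y : k, χ (τ (algebraMap k C y)) = h (algebraMap k C y)) {c : C} {b : A}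
    (hb : χ b = h c) (hbc : b - τ c ∈ IsLocalRing.maximalIdeal A) : χ (τ c) = h c := by
  have hsep := Algebra.IsSeparable.isSeparable k c
  have hxint : IsIntegral k c := hsep.isIntegral
  let q : A[X] := (minpoly k c).map (τ.comp (algebraMap k C))
  have hq0 : q.eval (τ c) = 0 := by
    rw [eval_map, ← hom_eval₂, ← aeval_def, minpoly.aeval, map_zero]
  have hq1 : IsUnit (q.derivative.eval (τ c)) := by
    have h1 := Polynomial.Separable.aeval_derivative_ne_zero hsep (minpoly.aeval k c)
    rw [derivative_map, eval_map, ← hom_eval₂, ← aeval_def]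
    exact (IsUnit.mk0 _ h1).map τ
  have hqb : χ (q.eval b) = 0 := by
    have e : χ.comp (τ.comp (algebraMap k C)) = h.comp (algebraMap k C) := RingHom.ext hk
    rw [eval_map, hom_eval₂, hb, e, ← hom_eval₂, ← aeval_def, minpoly.aeval, map_zero]
  obtain ⟨r, hr⟩ := q.binomExpansion (τ c) (b - τ c)
  rw [add_sub_cancel, hq0, zero_add] at hr
  have hu : IsUnit (q.derivative.eval (τ c) + r * (b - τ c)) := by
    by_contra hc
    have h1 := Ideal.sub_mem _ ((IsLocalRing.mem_maximalIdeal _).2 hc) (Ideal.mul_mem_left _ r hbc)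
    rw [add_sub_cancel_right] at h1
    exact (IsLocalRing.mem_maximalIdeal _).1 h1 hq1
  have h2 : χ (b - τ c) * χ (q.derivative.eval (τ c) + r * (b - τ c)) = 0 := by
    rw [← map_mul, ← hqb, hr]
    congr 1
    ring
  have h3 := (mul_eq_zero.1 h2).resolve_right (hu.map χ).ne_zero
  rw [map_sub, hb, sub_eq_zero] at h3
  exact h3.symm

lemma hom_eq_on_adjoin {C R : Type*} [Field C] [Field R] (C₀ : Subfield C) (t : C) (f g : C →+* R)
    (h₀ : ∀ c ∈ C₀, f c = g c) (ht : f t = g t) (y : IntermediateField.adjoin C₀ {t}) :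
    f (y : C) = g (y : C) := by
  let K : IntermediateField C₀ C := (f.eqLocusField g).toIntermediateField fun x => h₀ _ x.2
  have : IntermediateField.adjoin C₀ {t} ≤ K := by
    rw [IntermediateField.adjoin_le_iff, Set.singleton_subset_iff]
    exact ht
  exact this y.2

end Separable

section Target

open LaurentSeries

lemma sepP_of_psO {p : ℕ} [Fact p.Prime] {C : Type} [Field C] [CharP C p] (t : C) (C₀ : Subfield C)
    [PerfectField C₀] [Algebra.IsSeparable (IntermediateField.adjoin C₀ {t}) C]
    {T : Type} [Field T] {s : T} (D : C →+* T⸨X⸩) (hDt : D t = HahnSeries.C s ^ p + psX T) :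
    SepP p D := by
  have : CharP T⸨X⸩ p := charP_of_injective_ringHom D.injective p
  refine SepP.of_not_pow t C₀ _ fun f hf => ?_
  refine (psX_unif (K := T)).pow_ne (Fact.out : p.Prime).one_lt (f - HahnSeries.C s) ?_
  rw [sub_pow_char, hf, hDt, add_sub_cancel_left]

/-- The transfer of existential sentences from a power series ring. -/
lemma emb_of_psO {p : ℕ} [Fact p.Prime] {C : Type} [Field C] [CharP C p] (t : C) (C₀ : Subfield C)
    [PerfectField C₀] [Algebra.IsSeparable (IntermediateField.adjoin C₀ {t}) C]
    {T F K : Type} [Field T] [Field F] [Field K] (P : FPlace F K) (hP : HenF P.O) (ι : C →+* F)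
    (hι : ∀ c, ι c ∈ P.O) (hU : UnifPow P.O p (ι t)) (κ : C →+* T)
    (h : Emb κ Set.univ (P.resHom ι hι) Set.univ) {s : T} (hs : s ^ p = κ t) (D : C →+* T⸨X⸩)
    (hD₀ : ∀ c ∈ C₀, D c = HahnSeries.C (κ c)) (hDt : D t = HahnSeries.C s ^ p + psX T)
    (hDO : ∀ c, D c ∈ psO T) (hDκ : ∀ c, (D c).coeff 0 = κ c) : Emb D (psO T) ι P.O := by
  have : CharP C₀ p := C₀.subtype.charP C₀.subtype.injective p
  obtain ⟨G, R, _, _, P₂, θ, σ, hG, hθ, hθO, hσ, hσθ, hσ₀⟩ :=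
    P.exists_lift_of_emb hP ι hι κ h C₀.subtype (SepP.of_perfect _)
  have hθι (c) : θ (ι c) ∈ P₂.O := (hθO _).2 (hι c)
  have hπ : P₂.O.valuation (θ (ι t) - σ s ^ p) < 1 := by
    rw [← map_pow, hs, ← P₂.res_eq_iff (hθι t) (hσ _), hσθ]
  have hπU := UnifPow.of_emb (ιA := θ.comp ι) (ιB := ι) (hθ.comp ι) hU (σ s) hπ
  refine Emb.trans ?_ (hθ.comp ι)
  refine Emb.powerSeries hG σ hσ hπ hπU.1 D (θ.comp ι) hθι (p := p) ?_
    fun U R' _ Q φ hle h1 h2 h3 c => ?_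
  · exact sepP_of_psO t C₀ D hDt
  · have hτO (c) : upConst U G (θ (ι c)) ∈ upO U P₂.O := (upConst_mem_upO U).2 (hθι c)
    let τ : C →+* upO U P₂.O := ((upConst U G).comp (θ.comp ι)).codRestrict (upO U P₂.O).toSubring hτO
    let χ : upO U P₂.O →+* R' := Q.hom.comp (ValuationSubring.inclusion _ _ hle)
    obtain ⟨g, hg, hφg, hg1⟩ := h3 _ (hDO c)
    have hagree (y : IntermediateField.adjoin C₀ {t}) : (χ.comp τ) y = (φ.comp D) y := by
      refine hom_eq_on_adjoin C₀ t _ _ (fun y hy => ?_) ?_ y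
      · rw [RingHom.comp_apply φ, hD₀ y hy, h1]
        exact congrArg (fun z => Q.res (upConst U G z)) (hσ₀ ⟨y, hy⟩).symm
      · rw [RingHom.comp_apply φ, hDt, map_add, h2, map_pow, h1]
        have hπ1 := P₂.O.mem_of_lt_one hπ
        have e : upConst U G (θ (ι t)) = upConst U G (σ s) ^ p + upConst U G (θ (ι t) - σ s ^ p) := by
          rw [map_sub, map_pow, add_sub_cancel]
        have h4 : upConst U G (σ s) ∈ Q.O := hle ((upConst_mem_upO U).2 (hσ s))
        rw [← Q.res_pow h4, ← Q.res_add _ (Q.O.pow_mem' h4 p) _ (hle ((upConst_mem_upO U).2 hπ1)), ← e]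
        rfl
    refine hom_eq_of_isSeparable (k := IntermediateField.adjoin C₀ {t}) τ χ (φ.comp D) hagree
      (b := ⟨g, hg⟩) hφg.symm ?_
    have h4 : P₂.O.valuation (θ (ι c) - σ (κ c)) < 1 := by
      rw [← P₂.res_eq_iff (hθι c) (hσ _), hσθ]
    rw [hDκ] at hg1
    have h5 := (upO U P₂.O).sub_lt_one hg1 ((upConst_lt_one U).2 h4)
    rw [map_sub (upConst U G), sub_sub_sub_cancel_right] at h5
    rw [ValuationSubring.valuation_lt_one_iff]
    exact h5

end Target

section AlgebraicCase

open LaurentSeries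

/-- The approximate embedding when the distinguished element has a root in the residue field. -/
lemma emb_of_pow (r4 : R4) {p : ℕ} [Fact p.Prime] {C : Type} [Field C] [CharP C p] (t : C)
    (C₀ : Subfield C) [PerfectField C₀] [Algebra.IsSeparable (IntermediateField.adjoin C₀ {t}) C]
    {F K F' K' : Type} [Field F] [Field K] [Field F'] [Field K'] (P : FPlace F K) (P' : FPlace F' K')
    (ι : C →+* F) (hι : ∀ c, ι c ∈ P.O) (ι' : C →+* F') (hι' : ∀ c, ι' c ∈ P'.O)
    (hP : HenF P.O) (hP' : HenF P'.O) (hU : UnifPow P.O p (ι t)) (hU' : UnifPow P'.O p (ι' t))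
    (h : Emb (P.resHom ι hι) Set.univ (P'.resHom ι' hι') Set.univ)
    {s : K} (hs : s ^ p = P.resHom ι hι t) : Emb ι P.O ι' P'.O := by
  have : CharP C₀ p := C₀.subtype.charP C₀.subtype.injective p
  let X : SectionDatum p :=
    { k := C₀, F := F, R := K, P := P, V := ⊤, ι := ι.comp C₀.subtype
      κ := (P.resHom ι hι).comp C₀.subtype, mem := fun _ => hι _
      res_eq := fun _ => rfl
      hen := by rwa [P.comp_top]
      sep := SepP.of_perfect _ }
  obtain ⟨F₁, K₁, _, _, P₁, V₁, j, r, l, hj, hjr, -, hl, hl', hlr, hen₁, hr, hjE⟩ := X.exists_limit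
  have hP₁ : HenF P₁.O := hen₁.coarsen (P₁.comp_le _)
  let x : F₁ := j (ι t) - l (r s) ^ p
  have hjι (c) : j (ι c) ∈ P₁.O := (hj _).2 (hι c)
  have hjιr (c) : P₁.res (j (ι c)) = r (P.resHom ι hι c) := hjr _
  have hx : Unif P₁.O x := by
    refine UnifPow.of_emb (hjE.comp ι) hU _ ?_
    change P₁.O.valuation (j (ι t) - _) < 1
    rw [← map_pow, ← P₁.res_eq_iff (hjι t) (hl _), hl', hjιr, ← hs, map_pow]
  obtain ⟨R, _, Q, E, hQ, hEl, hEx, hE0⟩ := exists_coarsening hl hl' hx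
  let V := (psO K₁).comap E
  have hιQ (c) : (j.comp ι) c ∈ Q.O := Q.comp_le V (hQ ▸ hjι c)
  let κ : C →+* R := Q.resHom (j.comp ι) hιQ
  let D : C →+* K₁⸨X⸩ := E.comp κ
  let κ₁ : C →+* K₁ := r.comp (P.resHom ι hι)
  have hlQ (z) : l z ∈ Q.O := Q.comp_le V (hQ ▸ hl z)
  have hxQ : x ∈ Q.O := Q.comp_le V (hQ ▸ P₁.O.mem_of_lt_one hx.2.1)
  have hDt : D t = HahnSeries.C (r s) ^ p + psX K₁ := by
    have e : j (ι t) = l (r s) ^ p + x := by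
      simp only [x]
      ring
    change E (Q.res (j (ι t))) = _
    rw [e, Q.res_add _ (Q.O.pow_mem' (hlQ _) p) _ hxQ, map_add, Q.res_pow (hlQ _), map_pow, hEl, hEx]
  have e5 : Emb D (psO K₁) ι' P'.O := by
    refine emb_of_psO t C₀ P' hP' ι' hι' hU' κ₁ ((hr.univ.comp (P.resHom ι hι)).trans h)
      (s := r s) ?_ D (fun c hc => ?_) hDt (fun c => ?_) fun c => ?_
    · rw [← map_pow, hs]
      rfl
    · change E (Q.res (j (ι c))) = _
      have : l (r (P.resHom ι hι c)) = j (ι c) := hlr ⟨c, hc⟩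
      rw [← this, hEl]
      rfl
    · have : j (ι c) ∈ Q.comp V := hQ ▸ hjι c
      exact this.2
    · exact (hE0 _ (hjι c)).trans (hjιr c)
  have e4 : Emb κ V D (psO K₁) := Emb.of_ringHom E (fun _ => Iff.rfl) fun _ => rfl
  let Y : SectionDatum p :=
    { k := C, F := F₁, R := R, P := Q, V := V, ι := j.comp ι, κ := κ, mem := hιQ
      res_eq := fun _ => rfl
      hen := hQ ▸ hP₁
      sep := SepP.of_comp E (sepP_of_psO t C₀ D hDt) }
  obtain ⟨F₂, R₂, _, _, P₂, V₂, j₂, r₂, l₂, hj₂, hjr₂, hrV₂, hl₂, hl₂', hlr₂, hen₂, hr₂, -⟩ :=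
    Y.exists_limit
  have e1 : Emb ι P.O (j.comp ι) P₁.O := Emb.of_ringHom j hj fun _ => rfl
  have e2 : Emb (j.comp ι) P₁.O (j₂.comp (j.comp ι)) (P₂.comp V₂) := by
    refine Emb.of_ringHom j₂ (fun a => ?_) fun _ => rfl
    rw [← hQ]
    change (j₂ a ∈ P₂.O ∧ P₂.res (j₂ a) ∈ V₂) ↔ (a ∈ Q.O ∧ Q.res a ∈ V)
    rw [hj₂, hjr₂, hrV₂]
  have hxV : Unif V (Q.res x) := by
    refine Emb.unif (ιA := id) (ιB := E) (W := psO K₁) (Emb.of_ringHom E (fun _ => Iff.rfl) fun _ => rfl) ?_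
    rw [hEx]
    exact psX_unif
  have hxV₂ : Unif V₂ (r₂ (Q.res x)) := Emb.unif hr₂ hxV
  have : CharP R₂ p := charP_of_injective_ringHom (r₂.comp κ).injective p
  have e3 : Emb (j₂.comp (j.comp ι)) (P₂.comp V₂) (r₂.comp κ) V₂ := by
    have := emb_comp_of_r4 r4 (p := p) P₂ l₂ hl₂ hl₂' hen₂.of_comp hxV₂ (fun a ha => hen₂.quad ha)
      (r₂.comp κ)
    have e : ⇑l₂ ∘ ⇑(r₂.comp κ) = j₂.comp (j.comp ι) := funext hlr₂
    rwa [e] at this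
  exact (((e1.trans e2).trans e3).trans (hr₂.comp κ)).trans (e4.trans e5)

end AlgebraicCase

section Final

lemma URt.unifPow {F : Type*} [Field F] {O : ValuationSubring F} {p : ℕ} {t : F} (h : URt O p t)
    (hne : O ≠ ⊤) : UnifPow O p t := by
  intro s hs
  have hu := (h s).resolve_left (not_le.2 hs)
  obtain ⟨π, hπ0, hπ⟩ := ValuationSubring.exists_lt_one hne
  have h0 : t - s ^ p ≠ 0 := by
    intro h0
    have h1 := hu.2 π hπ
    rw [h0, map_zero, le_zero_iff, Valuation.zero_iff] at h1
    exact hπ0 h1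
  refine ⟨h0, hs, fun y hy => ?_⟩
  rw [← ValuationSubring.valuation_le_one_iff, map_mul, map_inv₀]
  exact inv_mul_le_one_of_le₀ (hu.2 y hy) zero_le

/-- The transfer of existential sentences between valued fields whose residue fields satisfy the same
existential sentences. -/
lemma emb_of_URt (r4 : R4) {C : Type} [Field C] {p : ℕ} [Fact p.Prime] [CharP C p] (t : C)
    (C₀ : Subfield C) [PerfectField C₀] [Algebra.IsSeparable (IntermediateField.adjoin C₀ {t}) C]
    {F F' : Type} [Field F] [Field F'] {O : ValuationSubring F} {O' : ValuationSubring F'}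
    {ι : C →+* F} {ι' : C →+* F'} (hι : ∀ c, ι c ∈ O) (hι' : ∀ c, ι' c ∈ O')
    (hO : HenselianLocalRing O) (hO' : HenselianLocalRing O') (hne : O ≠ ⊤) (hne' : O' ≠ ⊤)
    (hU : URt O p (ι t)) (hU' : URt O' p (ι' t))
    (hres : ∀ ψ : (Language.ring[[C]]).Sentence, IsExistentialSen ψ →
      SatRC C (ResF O) (resConstExt O ι) ψ → SatRC C (ResF O') (resConstExt O' ι') ψ) :
    Emb ι O ι' O' := by
  have h := emb_univ_of_satRC hres
  have hH := HenF.of_henselianLocalRing hO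
  have hH' := HenF.of_henselianLocalRing hO'
  let P := FPlace.ofValuationSubring O
  let P' := FPlace.ofValuationSubring O'
  have h' : Emb (P.resHom ι hι) Set.univ (P'.resHom ι' hι') Set.univ := h
  by_cases hs : ∃ s, s ^ p = P.resHom ι hι t
  · obtain ⟨s, hs⟩ := hs
    exact emb_of_pow r4 t C₀ P P' ι hι ι' hι' hH hH' (hU.unifPow hne) (hU'.unifPow hne') h' hs
  · exact emb_of_forall_pow_ne r4 t C₀ P P' ι hι ι' hι' hH hH' hne' h' fun s hs' => hs ⟨s, hs'⟩

end Final

section UniversalExistential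

variable {L : Language} {M N : Type*} [L.Structure M] [L.Structure N]

lemma realize_alls_iff_not_exs_not {n : ℕ} (ψ : L.BoundedFormula Empty n) :
    Sentence.Realize M ψ.alls ↔ ¬ Sentence.Realize M ψ.not.exs := by
  have h1 := BoundedFormula.realize_alls (M := M) (φ := ψ) (v := default)
  have h2 := BoundedFormula.realize_exs (M := M) (φ := ψ.not) (v := default)
  refine h1.trans (Iff.trans ?_ (not_congr h2).symm)
  simp

lemma realize_iff_of_isUE (h : ∀ φ : L.Sentence, IsExistentialSen φ →
    (Sentence.Realize M φ ↔ Sentence.Realize N φ)) {φ : L.Sentence} (hφ : IsUE φ) :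
    Sentence.Realize M φ ↔ Sentence.Realize N φ := by
  induction hφ with
  | ex hφ => exact h _ hφ
  | all hφ =>
    obtain ⟨n, ψ, hψ, rfl⟩ := hφ
    rw [realize_alls_iff_not_exs_not, realize_alls_iff_not_exs_not, h _ ⟨n, _, hψ.not, rfl⟩]
  | inf _ _ ih₁ ih₂ => exact Formula.realize_inf.trans ((and_congr ih₁ ih₂).trans Formula.realize_inf.symm)
  | sup _ _ ih₁ ih₂ => exact Formula.realize_sup.trans ((or_congr ih₁ ih₂).trans Formula.realize_sup.symm)

end UniversalExistential

/-- Proposition 5.5: assuming (R4), henselian nontrivially valued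
fields extending the trivially valued field `C` (where `C/C₀(t)` is separable algebraic
over a perfect `C₀`) satisfying `UR(t)` and whose residue fields have the same
universal/existential `𝔏_ring(C)`-theory have the same universal/existential
`𝔏_val(C)`-theory. -/
theorem UE_val_theory_eq_of_URt (r4 : R4) (C : Type) [Field C] (p : ℕ) (hp : p.Prime)
    (hchar : CharP C p) (t : C) (C₀ : Subfield C) (hperf : PerfectField ↥C₀)
    (hsep : Algebra.IsSeparable ↥(IntermediateField.adjoin C₀ {t}) C)
    (F : Type) [Field F] (O : ValuationSubring F) (ι : C →+* F)
    (F' : Type) [Field F'] (O' : ValuationSubring F') (ι' : C →+* F')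
    (hTriv : ∀ c, ι c ∈ O) (hTriv' : ∀ c, ι' c ∈ O')
    (hHens : HenselianLocalRing ↥O) (hHens' : HenselianLocalRing ↥O')
    (hNontriv : O ≠ ⊤) (hNontriv' : O' ≠ ⊤)
    (hUR : URt O p (ι t)) (hUR' : URt O' p (ι' t))
    (hres : ∀ ψ : (Language.ring[[C]]).Sentence, IsUE ψ →
      (SatRC C (ResF O) (resConstExt O ⇑ι) ψ ↔ SatRC C (ResF O') (resConstExt O' ⇑ι') ψ)) :
    ∀ φ : (Lval[[C]]).Sentence, IsUE φ →
      (SatVC C (⇑ι) O φ ↔ SatVC C (⇑ι') O' φ) := by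
  have := Fact.mk hp
  have h : Emb ι O ι' O' := emb_of_URt r4 t C₀ hTriv hTriv' hHens hHens' hNontriv hNontriv' hUR hUR'
    fun ψ hψ => (hres ψ (IsUE.ex hψ)).1
  have h' : Emb ι' O' ι O := emb_of_URt r4 t C₀ hTriv' hTriv hHens' hHens hNontriv' hNontriv hUR' hUR
    fun ψ hψ => (hres ψ (IsUE.ex hψ)).2
  let := valCStructure C F ι O
  let := valCStructure C F' ι' O'
  exact fun φ hφ => realize_iff_of_isUE (fun ψ hψ => ⟨h.satVC hψ, h'.satVC hψ⟩) hφ
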